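/- Let P(z) = z^2 + v be a quadratic polynomial with a fixed Cremer point, i.e., there is p ∈ ℂ with P(p) = p, P'(p) = e^{2πiρ} for some irrational ρ ∈ ℝ, and P is not linearizable at p (there is no open neighborhood U of p and injective holomorphic map h : U → ℂ with h(p) = 0 such that h(P(z)) = P'(p)·h(z) for all z ∈ U with P(z) ∈ U). Let J_P be the Julia set of P. If φ : J_P → A is a monotone map from J_P onto a nonempty compact connected locally connected metric space A, then A is a single point. -/

import Mathlib

namespace CremerJulia
open Set Filter Topology Metric

/-- `f` admits a continuous logarithm on `X`. -/
def HasLog (f : ℂ → ℂ) (X : Set ℂ) : Prop :=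
  ∃ l : ℂ → ℂ, ContinuousOn l X ∧ ∀ z ∈ X, Complex.exp (l z) = f z

theorem HasLog.mono {f : ℂ → ℂ} {X Y : Set ℂ} (h : HasLog f X) (hY : Y ⊆ X) : HasLog f Y := by
  obtain ⟨l, hl, he⟩ := h
  exact ⟨l, hl.mono hY, fun z hz => he z (hY hz)⟩

theorem HasLog.congr {f g : ℂ → ℂ} {X : Set ℂ} (h : HasLog f X) (hfg : ∀ z ∈ X, f z = g z) :
    HasLog g X := by
  obtain ⟨l, hl, he⟩ := h
  exact ⟨l, hl, fun z hz => (he z hz).trans (hfg z hz)⟩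

theorem HasLog.mul {f g : ℂ → ℂ} {X : Set ℂ} (hf : HasLog f X) (hg : HasLog g X) :
    HasLog (fun z => f z * g z) X := by
  obtain ⟨l, hl, he⟩ := hf
  obtain ⟨m, hm, hm'⟩ := hg
  exact ⟨fun z => l z + m z, hl.add hm, fun z hz => by rw [Complex.exp_add, he z hz, hm' z hz]⟩

theorem HasLog.inv {f : ℂ → ℂ} {X : Set ℂ} (hf : HasLog f X) :
    HasLog (fun z => (f z)⁻¹) X := by
  obtain ⟨l, hl, he⟩ := hf
  exact ⟨fun z => - l z, hl.neg, fun z hz => by rw [Complex.exp_neg, he z hz]⟩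

theorem hasLog_const {c : ℂ} (hc : c ≠ 0) (X : Set ℂ) : HasLog (fun _ => c) X :=
  ⟨fun _ => Complex.log c, continuousOn_const, fun _ _ => Complex.exp_log hc⟩

theorem hasLog_of_slitPlane {f : ℂ → ℂ} {X : Set ℂ} (hf : ContinuousOn f X)
    (h : ∀ z ∈ X, f z ∈ Complex.slitPlane) : HasLog f X :=
  ⟨fun z => Complex.log (f z), hf.clog h,
    fun z hz => Complex.exp_log (Complex.slitPlane_ne_zero (h z hz))⟩

theorem eq_of_exp_eq_of_norm_lt {a b : ℂ} (h : Complex.exp a = Complex.exp b)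
    (hab : ‖a - b‖ < 2 * Real.pi) : a = b := by
  obtain ⟨n, hn⟩ := Complex.exp_eq_exp_iff_exists_int.1 h
  have h1 : a - b = n * (2 * Real.pi * Complex.I) := by rw [hn]; ring
  rw [h1] at hab
  have h2 : ‖(n : ℂ) * (2 * Real.pi * Complex.I)‖ = |(n : ℝ)| * (2 * Real.pi) := by
    simp [abs_of_pos Real.pi_pos]
  rw [h2] at hab
  have hpi := Real.pi_pos
  have h3 : |(n : ℝ)| < 1 := by
    by_contra h4
    push Not at h4
    nlinarith
  have h5 : n = 0 := by
    have : |n| < 1 := by exact_mod_cast h3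
    exact Int.abs_lt_one_iff.1 this
  subst h5
  simpa using hn

/-- A continuous function on a preconnected set whose exponential is constant is constant. -/
theorem eq_of_exp_const {α : Type*} [TopologicalSpace α] {X : Set α} (hX : IsPreconnected X)
    {f : α → ℂ} (hf : ContinuousOn f X)
    (h : ∀ x ∈ X, ∀ y ∈ X, Complex.exp (f x) = Complex.exp (f y)) {x y : α}
    (hx : x ∈ X) (hy : y ∈ X) : f x = f y := by
  refine hX.induction₂ (fun a b => f a = f b) (fun a ha => ?_)
    (fun a b c _ _ _ h1 h2 => h1.trans h2) (fun a b _ _ h1 => h1.symm) hx hy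
  have h1 := (hf a ha) (Metric.ball_mem_nhds (f a) one_pos)
  filter_upwards [h1, self_mem_nhdsWithin] with b hb hbX
  refine eq_of_exp_eq_of_norm_lt (h a ha b hbX) ?_
  rw [← dist_eq_norm, dist_comm]
  have : dist (f b) (f a) < 1 := hb
  linarith [Real.pi_gt_three]

theorem one_add_mem_slitPlane {w : ℂ} (hw : ‖w‖ < 1) : 1 + w ∈ Complex.slitPlane := by
  left
  have := Complex.abs_re_le_norm w
  have := neg_abs_le w.re
  simp only [Complex.add_re, Complex.one_re]
  linarith

/-- If `a`, `b` are joined by a preconnected set in the complement of the closed set `X`,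
then `(z - a) / (z - b)` has a continuous logarithm on `X`. -/
theorem hasLog_div {X C : Set ℂ} (hX : IsClosed X) (hC : IsPreconnected C) (hCX : Disjoint C X)
    {a b : ℂ} (ha : a ∈ C) (hb : b ∈ C) : HasLog (fun z => (z - a) / (z - b)) X := by
  have hne : ∀ c ∈ C, ∀ z ∈ X, z - c ≠ 0 := fun c hc z hz h0 =>
    Set.disjoint_left.1 hCX hc ((sub_eq_zero.1 h0) ▸ hz)
  refine hC.induction₂ (fun a b => HasLog (fun z => (z - a) / (z - b)) X) (fun c hc => ?_)
    (fun x y w hx hy hw h1 h2 => ?_) (fun x y hx hy h1 => ?_) ha hb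
  · have hcX : Xᶜ ∈ 𝓝 c := hX.isOpen_compl.mem_nhds (Set.disjoint_left.1 hCX hc)
    obtain ⟨δ, hδ, hball⟩ := Metric.mem_nhds_iff.1 hcX
    filter_upwards [mem_nhdsWithin_of_mem_nhds (Metric.ball_mem_nhds c hδ), self_mem_nhdsWithin]
      with b hb hbC
    have key : HasLog (fun z => (z - b) / (z - c)) X := by
      refine hasLog_of_slitPlane ?_ fun z hz => ?_
      · exact (continuousOn_id.sub continuousOn_const).div
          (continuousOn_id.sub continuousOn_const) fun z hz => hne c hc z hz
      · have h1 : (z - b) / (z - c) = 1 + (c - b) / (z - c) := by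
          field_simp [hne c hc z hz]; ring
        rw [h1]
        apply one_add_mem_slitPlane
        rw [norm_div, div_lt_one (norm_pos_iff.2 (hne c hc z hz))]
        have h2 : δ ≤ ‖z - c‖ := by
          by_contra h3
          push Not at h3
          exact hball (by rw [Metric.mem_ball, dist_eq_norm]; exact h3) hz
        have h3 : ‖c - b‖ < δ := by
          rw [← dist_eq_norm, dist_comm]; exact hb
        linarith
    exact key.inv.congr fun z hz => by rw [inv_div]
  · exact (h1.mul h2).congr fun z hz => by
      field_simp [hne y hy z hz, hne w hw z hz]
  · exact h1.inv.congr fun z hz => by rw [inv_div]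

/-- If `a` is joined to infinity by a preconnected set in the complement of the compact set `X`,
then `z - a` has a continuous logarithm on `X`. -/
theorem hasLog_sub_of_unbounded {X C : Set ℂ} (hX : IsCompact X) (hC : IsPreconnected C)
    (hCX : Disjoint C X) (hunb : ¬ Bornology.IsBounded C) {a : ℂ} (ha : a ∈ C) :
    HasLog (fun z => z - a) X := by
  obtain ⟨M, hM0, hM⟩ := hX.isBounded.exists_pos_norm_lt
  obtain ⟨b, hb, hbM⟩ : ∃ b ∈ C, M < ‖b‖ := by
    by_contra h
    push Not at h
    exact hunb (isBounded_iff_forall_norm_le.2 ⟨M, h⟩)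
  have hb0 : b ≠ 0 := by
    rintro rfl
    simp at hbM; linarith
  have hne : ∀ c ∈ C, ∀ z ∈ X, z - c ≠ 0 := fun c hc z hz h0 =>
    Set.disjoint_left.1 hCX hc ((sub_eq_zero.1 h0) ▸ hz)
  have h1 : HasLog (fun z => 1 + (- (z / b))) X := by
    refine hasLog_of_slitPlane (by fun_prop) fun z hz => one_add_mem_slitPlane ?_
    rw [norm_neg, norm_div, div_lt_one (norm_pos_iff.2 hb0)]
    linarith [hM z hz]
  refine ((hasLog_div hX.isClosed hC hCX ha hb).mul
    ((hasLog_const (neg_ne_zero.2 hb0) X).mul h1)).congr fun z hz => ?_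
  have := hne b hb z hz
  field_simp
  ring

/-- There is no continuous logarithm on a connected set symmetric about the origin. -/
theorem not_hasLog_id_of_neg_mem {X : Set ℂ} (hX : IsPreconnected X) (hne : X.Nonempty)
    (hneg : ∀ z ∈ X, -z ∈ X) : ¬ HasLog (fun z => z) X := by
  rintro ⟨l, hl, he⟩
  obtain ⟨x, hx⟩ := hne
  have h0 : ∀ z ∈ X, z ≠ 0 := fun z hz => by
    have h1 : Complex.exp (l z) = z := he z hz
    rw [← h1]; exact Complex.exp_ne_zero _
  have hc : ContinuousOn (fun z => l (-z) - l z) X :=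
    (hl.comp continuousOn_neg fun z hz => hneg z hz).sub hl
  have hexp : ∀ z ∈ X, Complex.exp (l (-z) - l z) = -1 := fun z hz => by
    rw [Complex.exp_sub, he _ (hneg z hz), he z hz, neg_div, div_self (h0 z hz)]
  have h1 := eq_of_exp_const hX hc (fun a ha b hb => by rw [hexp a ha, hexp b hb]) hx (hneg x hx)
  simp only [neg_neg] at h1
  have h2 : l (-x) - l x = 0 := by linear_combination (1 / 2 : ℂ) * h1
  have h3 := hexp x hx
  rw [h2, Complex.exp_zero] at h3
  norm_num at h3

theorem isSimplyConnected_of_convex {X : Set ℂ} (hX : Convex ℝ X) (hne : X.Nonempty) :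
    IsSimplyConnected X := by
  have := hX.contractibleSpace hne
  exact SimplyConnectedSpace.ofContractible X

theorem hasLog_of_convex {X : Set ℂ} (hX : Convex ℝ X) (hXo : IsOpen X)
    {q : ℂ → ℂ} (hq : ContinuousOn q X) (h0 : ∀ z ∈ X, q z ≠ 0) : HasLog q X := by
  rcases X.eq_empty_or_nonempty with rfl | hne
  · exact ⟨q, hq, by simp⟩
  obtain ⟨f, hf, he⟩ := Complex.exists_continuousOn_eqOn_exp_comp
    (isSimplyConnected_of_convex hX hne) hXo hq (by rintro ⟨z, hz, h⟩; exact h0 z hz h)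
  exact ⟨f, hf, fun z hz => he hz⟩

/-- For a bounded open set `B` containing `a`, and a zero-free continuous `u` on its closure,
`(z - a) / u z` has no continuous logarithm on the frontier of `B`. -/
theorem not_hasLog_frontier {B : Set ℂ} (hbd : Bornology.IsBounded B) {a : ℂ}
    (ha : a ∈ B) {u : ℂ → ℂ} (hu : ContinuousOn u (closure B)) (hu0 : ∀ z ∈ closure B, u z ≠ 0) :
    ¬ HasLog (fun z => (z - a) / u z) (frontier B) := by
  classical
  rintro ⟨l, hl, he⟩
  obtain ⟨L, hL⟩ := ContinuousMap.exists_restrict_eq (Y := ℂ) (isClosed_frontier (s := B))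
    ⟨(frontier B).domRestrict l, hl.domRestrict⟩
  have hLl : ∀ z ∈ frontier B, L z = l z := fun z hz => by
    exact DFunLike.congr_fun hL ⟨z, hz⟩
  set q : ℂ → ℂ := B.piecewise (fun z => Complex.exp (L z) * u z) (fun z => z - a) with hq
  have hqc : Continuous q := by
    refine continuous_piecewise (fun z hz => ?_) ?_ (by fun_prop)
    · rw [hLl z hz, he z hz, div_mul_cancel₀ _ (hu0 z (frontier_subset_closure hz))]
    · exact (Complex.continuous_exp.comp L.continuous).continuousOn.mul hu
  have hq0 : ∀ z, q z ≠ 0 := by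
    intro z
    by_cases hz : z ∈ B
    · rw [hq, Set.piecewise_eq_of_mem _ _ _ hz]
      exact mul_ne_zero (Complex.exp_ne_zero _) (hu0 z (subset_closure hz))
    · rw [hq, Set.piecewise_eq_of_notMem _ _ _ hz]
      exact fun h => hz ((sub_eq_zero.1 h) ▸ ha)
  obtain ⟨m, hm, hme⟩ := hasLog_of_convex convex_univ isOpen_univ hqc.continuousOn fun z _ => hq0 z
  obtain ⟨M, hM0, hM⟩ := hbd.exists_pos_norm_lt
  refine not_hasLog_id_of_neg_mem (X := sphere (0 : ℂ) (M + ‖a‖)) ?_ ?_ (by simp) ?_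
  · exact (isConnected_sphere (by simp) 0 (by positivity)).isPreconnected
  · exact NormedSpace.sphere_nonempty.2 (by positivity)
  · refine ⟨fun z => m (z + a), ?_, fun z hz => ?_⟩
    · exact (continuousOn_univ.1 hm |>.comp (by fun_prop)).continuousOn
    · rw [hme _ (mem_univ _), hq, Set.piecewise_eq_of_notMem]
      · ring
      · intro h
        have h1 := hM _ h
        have h2 : ‖z‖ = M + ‖a‖ := by simpa using hz
        have h3 : ‖z‖ ≤ ‖z + a‖ + ‖a‖ := by
          calc ‖z‖ = ‖(z + a) - a‖ := by ring_nf
            _ ≤ _ := norm_sub_le _ _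
        linarith

/-- Crossing lemma: if the compact connected-minus-a-point set `Z` crosses a short segment
exactly at `s`, and reaches `s` from both sides, then the ends of the segment
are separated by `Z`. -/
theorem false_of_jump {Z C : Set ℂ} (hZ : IsClosed Z) {s d : ℂ} {η : ℝ} (hη : 0 < η) (hd : d ≠ 0)
    (hs : s ∈ Z) (hpre : IsPreconnected (Z \ {s}))
    (hseg : ∀ y : ℝ, |y| ≤ η → s + y * Complex.I * d ∈ Z → y = 0)
    (hpos : s ∈ closure (Z ∩ {z | 0 < ((z - s) / d).re}))
    (hneg : s ∈ closure (Z ∩ {z | ((z - s) / d).re < 0}))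
    (hC : IsPreconnected C) (hCZ : Disjoint C Z)
    (ha : s + η * Complex.I * d ∈ C) (hb : s - η * Complex.I * d ∈ C) : False := by
  obtain ⟨l, hl, he⟩ := hasLog_div hZ hC hCZ ha hb
  have haZ : s + η * Complex.I * d ∉ Z := Set.disjoint_left.1 hCZ ha
  have hbZ : s - η * Complex.I * d ∉ Z := Set.disjoint_left.1 hCZ hb
  set m : ℂ → ℂ := fun z => (z - (s + η * Complex.I * d)) / (z - (s - η * Complex.I * d)) with hm
  have hne : ∀ z ∈ Z, (z - s) / d + η * Complex.I ≠ 0 := by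
    intro z hz h0
    apply hbZ
    have : z = s - η * Complex.I * d := by
      field_simp at h0
      linear_combination h0
    rwa [← this]
  have hmy : ∀ z, m z = ((z - s) / d - η * Complex.I) / ((z - s) / d + η * Complex.I) := by
    intro z
    have h1 : z - (s + η * Complex.I * d) = ((z - s) / d - η * Complex.I) * d := by
      field_simp; ring
    have h2 : z - (s - η * Complex.I * d) = ((z - s) / d + η * Complex.I) * d := by
      field_simp; ring
    rw [hm]
    simp only
    rw [h1, h2, mul_div_mul_right _ _ hd]
  have him : ∀ y : ℂ, ((y - η * Complex.I) / (y + η * Complex.I)).im =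
      - (2 * η * y.re) / Complex.normSq (y + η * Complex.I) := by
    intro y
    rw [Complex.div_im]
    simp
    ring
  have hre : ∀ y : ℂ, ((y - η * Complex.I) / (y + η * Complex.I)).re =
      (y.re ^ 2 + y.im ^ 2 - η ^ 2) / Complex.normSq (y + η * Complex.I) := by
    intro y
    rw [Complex.div_re]
    simp
    ring
  have hslit : ∀ z ∈ Z \ {s}, m z ∈ Complex.slitPlane := by
    rintro z ⟨hz, hzs⟩
    rw [hmy]
    set y := (z - s) / d with hy
    have hpos' : 0 < Complex.normSq (y + η * Complex.I) := Complex.normSq_pos.2 (hne z hz)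
    rw [Complex.mem_slitPlane_iff, him, hre]
    by_contra hcon
    push Not at hcon
    obtain ⟨h1, h2⟩ := hcon
    have h2' : y.re = 0 := by
      rcases (div_eq_zero_iff.1 h2) with h | h
      · have : η * y.re = 0 := by linarith
        exact (mul_eq_zero.1 this).resolve_left hη.ne'
      · exact absurd h hpos'.ne'
    have h1' : y.im ^ 2 ≤ η ^ 2 := by
      have := (div_le_iff₀ hpos').1 h1
      rw [h2'] at this
      nlinarith
    have hyim : |y.im| ≤ η := abs_le_of_sq_le_sq h1' hη.le
    have hzy : z = s + (y.im : ℂ) * Complex.I * d := by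
      have : y = (y.im : ℂ) * Complex.I := by
        apply Complex.ext <;> simp [h2']
      rw [← this, hy]
      field_simp
      ring
    have hy0 := hseg y.im hyim (by rw [← hzy]; exact hz)
    rw [hy0] at hzy
    exact hzs (by simpa using hzy)
  have hmcont : ContinuousOn m Z := by
    refine ContinuousOn.div (by fun_prop) (by fun_prop) fun z hz h0 => hbZ ?_
    rwa [← sub_eq_zero.1 h0]
  have hc : ContinuousOn (fun z => l z - Complex.log (m z)) (Z \ {s}) :=
    (hl.mono sdiff_subset).sub ((hmcont.mono sdiff_subset).clog hslit)
  have hcexp : ∀ z ∈ Z \ {s}, Complex.exp (l z - Complex.log (m z)) = 1 := fun z hz => by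
    have h0 := Complex.slitPlane_ne_zero (hslit z hz)
    rw [Complex.exp_sub, he z hz.1, Complex.exp_log h0]
    exact div_self h0
  have hms : m s = -1 := by
    rw [hmy]
    have : (η : ℂ) * Complex.I ≠ 0 := mul_ne_zero (by exact_mod_cast hη.ne') Complex.I_ne_zero
    simp only [sub_self, zero_div, zero_sub, zero_add]
    rw [neg_div, div_self this]
  have hml := hmcont s hs
  have hll := hl s hs
  rw [ContinuousWithinAt, hms] at hml
  rw [ContinuousWithinAt] at hll
  set S1 := Z ∩ {z | 0 < ((z - s) / d).re} with hS1
  set S2 := Z ∩ {z | ((z - s) / d).re < 0} with hS2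
  have n1 : (𝓝[S1] s).NeBot := mem_closure_iff_nhdsWithin_neBot.1 hpos
  have n2 : (𝓝[S2] s).NeBot := mem_closure_iff_nhdsWithin_neBot.1 hneg
  obtain ⟨z1, hz1⟩ := closure_nonempty_iff.1 ⟨s, hpos⟩
  have hz1s : z1 ∈ Z \ {s} := ⟨hz1.1, by
    rintro rfl
    have := hz1.2
    simp at this⟩
  set c := l z1 - Complex.log (m z1) with hcdef
  have hconst : ∀ z ∈ Z \ {s}, l z = c + Complex.log (m z) := fun z hz => by
    have := eq_of_exp_const hpre hc (fun a ha b hb => by rw [hcexp a ha, hcexp b hb]) hz hz1s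
    rw [hcdef, ← this]; ring
  have t1 : Tendsto l (𝓝[S1] s) (𝓝 (c + (Real.log ‖(-1 : ℂ)‖ - Real.pi * Complex.I))) := by
    have h1 : Tendsto m (𝓝[S1] s) (𝓝[{z | z.im < 0}] (-1)) := by
      refine tendsto_nhdsWithin_iff.2 ⟨hml.mono_left (nhdsWithin_mono _ inter_subset_left), ?_⟩
      filter_upwards [self_mem_nhdsWithin] with z hz
      show (m z).im < 0
      rw [hmy, him]
      have := Complex.normSq_pos.2 (hne z hz.1)
      have h3 : 0 < ((z - s) / d).re := hz.2
      apply div_neg_of_neg_of_pos _ this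
      nlinarith
    have h2 := (Complex.tendsto_log_nhdsWithin_im_neg_of_re_neg_of_im_zero (z := -1)
      (by simp) (by simp)).comp h1
    refine (h2.const_add c).congr' ?_
    filter_upwards [self_mem_nhdsWithin] with z hz
    refine (hconst z ⟨hz.1, ?_⟩).symm
    rintro rfl
    have := hz.2
    simp at this
  have t2 : Tendsto l (𝓝[S2] s) (𝓝 (c + (Real.log ‖(-1 : ℂ)‖ + Real.pi * Complex.I))) := by
    have h1 : Tendsto m (𝓝[S2] s) (𝓝[{z | 0 ≤ z.im}] (-1)) := by
      refine tendsto_nhdsWithin_iff.2 ⟨hml.mono_left (nhdsWithin_mono _ inter_subset_left), ?_⟩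
      filter_upwards [self_mem_nhdsWithin] with z hz
      show 0 ≤ (m z).im
      rw [hmy, him]
      have := Complex.normSq_pos.2 (hne z hz.1)
      have h3 : ((z - s) / d).re < 0 := hz.2
      apply div_nonneg _ this.le
      nlinarith
    have h2 := (Complex.tendsto_log_nhdsWithin_im_nonneg_of_re_neg_of_im_zero (z := -1)
      (by simp) (by simp)).comp h1
    refine (h2.const_add c).congr' ?_
    filter_upwards [self_mem_nhdsWithin] with z hz
    refine (hconst z ⟨hz.1, ?_⟩).symm
    rintro rfl
    have := hz.2
    simp at this
  have e1 := tendsto_nhds_unique t1 (hll.mono_left (nhdsWithin_mono _ inter_subset_left))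
  have e2 := tendsto_nhds_unique t2 (hll.mono_left (nhdsWithin_mono _ inter_subset_left))
  have e3 := congrArg Complex.im (e1.trans e2.symm)
  simp at e3
  linarith [Real.pi_pos]

/-- A continuous logarithm of a holomorphic function is holomorphic. -/
theorem differentiableOn_of_exp_eq {W : Set ℂ} (hW : IsOpen W) {l g : ℂ → ℂ}
    (hl : ContinuousOn l W) (hg : DifferentiableOn ℂ g W)
    (h : ∀ z ∈ W, Complex.exp (l z) = g z) : DifferentiableOn ℂ l W := by
  intro z hz
  have hg0 : g z ≠ 0 := by rw [← h z hz]; exact Complex.exp_ne_zero _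
  have hgd : DifferentiableAt ℂ g z := hg.differentiableAt (hW.mem_nhds hz)
  have hlc : ContinuousAt l z := hl.continuousAt (hW.mem_nhds hz)
  have hm1 : g z / g z ∈ Complex.slitPlane := by rw [div_self hg0]; simp
  have hd : DifferentiableAt ℂ (fun w => l z + Complex.log (g w / g z)) z :=
    (differentiableAt_const _).add ((hgd.div_const _).clog hm1)
  refine (hd.congr_of_eventuallyEq ?_).differentiableWithinAt
  have h1 : ∀ᶠ w in 𝓝 z, ‖l w - (l z + Complex.log (g w / g z))‖ < 2 * Real.pi := by
    have hcont : ContinuousAt (fun w => ‖l w - (l z + Complex.log (g w / g z))‖) z :=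
      (hlc.sub hd.continuousAt).norm
    refine hcont.eventually_lt continuousAt_const ?_
    simp [div_self hg0, Real.pi_pos]
  have h2 : ∀ᶠ w in 𝓝 z, g w ≠ 0 := hgd.continuousAt.eventually_ne hg0
  filter_upwards [h1, h2, hW.mem_nhds hz] with w hw1 hw2 hw3
  refine eq_of_exp_eq_of_norm_lt ?_ hw1
  rw [Complex.exp_add, Complex.exp_log (div_ne_zero hw2 hg0), h w hw3, h z hz]
  field_simp

/-- Zero-free holomorphic functions on convex open sets have holomorphic logarithms. -/
theorem exists_holo_log {X : Set ℂ} (hX : Convex ℝ X) (hXo : IsOpen X)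
    {q : ℂ → ℂ} (hq : DifferentiableOn ℂ q X) (h0 : ∀ z ∈ X, q z ≠ 0) :
    ∃ l : ℂ → ℂ, DifferentiableOn ℂ l X ∧ ∀ z ∈ X, Complex.exp (l z) = q z := by
  obtain ⟨l, hl, he⟩ := hasLog_of_convex hX hXo hq.continuousOn h0
  exact ⟨l, differentiableOn_of_exp_eq hXo hl hq he, he⟩

/-- Zero-free holomorphic functions on convex open sets have holomorphic square roots,
with prescribed value at a point. -/
theorem exists_holo_sqrt {X : Set ℂ} (hX : Convex ℝ X) (hXo : IsOpen X)
    {q : ℂ → ℂ} (hq : DifferentiableOn ℂ q X) (h0 : ∀ z ∈ X, q z ≠ 0) {c w : ℂ} (hc : c ∈ X)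
    (hw : w ^ 2 = q c) :
    ∃ s : ℂ → ℂ, DifferentiableOn ℂ s X ∧ (∀ z ∈ X, s z ^ 2 = q z) ∧ s c = w := by
  obtain ⟨l, hl, he⟩ := exists_holo_log hX hXo hq h0
  have h2 : ∀ z ∈ X, Complex.exp (l z / 2) ^ 2 = q z := fun z hz => by
    rw [← Complex.exp_nat_mul, ← he z hz]; congr 1; push_cast; ring
  have hd : DifferentiableOn ℂ (fun z => Complex.exp (l z / 2)) X := (hl.div_const 2).cexp
  rcases sq_eq_sq_iff_eq_or_eq_neg.1 ((h2 c hc).trans hw.symm) with h | h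
  · exact ⟨_, hd, h2, h⟩
  · refine ⟨fun z => - Complex.exp (l z / 2), hd.neg, fun z hz => by rw [neg_sq, h2 z hz], ?_⟩
    simp only [h, neg_neg]

end CremerJulia

namespace CremerJulia
open Set Filter Topology Metric

/-- The quadratic polynomial `z ^ 2 + v`. -/
def quad (v z : ℂ) : ℂ := z ^ 2 + v

/-- The filled Julia set. -/
def filled (v : ℂ) : Set ℂ := {z | Bornology.IsBounded (range fun n : ℕ => (quad v)^[n] z)}

theorem quad_neg (v z : ℂ) : quad v (-z) = quad v z := by simp [quad]

theorem quad_eq_quad_iff {v z w : ℂ} : quad v z = quad v w ↔ z = w ∨ z = -w := by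
  simp only [quad, add_left_inj, sq_eq_sq_iff_eq_or_eq_neg]

theorem continuous_quad (v : ℂ) : Continuous (quad v) := by unfold quad; fun_prop

theorem differentiable_quad (v : ℂ) : Differentiable ℂ (quad v) := by
  unfold quad; fun_prop

theorem differentiable_iterate_quad (v : ℂ) (n : ℕ) : Differentiable ℂ (quad v)^[n] := by
  induction n with
  | zero => exact differentiable_id
  | succ n ih =>
    rw [Function.iterate_succ]
    exact ih.comp (differentiable_quad v)

theorem exists_quad_eq (v w : ℂ) : ∃ z, quad v z = w := by
  obtain ⟨z, hz⟩ := IsAlgClosed.exists_pow_nat_eq (w - v) two_pos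
  exact ⟨z, by simp [quad, hz]⟩

theorem isOpenMap_quad (v : ℂ) : IsOpenMap (quad v) := by
  have h : AnalyticOnNhd ℂ (quad v) univ :=
    (differentiable_quad v).differentiableOn.analyticOnNhd isOpen_univ
  rcases h.is_constant_or_isOpenMap with ⟨w, hw⟩ | h
  · have h0 := hw 0
    have h1 := hw 1
    rw [← h0] at h1
    simp [quad] at h1
  · exact h

theorem two_mul_norm_le_norm_quad {v z : ℂ} (h : ‖v‖ + 2 ≤ ‖z‖) : 2 * ‖z‖ ≤ ‖quad v z‖ := by
  have h1 : ‖z ^ 2‖ - ‖v‖ ≤ ‖quad v z‖ := by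
    have := norm_sub_norm_le (z ^ 2) (-v)
    rwa [norm_neg, sub_neg_eq_add] at this
  rw [norm_pow] at h1
  have := norm_nonneg v
  nlinarith

theorem two_pow_mul_norm_le {v z : ℂ} (h : ‖v‖ + 2 ≤ ‖z‖) (n : ℕ) :
    2 ^ n * ‖z‖ ≤ ‖(quad v)^[n] z‖ := by
  induction n generalizing z with
  | zero => simp
  | succ n ih =>
    have h1 := two_mul_norm_le_norm_quad h
    have h0 := norm_nonneg v
    rw [Function.iterate_succ_apply]
    refine le_trans ?_ (ih (by linarith))
    rw [pow_succ, mul_assoc]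
    gcongr

theorem mem_filled_iff_isBounded {v z : ℂ} :
    z ∈ filled v ↔ Bornology.IsBounded (range fun n : ℕ => (quad v)^[n] z) := Iff.rfl

theorem mem_filled_iff {v z : ℂ} : z ∈ filled v ↔ ∀ n, ‖(quad v)^[n] z‖ ≤ ‖v‖ + 2 := by
  constructor
  · intro hz n
    by_contra hcon
    push Not at hcon
    obtain ⟨C, hC⟩ := isBounded_iff_forall_norm_le.1 (mem_filled_iff_isBounded.1 hz)
    obtain ⟨m, hm⟩ := pow_unbounded_of_one_lt C (one_lt_two)
    have h1 := two_pow_mul_norm_le hcon.le m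
    rw [← Function.iterate_add_apply] at h1
    have h2 := hC _ ⟨m + n, rfl⟩
    have h3 : (1 : ℝ) ≤ ‖(quad v)^[n] z‖ := by linarith [norm_nonneg v]
    have h4 : (0 : ℝ) < 2 ^ m := by positivity
    nlinarith
  · intro h
    exact mem_filled_iff_isBounded.2
      (isBounded_iff_forall_norm_le.2 ⟨‖v‖ + 2, by rintro _ ⟨n, rfl⟩; exact h n⟩)

theorem norm_le_of_mem_filled {v z : ℂ} (h : z ∈ filled v) : ‖z‖ ≤ ‖v‖ + 2 := mem_filled_iff.1 h 0

theorem isClosed_filled (v : ℂ) : IsClosed (filled v) := by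
  have : filled v = ⋂ n, {z | ‖(quad v)^[n] z‖ ≤ ‖v‖ + 2} := by
    ext z; simp [mem_filled_iff]
  rw [this]
  exact isClosed_iInter fun n =>
    isClosed_le (differentiable_iterate_quad v n).continuous.norm continuous_const

theorem isCompact_filled (v : ℂ) : IsCompact (filled v) :=
  isCompact_of_isClosed_isBounded (isClosed_filled v)
    (isBounded_iff_forall_norm_le.2 ⟨_, fun _ h => norm_le_of_mem_filled h⟩)

theorem quad_mem_filled_iff {v z : ℂ} : quad v z ∈ filled v ↔ z ∈ filled v := by
  constructor
  · intro h
    rw [mem_filled_iff] at h ⊢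
    rintro (_ | n)
    · by_contra hcon
      push Not at hcon
      have h1 := two_mul_norm_le_norm_quad hcon.le
      have h2 := h 0
      simp only [Function.iterate_zero, id] at h1 h2 hcon
      linarith [norm_nonneg v]
    · exact h n
  · intro h
    rw [mem_filled_iff] at h ⊢
    exact fun n => h (n + 1)

theorem preimage_filled (v : ℂ) : quad v ⁻¹' filled v = filled v := by
  ext z; exact quad_mem_filled_iff

theorem iterate_mem_filled {v z : ℂ} (h : z ∈ filled v) (n : ℕ) : (quad v)^[n] z ∈ filled v := by
  induction n with
  | zero => exact h
  | succ n ih => rw [Function.iterate_succ_apply']; exact quad_mem_filled_iff.2 ih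

theorem tendsto_iterate_of_notMem {v z : ℂ} (h : z ∉ filled v) :
    Tendsto (fun n => ‖(quad v)^[n] z‖) atTop atTop := by
  rw [mem_filled_iff] at h
  push Not at h
  obtain ⟨n, hn⟩ := h
  rw [← tendsto_add_atTop_iff_nat n]
  refine tendsto_atTop_mono (fun m => ?_) (tendsto_pow_atTop_atTop_of_one_lt (one_lt_two (α := ℝ)))
  rw [Function.iterate_add_apply]
  have h1 := two_pow_mul_norm_le hn.le m
  have h3 : (1 : ℝ) ≤ ‖(quad v)^[n] z‖ := by linarith [norm_nonneg v]
  have h4 : (0 : ℝ) < 2 ^ m := by positivity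
  nlinarith

/-- The Julia set. -/
def julia (v : ℂ) : Set ℂ := frontier (filled v)

theorem quad_mem_julia_iff {v z : ℂ} : quad v z ∈ julia v ↔ z ∈ julia v := by
  have := (isOpenMap_quad v).preimage_frontier_eq_frontier_preimage (continuous_quad v) (filled v)
  rw [preimage_filled] at this
  exact Set.ext_iff.1 this z

theorem quad_mem_interior_iff {v z : ℂ} :
    quad v z ∈ interior (filled v) ↔ z ∈ interior (filled v) := by
  have := (isOpenMap_quad v).preimage_interior_eq_interior_preimage (continuous_quad v) (filled v)
  rw [preimage_filled] at this
  exact Set.ext_iff.1 this z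

theorem neg_mem_julia_iff {v z : ℂ} : -z ∈ julia v ↔ z ∈ julia v := by
  rw [← quad_mem_julia_iff, quad_neg, quad_mem_julia_iff]

theorem neg_mem_interior_iff {v z : ℂ} :
    -z ∈ interior (filled v) ↔ z ∈ interior (filled v) := by
  rw [← quad_mem_interior_iff, quad_neg, quad_mem_interior_iff]

theorem isClosed_julia (v : ℂ) : IsClosed (julia v) := isClosed_frontier

theorem julia_subset_filled (v : ℂ) : julia v ⊆ filled v := (isClosed_filled v).frontier_subset

theorem isCompact_julia (v : ℂ) : IsCompact (julia v) :=
  (isCompact_filled v).of_isClosed_subset (isClosed_julia v) (julia_subset_filled v)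

theorem mem_julia_iff {v z : ℂ} : z ∈ julia v ↔ z ∈ filled v ∧ z ∉ interior (filled v) := by
  rw [julia, (isClosed_filled v).frontier_eq, Set.mem_sdiff]

theorem closure_compl_filled (v : ℂ) : closure (filled v)ᶜ = (interior (filled v))ᶜ :=
  closure_compl

/-- The frontier of a component of an open set misses the open set. -/
theorem frontier_connectedComponentIn_subset {O : Set ℂ} (hO : IsOpen O) (a : ℂ) :
    frontier (connectedComponentIn O a) ⊆ Oᶜ := by
  intro z hz hzO
  have hC := hO.connectedComponentIn (x := a)
  have h1 : IsOpen (connectedComponentIn O z) := hO.connectedComponentIn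
  have h2 := mem_closure_iff.1 (frontier_subset_closure hz) _ h1 (mem_connectedComponentIn hzO)
  obtain ⟨w, hw1, hw2⟩ := h2
  have h3 : z ∈ connectedComponentIn O a := by
    rw [connectedComponentIn_eq hw2, ← connectedComponentIn_eq hw1]
    exact mem_connectedComponentIn hzO
  rw [hC.frontier_eq] at hz
  exact hz.2 h3

theorem isPreconnected_norm_gt {M : ℝ} (hM : 0 < M) : IsPreconnected {z : ℂ | M < ‖z‖} := by
  have h1 : {z : ℂ | M < ‖z‖} = Complex.exp '' {z : ℂ | Real.log M < z.re} := by
    ext z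
    constructor
    · intro hz
      have hz0 : z ≠ 0 := norm_pos_iff.1 (hM.trans hz)
      refine ⟨Complex.log z, ?_, Complex.exp_log hz0⟩
      rw [mem_ofPred_eq, Complex.log_re]
      exact Real.log_lt_log hM hz
    · rintro ⟨w, hw, rfl⟩
      rw [mem_ofPred_eq, Complex.norm_exp]
      exact (Real.log_lt_iff_lt_exp hM).1 hw
  rw [h1]
  exact (convex_halfSpace_re_gt _).isPreconnected.image _ Complex.continuous_exp.continuousOn

theorem not_isBounded_of_norm_gt_subset {M : ℝ} {C : Set ℂ} (h : {z : ℂ | M < ‖z‖} ⊆ C) :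
    ¬ Bornology.IsBounded C := by
  intro hb
  obtain ⟨R, hR0, hR⟩ := hb.exists_pos_norm_lt
  have h1 : ((|M| + R + 1 : ℝ) : ℂ) ∈ C := by
    apply h
    rw [mem_ofPred_eq, Complex.norm_real, Real.norm_eq_abs, abs_of_pos (by positivity)]
    linarith [le_abs_self M]
  have h2 := hR _ h1
  rw [Complex.norm_real, Real.norm_eq_abs, abs_of_pos (by positivity)] at h2
  linarith [abs_nonneg M]

theorem norm_gt_subset_compl_filled (v : ℂ) : {z : ℂ | ‖v‖ + 2 < ‖z‖} ⊆ (filled v)ᶜ :=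
  fun _ hz h => absurd (norm_le_of_mem_filled h) (not_le.2 hz)

theorem not_isBounded_compl_filled (v : ℂ) : ¬ Bornology.IsBounded (filled v)ᶜ :=
  not_isBounded_of_norm_gt_subset (norm_gt_subset_compl_filled v)

/-- A bounded open set with frontier in the filled Julia set lies in the filled Julia set. -/
theorem subset_filled_of_frontier_subset {v : ℂ} {B : Set ℂ} (hB : Bornology.IsBounded B)
    (h : frontier B ⊆ filled v) : B ⊆ filled v := by
  intro z hz
  rw [mem_filled_iff]
  intro n
  exact Complex.norm_le_of_forall_mem_frontier_norm_le hB
    (differentiable_iterate_quad v n).diffContOnCl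
    (fun w hw => mem_filled_iff.1 (h hw) n) (subset_closure hz)

theorem isConnected_compl_filled (v : ℂ) : IsConnected (filled v)ᶜ := by
  have hM : 0 < ‖v‖ + 2 := by positivity
  have hO : IsOpen (filled v)ᶜ := (isClosed_filled v).isOpen_compl
  obtain ⟨w, hw⟩ : ∃ w : ℂ, ‖v‖ + 2 < ‖w‖ := by
    by_contra! h
    exact NormedSpace.unbounded_univ ℂ ℂ
      (isBounded_iff_forall_norm_le.2 ⟨_, fun z _ => h z⟩)
  have hsub := norm_gt_subset_compl_filled v
  refine ⟨⟨w, hsub hw⟩, ?_⟩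
  have key : ∀ z ∈ (filled v)ᶜ, z ∈ connectedComponentIn (filled v)ᶜ w := by
    intro z hz
    have h1 : ¬ Bornology.IsBounded (connectedComponentIn (filled v)ᶜ z) := by
      intro hb
      have h2 := frontier_connectedComponentIn_subset hO z
      rw [compl_compl] at h2
      exact hz (subset_filled_of_frontier_subset hb h2 (mem_connectedComponentIn hz))
    obtain ⟨u, hu, huM⟩ : ∃ u ∈ connectedComponentIn (filled v)ᶜ z, ‖v‖ + 2 < ‖u‖ := by
      by_contra! h
      exact h1 (isBounded_iff_forall_norm_le.2 ⟨_, h⟩)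
    have h3 : u ∈ connectedComponentIn (filled v)ᶜ w :=
      (isPreconnected_norm_gt hM).subset_connectedComponentIn hw hsub huM
    rw [connectedComponentIn_eq h3, ← connectedComponentIn_eq hu]
    exact mem_connectedComponentIn hz
  have : (filled v)ᶜ = connectedComponentIn (filled v)ᶜ w :=
    Subset.antisymm key (connectedComponentIn_subset _ _)
  rw [this]
  exact isPreconnected_connectedComponentIn

theorem isConnected_compl_interior (v : ℂ) : IsConnected (interior (filled v))ᶜ := by
  rw [← closure_compl_filled]
  exact (isConnected_compl_filled v).closure

/-- If the Julia set is connected, the critical point does not escape. -/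
theorem zero_mem_filled {v : ℂ} (hJ : IsConnected (julia v)) : (0 : ℂ) ∈ filled v := by
  by_contra h0
  have hd : Disjoint (filled v)ᶜ (julia v) :=
    disjoint_compl_left.mono_right (julia_subset_filled v)
  have h1 := hasLog_sub_of_unbounded (isCompact_julia v) (isConnected_compl_filled v).isPreconnected
    hd (not_isBounded_compl_filled v) h0
  refine not_hasLog_id_of_neg_mem hJ.isPreconnected hJ.nonempty
    (fun z hz => neg_mem_julia_iff.2 hz) (h1.congr fun z _ => by simp)

end CremerJulia

namespace CremerJulia
open Set Filter Topology Metric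

/-- A solution near the origin of the Böttcher equation in the coordinate at infinity. -/
structure IsGerm (v : ℂ) (s : ℝ) (B : ℂ → ℂ) : Prop where
  pos : 0 < s
  le_one : s ≤ 1
  diff : DifferentiableOn ℂ B (ball 0 s)
  zero : B 0 = 1
  eq : ∀ u ∈ ball (0 : ℂ) s, B u ^ 2 = B (u ^ 2) - v * u ^ 2

theorem sq_mem_ball {s : ℝ} (hs : s ≤ 1) {u : ℂ} (hu : u ∈ ball (0 : ℂ) s) :
    u ^ 2 ∈ ball (0 : ℂ) s := by
  rw [mem_ball_zero_iff] at hu ⊢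
  rw [norm_pow]
  nlinarith [norm_nonneg u]

/-- The branch of the square root near one used for the local construction. -/
noncomputable def csqrt (x : ℂ) : ℂ := Complex.exp (Complex.log x / 2)

theorem csqrt_sq {x : ℂ} (hx : x ≠ 0) : csqrt x ^ 2 = x := by
  rw [csqrt, ← Complex.exp_nat_mul]
  push_cast
  rw [mul_div_cancel₀ _ two_ne_zero, Complex.exp_log hx]

theorem csqrt_re_nonneg (x : ℂ) : 0 ≤ (csqrt x).re := by
  rw [csqrt, Complex.exp_re]
  refine mul_nonneg (Real.exp_pos _).le (Real.cos_nonneg_of_mem_Icc ?_)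
  have h1 := Complex.neg_pi_lt_log_im x
  have h2 := Complex.log_im_le_pi x
  have h3 : (Complex.log x / 2).im = (Complex.log x).im / 2 := by
    simp
  rw [h3]
  constructor <;> linarith

theorem norm_csqrt_sub_one_le {x : ℂ} (hx : x ≠ 0) : ‖csqrt x - 1‖ ≤ ‖x - 1‖ := by
  have h1 : (csqrt x - 1) * (csqrt x + 1) = x - 1 := by
    linear_combination csqrt_sq hx
  rw [← h1, norm_mul]
  have h2 : 1 ≤ ‖csqrt x + 1‖ := by
    refine le_trans ?_ (Complex.re_le_norm _)
    have := csqrt_re_nonneg x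
    simp only [Complex.add_re, Complex.one_re]
    linarith
  nlinarith [norm_nonneg (csqrt x - 1)]

/-- Successive approximations of the germ. -/
noncomputable def germApprox (v : ℂ) : ℕ → ℂ → ℂ
  | 0 => fun _ => 1
  | n + 1 => fun u => csqrt (germApprox v n (u ^ 2) - v * u ^ 2)

theorem exists_germ (v : ℂ) : ∃ s B, IsGerm v s B := by
  set s : ℝ := 1 / (2 * (‖v‖ + 1)) with hs
  have hv := norm_nonneg v
  have hs0 : 0 < s := by positivity
  have hs1 : s ≤ 1 / 2 := by
    rw [hs]; apply one_div_le_one_div_of_le <;> linarith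
  have hsv : 2 * ‖v‖ * s ≤ 1 := by
    have : s * (2 * (‖v‖ + 1)) = 1 := by rw [hs]; field_simp
    nlinarith
  have hsq : ∀ u ∈ ball (0 : ℂ) s, u ^ 2 ∈ ball (0 : ℂ) s := fun u hu =>
    sq_mem_ball (by linarith) hu
  have hsmall : ∀ u ∈ ball (0 : ℂ) s, 2 * ‖v‖ * ‖u‖ ^ 2 ≤ 1 / 2 := by
    intro u hu
    rw [mem_ball_zero_iff] at hu
    have h1 : ‖u‖ ^ 2 ≤ s * (1 / 2) := by nlinarith [norm_nonneg u]
    nlinarith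
  have hb : ∀ n, ∀ u ∈ ball (0 : ℂ) s, ‖germApprox v n u - 1‖ ≤ 2 * ‖v‖ * ‖u‖ ^ 2 ∧
      ‖(germApprox v n (u ^ 2) - v * u ^ 2) - 1‖ ≤ 2 * ‖v‖ * ‖u‖ ^ 2 := by
    have aux : ∀ n, (∀ u ∈ ball (0 : ℂ) s, ‖germApprox v n u - 1‖ ≤ 2 * ‖v‖ * ‖u‖ ^ 2) →
        ∀ u ∈ ball (0 : ℂ) s,
          ‖(germApprox v n (u ^ 2) - v * u ^ 2) - 1‖ ≤ 2 * ‖v‖ * ‖u‖ ^ 2 := by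
      intro n hn u hu
      have h1 := hn _ (hsq u hu)
      have h2 : ‖(germApprox v n (u ^ 2) - v * u ^ 2) - 1‖ ≤
          ‖germApprox v n (u ^ 2) - 1‖ + ‖v * u ^ 2‖ := by
        rw [show (germApprox v n (u ^ 2) - v * u ^ 2) - 1 =
          (germApprox v n (u ^ 2) - 1) - v * u ^ 2 by ring]
        exact norm_sub_le _ _
      rw [norm_mul, norm_pow] at h2
      rw [norm_pow] at h1
      rw [mem_ball_zero_iff] at hu
      have h3 : ‖u‖ ^ 2 ≤ 1 / 2 := by nlinarith [norm_nonneg u]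
      have h4 : 2 * ‖v‖ * (‖u‖ ^ 2) ^ 2 ≤ ‖v‖ * ‖u‖ ^ 2 := by
        have : 0 ≤ ‖v‖ * ‖u‖ ^ 2 := by positivity
        nlinarith
      linarith
    intro n
    induction n with
    | zero =>
      have h0 : ∀ u ∈ ball (0 : ℂ) s, ‖germApprox v 0 u - 1‖ ≤ 2 * ‖v‖ * ‖u‖ ^ 2 := by
        intro u _
        simp only [germApprox, sub_self, norm_zero]
        positivity
      exact fun u hu => ⟨h0 u hu, aux 0 h0 u hu⟩
    | succ n ih =>
      have h0 : ∀ u ∈ ball (0 : ℂ) s, ‖germApprox v (n + 1) u - 1‖ ≤ 2 * ‖v‖ * ‖u‖ ^ 2 := by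
        intro u hu
        have h1 := (ih u hu).2
        refine (norm_csqrt_sub_one_le ?_).trans h1
        intro h0
        rw [h0] at h1
        have := hsmall u hu
        simp at h1
        linarith
      exact fun u hu => ⟨h0 u hu, aux _ h0 u hu⟩
  have hslit : ∀ n, ∀ u ∈ ball (0 : ℂ) s,
      germApprox v n (u ^ 2) - v * u ^ 2 ∈ Complex.slitPlane := by
    intro n u hu
    have h1 := (hb n u hu).2
    have h2 := hsmall u hu
    have := one_add_mem_slitPlane (w := (germApprox v n (u ^ 2) - v * u ^ 2) - 1) (by linarith)
    rwa [add_sub_cancel] at this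
  have hd : ∀ n, DifferentiableOn ℂ (germApprox v n) (ball 0 s) := by
    intro n
    induction n with
    | zero => exact differentiableOn_const _
    | succ n ih =>
      have h1 : DifferentiableOn ℂ (fun u => germApprox v n (u ^ 2) - v * u ^ 2) (ball 0 s) :=
        (ih.comp (by fun_prop) hsq).sub (by fun_prop)
      exact ((h1.clog (hslit n)).div_const 2).cexp
  have hrec : ∀ n, ∀ u ∈ ball (0 : ℂ) s,
      germApprox v (n + 1) u ^ 2 = germApprox v n (u ^ 2) - v * u ^ 2 := fun n u hu =>
    csqrt_sq (Complex.slitPlane_ne_zero (hslit n u hu))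
  have hre : ∀ n, ∀ u ∈ ball (0 : ℂ) s, 1 / 2 ≤ (germApprox v n u).re := by
    intro n u hu
    have h1 := (hb n u hu).1
    have h2 := hsmall u hu
    have h3 := Complex.abs_re_le_norm (germApprox v n u - 1)
    have h4 := neg_abs_le (germApprox v n u - 1).re
    simp only [Complex.sub_re, Complex.one_re] at h3 h4
    linarith
  have gain : ∀ m, ∀ w ∈ ball (0 : ℂ) s,
      ‖germApprox v (m + 1) w - germApprox v m w‖ ≤ 2 * ‖v‖ * ‖w‖ ^ (m + 2) := by
    intro m
    induction m with
    | zero =>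
      intro w hw
      simpa only [germApprox] using (hb 1 w hw).1
    | succ m ihm =>
      intro w hw
      have h1 : (germApprox v (m + 2) w - germApprox v (m + 1) w) *
          (germApprox v (m + 2) w + germApprox v (m + 1) w) =
          germApprox v (m + 1) (w ^ 2) - germApprox v m (w ^ 2) := by
        linear_combination hrec (m + 1) w hw - hrec m w hw
      have h2 : 1 ≤ ‖germApprox v (m + 2) w + germApprox v (m + 1) w‖ := by
        refine le_trans ?_ (Complex.re_le_norm _)
        have := hre (m + 2) w hw
        have := hre (m + 1) w hw
        simp only [Complex.add_re]
        linarith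
      have h3 : ‖germApprox v (m + 2) w - germApprox v (m + 1) w‖ ≤
          ‖germApprox v (m + 1) (w ^ 2) - germApprox v m (w ^ 2)‖ := by
        rw [← h1, norm_mul]
        nlinarith [norm_nonneg (germApprox v (m + 2) w - germApprox v (m + 1) w)]
      refine h3.trans ((ihm _ (hsq w hw)).trans ?_)
      rw [norm_pow, ← pow_mul]
      gcongr 2 * ‖v‖ * ?_
      rw [mem_ball_zero_iff] at hw
      exact pow_le_pow_of_le_one (norm_nonneg w) (by linarith) (by omega)
  have hgain : ∀ m, ∀ w ∈ ball (0 : ℂ) s,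
      ‖germApprox v (m + 1) w - germApprox v m w‖ ≤ 2 * ‖v‖ * (1 / 2) ^ (m + 2) := by
    intro m w hw
    refine (gain m w hw).trans ?_
    rw [mem_ball_zero_iff] at hw
    gcongr
    linarith
  have hsum : Summable fun m : ℕ => 2 * ‖v‖ * (1 / 2 : ℝ) ^ (m + 2) :=
    ((summable_nat_add_iff 2).2 summable_geometric_two).mul_left _
  set B : ℂ → ℂ := fun u => 1 + ∑' n, (germApprox v (n + 1) u - germApprox v n u) with hB
  have hlim : ∀ u ∈ ball (0 : ℂ) s, Tendsto (fun n => germApprox v n u) atTop (𝓝 (B u)) := by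
    intro u hu
    have h1 : Summable fun n => germApprox v (n + 1) u - germApprox v n u :=
      Summable.of_norm_bounded hsum fun n => hgain n u hu
    have h2 := (h1.hasSum.tendsto_sum_nat).const_add 1
    refine h2.congr fun n => ?_
    rw [Finset.sum_range_sub (fun n => germApprox v n u)]
    simp [germApprox]
  refine ⟨s, B, hs0, by linarith, ?_, ?_, ?_⟩
  · exact (differentiableOn_const _).add (Complex.differentiableOn_tsum_of_summable_norm hsum
      (fun n => (hd (n + 1)).sub (hd n)) isOpen_ball hgain)
  · have h0 : (0 : ℂ) ∈ ball (0 : ℂ) s := mem_ball_self hs0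
    refine tendsto_nhds_unique (hlim 0 h0) ?_
    refine tendsto_const_nhds.congr fun n => ?_
    have := (hb n 0 h0).1
    simp only [norm_zero, ne_eq, OfNat.ofNat_ne_zero, not_false_eq_true, zero_pow, mul_zero,
      norm_le_zero_iff] at this
    exact (sub_eq_zero.1 this).symm
  · intro u hu
    have h1 := ((tendsto_add_atTop_iff_nat 1).2 (hlim u hu)).pow 2
    have h2 := (hlim _ (hsq u hu)).sub_const (v * u ^ 2)
    exact tendsto_nhds_unique h1 (h2.congr fun n => (hrec n u hu).symm)

theorem isPreconnected_ball_zero (s : ℝ) : IsPreconnected (ball (0 : ℂ) s) :=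
  (convex_ball _ _).isPreconnected

namespace IsGerm

variable {v : ℂ} {s : ℝ} {B : ℂ → ℂ}

theorem iterate_eq (h : IsGerm v s B) {u : ℂ} (hu : u ∈ ball (0 : ℂ) s) (hu0 : u ≠ 0) (n : ℕ) :
    (quad v)^[n] (B u / u) = B (u ^ 2 ^ n) / u ^ 2 ^ n := by
  induction n generalizing u with
  | zero => simp
  | succ n ih =>
    have h1 : quad v (B u / u) = B (u ^ 2) / u ^ 2 := by
      rw [quad, div_pow, h.eq u hu]
      field_simp
      ring
    rw [Function.iterate_succ_apply, h1, ih (sq_mem_ball h.le_one hu) (pow_ne_zero _ hu0),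
      ← pow_mul, ← pow_succ']

theorem tendsto_atTop (h : IsGerm v s B) {u : ℕ → ℂ} (hu : Tendsto u atTop (𝓝[≠] 0)) :
    Tendsto (fun n => ‖B (u n) / u n‖) atTop atTop := by
  have hc : ContinuousAt B 0 := (h.diff.differentiableAt (ball_mem_nhds _ h.pos)).continuousAt
  have h1 : Tendsto (fun n => ‖B (u n)‖) atTop (𝓝 1) := by
    have := (hc.tendsto.comp (hu.mono_right nhdsWithin_le_nhds)).norm
    simpa [h.zero] using this
  have h2 : Tendsto (fun n => ‖(u n)⁻¹‖) atTop atTop :=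
    (tendsto_norm_cobounded_atTop.comp (tendsto_inv₀_nhdsNE_zero)).comp hu
  exact (h2.atTop_mul_pos one_pos h1).congr fun n => by rw [div_eq_mul_inv, norm_mul, mul_comm]

theorem tendsto_pow {u : ℂ} (hu : ‖u‖ < 1) (hu0 : u ≠ 0) :
    Tendsto (fun n : ℕ => u ^ 2 ^ n) atTop (𝓝[≠] 0) := by
  refine tendsto_nhdsWithin_iff.2 ⟨?_, Eventually.of_forall fun n => pow_ne_zero _ hu0⟩
  exact (tendsto_pow_atTop_nhds_zero_of_norm_lt_one hu).comp
    (tendsto_pow_atTop_atTop_of_one_lt one_lt_two)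

theorem notMem_filled (h : IsGerm v s B) {u : ℂ} (hu : u ∈ ball (0 : ℂ) s) (hu0 : u ≠ 0) :
    B u / u ∉ filled v := by
  intro hf
  have hu1 : ‖u‖ < 1 := by
    rw [mem_ball_zero_iff] at hu
    linarith [h.le_one]
  have h1 := h.tendsto_atTop (tendsto_pow hu1 hu0)
  obtain ⟨n, hn⟩ := (h1.eventually_gt_atTop (‖v‖ + 2)).exists
  rw [← h.iterate_eq hu hu0] at hn
  exact absurd (mem_filled_iff.1 hf n) (not_le.2 hn)

theorem ne_zero (h : IsGerm v s B) (h0 : (0 : ℂ) ∈ filled v) {u : ℂ} (hu : u ∈ ball (0 : ℂ) s) :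
    B u ≠ 0 := by
  rcases eq_or_ne u 0 with rfl | hu0
  · rw [h.zero]; exact one_ne_zero
  · intro hB
    have := h.notMem_filled hu hu0
    rw [hB, zero_div] at this
    exact this h0

theorem extend (h : IsGerm v s B) (h0 : (0 : ℂ) ∈ filled v) :
    ∃ B', IsGerm v (Real.sqrt s) B' ∧ EqOn B' B (ball 0 s) := by
  have hs := h.pos
  have hs1 := h.le_one
  have hss : s ≤ Real.sqrt s := Real.le_sqrt_of_sq_le (by nlinarith)
  have hsq : ∀ u ∈ ball (0 : ℂ) (Real.sqrt s), u ^ 2 ∈ ball (0 : ℂ) s := by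
    intro u hu
    rw [mem_ball_zero_iff] at hu ⊢
    rw [norm_pow, ← Real.sq_sqrt hs.le]
    gcongr
  have hvK : v ∈ filled v := by
    have := quad_mem_filled_iff.2 h0
    simpa [quad] using this
  have hne : ∀ u ∈ ball (0 : ℂ) (Real.sqrt s), B (u ^ 2) - v * u ^ 2 ≠ 0 := by
    intro u hu hz
    rcases eq_or_ne u 0 with rfl | hu0
    · simp [h.zero] at hz
    · have h1 := h.notMem_filled (hsq u hu) (pow_ne_zero 2 hu0)
      rw [sub_eq_zero.1 hz, mul_div_cancel_right₀ _ (pow_ne_zero 2 hu0)] at h1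
      exact h1 hvK
  have hd : DifferentiableOn ℂ (fun u => B (u ^ 2) - v * u ^ 2) (ball 0 (Real.sqrt s)) :=
    (h.diff.comp (by fun_prop) hsq).sub (by fun_prop)
  obtain ⟨B', hB'd, hB'sq, hB'0⟩ := exists_holo_sqrt (convex_ball _ _) isOpen_ball hd hne
    (c := 0) (w := 1) (mem_ball_self (Real.sqrt_pos.2 hs)) (by simp [h.zero])
  have hE : EqOn B' B (ball 0 s) := by
    refine (isPreconnected_ball_zero s).eq_of_sq_eq
      (hB'd.continuousOn.mono (ball_subset_ball hss)) h.diff.continuousOn (fun u hu => ?_)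
      (fun hu => h.ne_zero h0 hu) (mem_ball_self hs) (by rw [hB'0, h.zero])
    simp only [Pi.pow_apply]
    rw [hB'sq u (ball_subset_ball hss hu), h.eq u hu]
  refine ⟨B', ⟨Real.sqrt_pos.2 hs, Real.sqrt_le_one.2 hs1, hB'd, hB'0, fun u hu => ?_⟩, hE⟩
  rw [hB'sq u hu, hE (hsq u hu)]

end IsGerm

/-- The Böttcher germ extends to the whole unit disc. -/
theorem exists_germ_one {v : ℂ} (h0 : (0 : ℂ) ∈ filled v) : ∃ B, IsGerm v 1 B := by
  obtain ⟨s0, B0, hB0⟩ := exists_germ v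
  choose! ext hext hextE using fun (q : {q : ℝ × (ℂ → ℂ) // IsGerm v q.1 q.2}) =>
    q.2.extend h0
  let seq : ℕ → {q : ℝ × (ℂ → ℂ) // IsGerm v q.1 q.2} := fun n =>
    Nat.rec ⟨(s0, B0), hB0⟩ (fun _ q => ⟨(Real.sqrt q.1.1, ext q), hext q⟩) n
  have hs : ∀ n, (seq (n + 1)).1.1 = Real.sqrt (seq n).1.1 := fun n => rfl
  have hpow : ∀ n, (seq n).1.1 ^ 2 ^ n = s0 := by
    intro n
    induction n with
    | zero => simp [seq]
    | succ n ih => rw [hs, pow_succ', pow_mul, Real.sq_sqrt (seq n).2.pos.le, ih]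
  have hEs : ∀ n, EqOn (seq (n + 1)).1.2 (seq n).1.2 (ball 0 (seq n).1.1) := fun n => hextE (seq n)
  have hmono1 : ∀ n, (seq n).1.1 ≤ (seq (n + 1)).1.1 := fun n => by
    rw [hs]
    exact Real.le_sqrt_of_sq_le (by nlinarith [(seq n).2.pos, (seq n).2.le_one])
  have hmono : Monotone fun n => (seq n).1.1 := monotone_nat_of_le_succ hmono1
  have hE : ∀ n m, n ≤ m → EqOn (seq m).1.2 (seq n).1.2 (ball 0 (seq n).1.1) := by
    intro n m hnm
    induction m, hnm using Nat.le_induction with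
    | base => exact eqOn_refl _ _
    | succ m hm ih =>
      exact fun u hu => (hEs m (ball_subset_ball (hmono hm) hu)).trans (ih hu)
  have hex : ∀ u ∈ ball (0 : ℂ) 1, ∃ n, u ∈ ball (0 : ℂ) (seq n).1.1 := by
    intro u hu
    rw [mem_ball_zero_iff] at hu
    have h1 : Tendsto (fun n : ℕ => ‖u‖ ^ 2 ^ n) atTop (𝓝 0) :=
      (tendsto_pow_atTop_nhds_zero_of_lt_one (norm_nonneg u) hu).comp
        (tendsto_pow_atTop_atTop_of_one_lt one_lt_two)
    obtain ⟨n, hn⟩ := (h1.eventually_lt_const hB0.pos).exists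
    refine ⟨n, ?_⟩
    rw [mem_ball_zero_iff]
    rw [← hpow n] at hn
    exact lt_of_pow_lt_pow_left₀ _ (seq n).2.pos.le hn
  choose! N hN using hex
  set B : ℂ → ℂ := fun u => (seq (N u)).1.2 u with hB
  have hBn : ∀ n, EqOn B (seq n).1.2 (ball 0 (seq n).1.1) := by
    intro n u hu
    have hu1 : u ∈ ball (0 : ℂ) 1 := ball_subset_ball (seq n).2.le_one hu
    rcases le_total n (N u) with h | h
    · exact hE n (N u) h hu
    · exact (hE (N u) n h (hN u hu1)).symm
  refine ⟨B, one_pos, le_rfl, fun u hu => ?_, ?_, fun u hu => ?_⟩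
  · have h1 := (seq (N u)).2.diff.differentiableAt (isOpen_ball.mem_nhds (hN u hu))
    refine (h1.congr_of_eventuallyEq ?_).differentiableWithinAt
    filter_upwards [isOpen_ball.mem_nhds (hN u hu)] with w hw using hBn _ hw
  · rw [hBn 0 (mem_ball_self (seq 0).2.pos), (seq 0).2.zero]
  · have h1 := hN u hu
    rw [hBn _ h1, hBn _ (sq_mem_ball (seq (N u)).2.le_one h1)]
    exact (seq (N u)).2.eq u h1

/-- The inverse Böttcher map of `z ^ 2 + v`. -/
structure IsBottcher (v : ℂ) (ψ : ℂ → ℂ) : Prop where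
  diff : DifferentiableOn ℂ ψ {w | 1 < ‖w‖}
  inj : InjOn ψ {w | 1 < ‖w‖}
  image : ψ '' {w | 1 < ‖w‖} = (filled v)ᶜ
  conj : ∀ w, 1 < ‖w‖ → ψ (w ^ 2) = quad v (ψ w)
  tendsto : Tendsto ψ (Bornology.cobounded ℂ) (Bornology.cobounded ℂ)

theorem one_lt_norm_pow {w : ℂ} (hw : 1 < ‖w‖) (n : ℕ) (hn : n ≠ 0) : 1 < ‖w ^ n‖ := by
  rw [norm_pow]; exact one_lt_pow₀ hw hn

theorem exists_isBottcher {v : ℂ} (h0 : (0 : ℂ) ∈ filled v) : ∃ ψ, IsBottcher v ψ := by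
  obtain ⟨B, hB⟩ := exists_germ_one h0
  have hinv : ∀ w : ℂ, 1 < ‖w‖ → w⁻¹ ∈ ball (0 : ℂ) 1 := by
    intro w hw
    rw [mem_ball_zero_iff, norm_inv]
    exact inv_lt_one_of_one_lt₀ hw
  have hw0 : ∀ w : ℂ, 1 < ‖w‖ → w ≠ 0 := by
    rintro w hw rfl
    simp at hw
    linarith
  set ψ : ℂ → ℂ := fun w => B w⁻¹ / w⁻¹ with hψ
  have hout : ∀ w, 1 < ‖w‖ → ψ w ∉ filled v := fun w hw =>
    hB.notMem_filled (hinv w hw) (inv_ne_zero (hw0 w hw))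
  have hconj : ∀ w, 1 < ‖w‖ → ψ (w ^ 2) = quad v (ψ w) := by
    intro w hw
    have := hB.iterate_eq (hinv w hw) (inv_ne_zero (hw0 w hw)) 1
    simp only [Function.iterate_one, pow_one] at this
    simp only [hψ]
    rw [this, inv_pow]
  have hconjn : ∀ w, 1 < ‖w‖ → ∀ n, ψ (w ^ 2 ^ n) = (quad v)^[n] (ψ w) := by
    intro w hw n
    have := hB.iterate_eq (hinv w hw) (inv_ne_zero (hw0 w hw)) n
    simp only [hψ]
    rw [this, inv_pow]
  have heven : ∀ u ∈ ball (0 : ℂ) 1, B (-u) = B u := by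
    have hneg : ∀ u ∈ ball (0 : ℂ) 1, -u ∈ ball (0 : ℂ) 1 := fun u hu => by
      simpa using hu
    have : EqOn (fun u => B (-u)) B (ball 0 1) := by
      refine (isPreconnected_ball_zero 1).eq_of_sq_eq
        (hB.diff.continuousOn.comp continuousOn_neg hneg) hB.diff.continuousOn (fun u hu => ?_)
        (fun hu => hB.ne_zero h0 hu) (mem_ball_self one_pos) (by simp)
      simp only [Pi.pow_apply]
      rw [hB.eq _ (hneg u hu), hB.eq u hu, neg_sq]
    exact fun u hu => this hu
  have hodd : ∀ w, 1 < ‖w‖ → ψ (-w) = -ψ w := by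
    intro w hw
    simp only [hψ, inv_neg]
    rw [heven _ (hinv w hw), div_neg]
  have hcB : ContinuousAt B 0 :=
    (hB.diff.differentiableAt (ball_mem_nhds _ one_pos)).continuousAt
  have hBd : HasStrictDerivAt (fun u => u / B u) 1 0 := by
    have h1 : AnalyticAt ℂ B 0 := hB.diff.analyticAt (ball_mem_nhds _ one_pos)
    have h2 : HasStrictDerivAt (fun u => id u / B u) _ 0 :=
      (hasStrictDerivAt_id (0 : ℂ)).div h1.hasStrictDerivAt
        (hB.ne_zero h0 (mem_ball_self one_pos))
    exact h2.congr_deriv (by simp [hB.zero])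
  have hlocinj : ∃ t > 0, InjOn (fun u => u / B u) (ball (0 : ℂ) t) := by
    have h1 := hBd.hasStrictFDerivAt_equiv one_ne_zero
    have h2 := h1.mem_toOpenPartialHomeomorph_source
    obtain ⟨t, ht, hts⟩ := Metric.isOpen_iff.1 (h1.toOpenPartialHomeomorph _).open_source 0 h2
    exact ⟨t, ht, (h1.toOpenPartialHomeomorph _).injOn.mono hts⟩
  have hmap : ∀ t > 0, ∀ᶠ y in 𝓝 (0 : ℂ), ∃ u ∈ ball (0 : ℂ) t, u / B u = y := by
    intro t ht
    have h1 := hBd.map_nhds_eq one_ne_zero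
    simp only [zero_div] at h1
    have : (fun u => u / B u) '' ball 0 t ∈ 𝓝 (0 : ℂ) := by
      rw [← h1]
      exact image_mem_map (ball_mem_nhds _ ht)
    filter_upwards [this] with y hy using hy
  have hinvψ : ∀ w, ψ w = (w⁻¹ / B w⁻¹)⁻¹ := fun w => by rw [hψ, inv_div]
  refine ⟨ψ, ?_, ?_, ?_, hconj, ?_⟩
  · have h1 : DifferentiableOn ℂ (fun w : ℂ => w⁻¹) {w | 1 < ‖w‖} :=
      differentiableOn_inv.mono fun w hw => hw0 w hw
    exact (hB.diff.comp h1 hinv).div h1 fun w hw => inv_ne_zero (hw0 w hw)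
  · obtain ⟨t, ht, hinj⟩ := hlocinj
    have hbase : ∀ n : ℕ, ∀ w w' : ℂ, 1 < ‖w‖ → 1 < ‖w'‖ → ψ w = ψ w' →
        w ^ 2 ^ n = w' ^ 2 ^ n → w = w' := by
      intro n
      induction n with
      | zero => intro w w' _ _ _ h; simpa using h
      | succ n ih =>
        intro w w' hw hw' he hp
        have h1 : w ^ 2 = w' ^ 2 := by
          refine ih _ _ (one_lt_norm_pow hw 2 two_ne_zero) (one_lt_norm_pow hw' 2 two_ne_zero) ?_ ?_
          · rw [hconj w hw, hconj w' hw', he]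
          · rw [← pow_mul, ← pow_mul, ← pow_succ', hp]
        rcases sq_eq_sq_iff_eq_or_eq_neg.1 h1 with h | h
        · exact h
        · exfalso
          rw [h, hodd w' hw'] at he
          have h2 : ψ w' = 0 := self_eq_neg.1 he.symm
          exact hout w' hw' (h2 ▸ h0)
    intro w hw w' hw' he
    have hlarge : ∀ w : ℂ, 1 < ‖w‖ → ∀ᶠ n : ℕ in atTop, (w ^ 2 ^ n)⁻¹ ∈ ball (0 : ℂ) t := by
      intro w hw
      have h1 := IsGerm.tendsto_pow (u := w⁻¹) (by simpa using hinv w hw)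
        (inv_ne_zero (hw0 w hw))
      filter_upwards [(h1.mono_right nhdsWithin_le_nhds) (ball_mem_nhds _ ht)] with n hn
      rwa [← inv_pow]
    obtain ⟨n, hn, hn'⟩ := ((hlarge w hw).and (hlarge w' hw')).exists
    refine hbase n w w' hw hw' he ?_
    have h1 : ψ (w ^ 2 ^ n) = ψ (w' ^ 2 ^ n) := by rw [hconjn w hw, hconjn w' hw', he]
    rw [hinvψ, hinvψ] at h1
    exact inv_injective (hinj hn hn' (inv_injective h1))
  · refine Subset.antisymm ?_ ?_
    · rintro _ ⟨w, hw, rfl⟩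
      exact hout w hw
    · intro z hz
      have hev := hmap 1 one_pos
      have h1 : Tendsto (fun n => ((quad v)^[n] z)⁻¹) atTop (𝓝 0) := by
        rw [tendsto_zero_iff_norm_tendsto_zero]
        simp only [norm_inv]
        exact (tendsto_iterate_of_notMem hz).inv_tendsto_atTop
      obtain ⟨n, hn⟩ := (h1.eventually hev).exists
      have key : ∀ n : ℕ, ∀ z, z ∉ filled v → (∃ w, 1 < ‖w‖ ∧ ψ w = (quad v)^[n] z) →
          ∃ w, 1 < ‖w‖ ∧ ψ w = z := by
        intro n
        induction n with
        | zero => intro z _ h; exact h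
        | succ n ih =>
          intro z hz h
          obtain ⟨ω, hω, he⟩ := ih (quad v z) (fun h => hz (quad_mem_filled_iff.1 h)) h
          obtain ⟨w, hw⟩ := IsAlgClosed.exists_pow_nat_eq ω two_pos
          have hw1 : 1 < ‖w‖ := by
            by_contra! hcon
            rw [← hw, norm_pow] at hω
            nlinarith [norm_nonneg w]
          rw [← hw, hconj w hw1] at he
          rcases quad_eq_quad_iff.1 he with h1 | h1
          · exact ⟨w, hw1, h1⟩
          · exact ⟨-w, by rwa [norm_neg], by rw [hodd w hw1, h1, neg_neg]⟩
      obtain ⟨u, hu, he⟩ := hn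
      have hzn : (quad v)^[n] z ≠ 0 := by
        intro h
        have : (quad v)^[n] z ∈ filled v := h ▸ h0
        have h2 : ∀ n, ∀ z, (quad v)^[n] z ∈ filled v → z ∈ filled v := by
          intro n
          induction n with
          | zero => exact fun z h => h
          | succ n ih => exact fun z h => quad_mem_filled_iff.1 (ih _ h)
        exact hz (h2 n z this)
      have hu0 : u ≠ 0 := by
        rintro rfl
        rw [zero_div] at he
        exact hzn (inv_eq_zero.1 he.symm)
      obtain ⟨w, hw, hwz⟩ := key n z hz ⟨u⁻¹, by
        rw [norm_inv]
        rw [mem_ball_zero_iff] at hu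
        exact (one_lt_inv₀ (norm_pos_iff.2 hu0)).2 hu, by
        rw [hinvψ, inv_inv, he, inv_inv]⟩
      exact ⟨w, hw, hwz⟩
  · have h1 : Tendsto (fun w : ℂ => w⁻¹) (Bornology.cobounded ℂ) (𝓝[≠] 0) :=
      tendsto_inv₀_cobounded'
    have h2 : Tendsto (fun u => (u / B u)⁻¹) (𝓝[≠] 0) (Bornology.cobounded ℂ) := by
      refine tendsto_inv₀_nhdsNE_zero.comp (tendsto_nhdsWithin_iff.2 ⟨?_, ?_⟩)
      · have := hBd.hasDerivAt.continuousAt.tendsto.mono_left (nhdsWithin_le_nhds (s := {0}ᶜ))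
        simpa using this
      · filter_upwards [self_mem_nhdsWithin, nhdsWithin_le_nhds (ball_mem_nhds (0 : ℂ) one_pos)]
          with u hu hu1
        exact div_ne_zero hu (hB.ne_zero h0 hu1)
    exact (h2.comp h1).congr fun w => (hinvψ w).symm

end CremerJulia

namespace CremerJulia
open Set Filter Topology Metric

theorem isPreconnected_iInter_of_antitone {C : ℕ → Set ℂ} (hanti : Antitone C)
    (hc : ∀ n, IsCompact (C n)) (hp : ∀ n, IsPreconnected (C n)) :
    IsPreconnected (⋂ n, C n) := by
  have hcl : IsClosed (⋂ n, C n) := isClosed_iInter fun n => (hc n).isClosed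
  have hcI : IsCompact (⋂ n, C n) := (hc 0).of_isClosed_subset hcl (iInter_subset _ 0)
  rw [isPreconnected_closed_iff]
  intro A B hA hB hAB hIA hIB
  by_contra hne
  rw [not_nonempty_iff_eq_empty] at hne
  have hdis : Disjoint ((⋂ n, C n) ∩ A) ((⋂ n, C n) ∩ B) := by
    rw [Set.disjoint_left]
    rintro x ⟨hx, hxA⟩ ⟨-, hxB⟩
    exact (hne ▸ (⟨hx, hxA, hxB⟩ : x ∈ (⋂ n, C n) ∩ (A ∩ B)) : x ∈ (∅ : Set ℂ))
  obtain ⟨U, V, hU, hV, hAU, hBV, hUV⟩ :=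
    SeparatedNhds.of_isCompact_isCompact (hcI.inter_right hA) (hcI.inter_right hB) hdis
  obtain ⟨n, hn⟩ := exists_subset_nhds_of_isCompact hanti.directed_ge hc (U := U ∪ V)
    fun x hx => (hU.union hV).mem_nhds ((hAB hx).imp (fun h => hAU ⟨hx, h⟩) fun h => hBV ⟨hx, h⟩)
  obtain ⟨a, haI, haA⟩ := hIA
  obtain ⟨b, hbI, hbB⟩ := hIB
  rcases (hp n).subset_or_subset hU hV hUV hn with h | h
  · exact Set.disjoint_left.1 hUV (h (mem_iInter.1 hbI n)) (hBV ⟨hbI, hbB⟩)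
  · exact Set.disjoint_left.1 hUV (hAU ⟨haI, haA⟩) (h (mem_iInter.1 haI n))

theorem dir_norm {w : ℂ} (hw : w ≠ 0) : ‖w / (‖w‖ : ℂ)‖ = 1 := by
  rw [norm_div, Complex.norm_real, norm_norm, div_self (norm_ne_zero_iff.2 hw)]

theorem ne_zero_of_one_lt {w : ℂ} (hw : 1 < ‖w‖) : w ≠ 0 := by
  rintro rfl
  rw [norm_zero] at hw
  linarith

variable {v : ℂ} {ψ : ℂ → ℂ}

theorem isOpen_norm_gt (r : ℝ) : IsOpen {w : ℂ | r < ‖w‖} :=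
  isOpen_lt continuous_const continuous_norm

namespace IsBottcher

theorem notMem (h : IsBottcher v ψ) {w : ℂ} (hw : 1 < ‖w‖) : ψ w ∉ filled v := by
  have : ψ w ∈ (filled v)ᶜ := h.image ▸ mem_image_of_mem ψ hw
  exact this

theorem exists_eq (h : IsBottcher v ψ) {z : ℂ} (hz : z ∉ filled v) : ∃ w, 1 < ‖w‖ ∧ ψ w = z := by
  have : z ∈ ψ '' {w | 1 < ‖w‖} := h.image ▸ hz
  exact this

theorem continuousAt (h : IsBottcher v ψ) {w : ℂ} (hw : 1 < ‖w‖) : ContinuousAt ψ w :=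
  (h.diff.differentiableAt ((isOpen_norm_gt 1).mem_nhds hw)).continuousAt

theorem isOpen_image (h : IsBottcher v ψ) {O : Set ℂ} (hO : IsOpen O)
    (hO1 : O ⊆ {w | 1 < ‖w‖}) : IsOpen (ψ '' O) := by
  have han : AnalyticOnNhd ℂ ψ {w | 1 < ‖w‖} := h.diff.analyticOnNhd (isOpen_norm_gt 1)
  rcases han.is_constant_or_isOpen (isPreconnected_norm_gt one_pos) with ⟨c, hc⟩ | hop
  · exfalso
    have h2 : (2 : ℂ) ∈ {w : ℂ | 1 < ‖w‖} := by simp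
    have h3 : (3 : ℂ) ∈ {w : ℂ | 1 < ‖w‖} := by simp
    have := h.inj h2 h3 ((hc _ h2).trans (hc _ h3).symm)
    norm_num at this
  · exact hop O hO1 hO

theorem neg (h : IsBottcher v ψ) {w : ℂ} (hw : 1 < ‖w‖) : ψ (-w) = -ψ w := by
  have hnw : 1 < ‖-w‖ := by rwa [norm_neg]
  have h1 : quad v (ψ (-w)) = quad v (ψ w) := by
    rw [← h.conj w hw, ← h.conj _ hnw, neg_sq]
  rcases quad_eq_quad_iff.1 h1 with h2 | h2
  · have := h.inj hnw hw h2
    exact absurd (neg_eq_self.1 this) (ne_zero_of_one_lt hw)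
  · exact h2

theorem tendsto_of_comp (h : IsBottcher v ψ) {ι : Type*} {l : Filter ι} {g : ι → ℂ} {w : ℂ}
    (hg : ∀ᶠ i in l, 1 < ‖g i‖) (hw : 1 < ‖w‖) (ht : Tendsto (fun i => ψ (g i)) l (𝓝 (ψ w))) :
    Tendsto g l (𝓝 w) := by
  rw [_root_.tendsto_nhds]
  intro s hs hws
  have ho := h.isOpen_image (hs.inter (isOpen_norm_gt 1)) inter_subset_right
  filter_upwards [hg, ht (ho.mem_nhds (mem_image_of_mem ψ ⟨hws, hw⟩))] with i hi1 hi2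
  obtain ⟨x, ⟨hxs, hx1⟩, hx⟩ := hi2
  rw [h.inj hx1 hi1 hx] at hxs
  exact hxs

theorem exists_norm_le (h : IsBottcher v ψ) (M : ℝ) :
    ∃ R, ∀ w, ‖ψ w‖ ≤ M → ‖w‖ ≤ R := by
  have h1 : ψ ⁻¹' {z | M < ‖z‖} ∈ Bornology.cobounded ℂ := by
    refine h.tendsto ?_
    filter_upwards [tendsto_norm_cobounded_atTop.eventually_gt_atTop M] with z hz using hz
  have h2 : Bornology.IsBounded (ψ ⁻¹' {z | M < ‖z‖})ᶜ := by
    rwa [← Bornology.isCobounded_def, ← Bornology.isBounded_compl_iff] at h1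
  obtain ⟨R, hR⟩ := h2.exists_norm_le
  exact ⟨R, fun w hw => hR w (by simpa using hw)⟩

theorem tendsto_norm_one (h : IsBottcher v ψ) {ι : Type*} {l : Filter ι} {g : ι → ℂ} {z : ℂ}
    (hg : ∀ᶠ i in l, 1 < ‖g i‖) (hz : z ∈ filled v)
    (ht : Tendsto (fun i => ψ (g i)) l (𝓝 z)) : Tendsto (fun i => ‖g i‖) l (𝓝 1) := by
  obtain ⟨R, hR⟩ := h.exists_norm_le (‖z‖ + 1)
  rw [tendsto_order]
  refine ⟨fun a ha => hg.mono fun i hi => ha.trans hi, fun r hr => ?_⟩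
  have hc : IsCompact {w : ℂ | r ≤ ‖w‖ ∧ ‖w‖ ≤ R} := by
    refine (isCompact_closedBall (0 : ℂ) R).of_isClosed_subset ?_ fun w hw => ?_
    · exact (isClosed_le continuous_const continuous_norm).inter
        (isClosed_le continuous_norm continuous_const)
    · simpa using hw.2
  have hc2 : IsCompact (ψ '' {w : ℂ | r ≤ ‖w‖ ∧ ‖w‖ ≤ R}) :=
    hc.image_of_continuousOn fun w hw => (h.continuousAt (hr.trans_le hw.1)).continuousWithinAt
  have hzn : z ∈ (ψ '' {w : ℂ | r ≤ ‖w‖ ∧ ‖w‖ ≤ R})ᶜ := by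
    rintro ⟨w, hw, rfl⟩
    exact h.notMem (hr.trans_le hw.1) hz
  filter_upwards [hg, ht (hc2.isClosed.isOpen_compl.mem_nhds hzn),
    ht.norm.eventually_lt_const (lt_add_one ‖z‖)] with i h1 h2 h3
  by_contra hcon
  exact h2 ⟨g i, ⟨not_lt.1 hcon, hR _ h3.le⟩, rfl⟩

end IsBottcher

/-- The closed relation between points and external angles. -/
def gr (ψ : ℂ → ℂ) : Set (ℂ × ℂ) :=
  closure {q | ∃ w, 1 < ‖w‖ ∧ q = (ψ w, w / (‖w‖ : ℂ))}

theorem mem_gr_of_norm {w : ℂ} (hw : 1 < ‖w‖) : (ψ w, w / (‖w‖ : ℂ)) ∈ gr ψ :=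
  subset_closure ⟨w, hw, rfl⟩

theorem mem_gr_iff {z u : ℂ} : (z, u) ∈ gr ψ ↔ ∃ w : ℕ → ℂ, (∀ n, 1 < ‖w n‖) ∧
    Tendsto (fun n => ψ (w n)) atTop (𝓝 z) ∧
    Tendsto (fun n => w n / (‖w n‖ : ℂ)) atTop (𝓝 u) := by
  constructor
  · intro h
    obtain ⟨x, hx, hlim⟩ := mem_closure_iff_seq_limit.1 h
    choose w hw hwx using hx
    rw [Prod.tendsto_iff] at hlim
    refine ⟨w, hw, ?_, ?_⟩
    · simpa [hwx] using hlim.1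
    · simpa [hwx] using hlim.2
  · rintro ⟨w, hw, h1, h2⟩
    exact mem_closure_iff_seq_limit.2 ⟨fun n => (ψ (w n), w n / (‖w n‖ : ℂ)),
      fun n => ⟨w n, hw n, rfl⟩, h1.prodMk_nhds h2⟩

theorem norm_eq_one_of_mem_gr {z u : ℂ} (h : (z, u) ∈ gr ψ) : ‖u‖ = 1 := by
  obtain ⟨w, hw, -, h2⟩ := mem_gr_iff.1 h
  refine tendsto_nhds_unique h2.norm (tendsto_const_nhds.congr fun n => ?_)
  rw [dir_norm (ne_zero_of_one_lt (hw n))]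

theorem exists_subseq_mem_gr {w : ℕ → ℂ} {z : ℂ} (hw : ∀ n, 1 < ‖w n‖)
    (ht : Tendsto (fun n => ψ (w n)) atTop (𝓝 z)) :
    ∃ u, ∃ k : ℕ → ℕ, StrictMono k ∧
      Tendsto (fun n => w (k n) / (‖w (k n)‖ : ℂ)) atTop (𝓝 u) ∧ (z, u) ∈ gr ψ := by
  obtain ⟨u, -, k, hk, hu⟩ := (isCompact_sphere (0 : ℂ) 1).tendsto_subseq
    (x := fun n => w n / (‖w n‖ : ℂ)) fun n => by
      simpa using dir_norm (ne_zero_of_one_lt (hw n))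
  exact ⟨u, k, hk, hu, mem_gr_iff.2 ⟨fun n => w (k n), fun n => hw _,
    ht.comp hk.tendsto_atTop, hu⟩⟩

/-- Points having an external angle in `T`. -/
def ang (ψ : ℂ → ℂ) (T : Set ℂ) : Set ℂ := {z | ∃ u ∈ T, (z, u) ∈ gr ψ}

/-- Julia points having an external angle in `T`: the union of the impressions of `T`. -/
def imp (v : ℂ) (ψ : ℂ → ℂ) (T : Set ℂ) : Set ℂ := julia v ∩ ang ψ T

theorem ang_mono {S T : Set ℂ} (h : S ⊆ T) : ang ψ S ⊆ ang ψ T :=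
  fun _ ⟨u, hu, hz⟩ => ⟨u, h hu, hz⟩

theorem imp_mono {S T : Set ℂ} (h : S ⊆ T) : imp v ψ S ⊆ imp v ψ T :=
  inter_subset_inter_right _ (ang_mono h)

theorem isClosed_ang {T : Set ℂ} (hT : IsClosed T) : IsClosed (ang ψ T) := by
  refine isClosed_of_closure_subset fun z hz => ?_
  obtain ⟨x, hx, hlim⟩ := mem_closure_iff_seq_limit.1 hz
  choose u huT hu using hx
  obtain ⟨a, -, k, hk, ha⟩ := (isCompact_sphere (0 : ℂ) 1).tendsto_subseq
    (x := u) fun n => by simpa using norm_eq_one_of_mem_gr (hu n)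
  refine ⟨a, hT.mem_of_tendsto ha (Eventually.of_forall fun n => huT _), ?_⟩
  exact isClosed_closure.mem_of_tendsto ((hlim.comp hk.tendsto_atTop).prodMk_nhds ha)
    (Eventually.of_forall fun n => hu _)

theorem isCompact_imp {T : Set ℂ} (hT : IsClosed T) : IsCompact (imp v ψ T) :=
  (isCompact_julia v).inter_right (isClosed_ang hT)

namespace IsBottcher

theorem ang_subset (h : IsBottcher v ψ) (T : Set ℂ) : ang ψ T ⊆ (interior (filled v))ᶜ := by
  rintro z ⟨u, -, hz⟩
  obtain ⟨w, hw, h1, -⟩ := mem_gr_iff.1 hz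
  rw [← closure_compl_filled]
  exact mem_closure_of_tendsto h1 (Eventually.of_forall fun n => h.notMem (hw n))

theorem exists_angle (h : IsBottcher v ψ) {z : ℂ} (hz : z ∉ interior (filled v)) :
    ∃ u, (z, u) ∈ gr ψ := by
  have hz' : z ∈ closure (filled v)ᶜ := by rwa [closure_compl_filled]
  obtain ⟨x, hx, hlim⟩ := mem_closure_iff_seq_limit.1 hz'
  choose w hw hwx using fun n => h.exists_eq (hx n)
  obtain ⟨u, -, -, -, hu⟩ := exists_subseq_mem_gr (ψ := ψ) hw (z := z) (by simpa [hwx] using hlim)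
  exact ⟨u, hu⟩

theorem eq_of_mem_gr (h : IsBottcher v ψ) {w u : ℂ} (hw : 1 < ‖w‖) (hu : (ψ w, u) ∈ gr ψ) :
    u = w / (‖w‖ : ℂ) := by
  obtain ⟨x, hx, h1, h2⟩ := mem_gr_iff.1 hu
  have h3 := h.tendsto_of_comp (Eventually.of_forall hx) hw h1
  refine tendsto_nhds_unique h2 (h3.div (Complex.continuous_ofReal.tendsto _ |>.comp h3.norm) ?_)
  exact_mod_cast (zero_lt_one.trans hw).ne'

theorem gr_quad (h : IsBottcher v ψ) {z u : ℂ} (hz : (z, u) ∈ gr ψ) :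
    (quad v z, u ^ 2) ∈ gr ψ := by
  obtain ⟨w, hw, h1, h2⟩ := mem_gr_iff.1 hz
  refine mem_gr_iff.2 ⟨fun n => w n ^ 2, fun n => one_lt_norm_pow (hw n) 2 two_ne_zero, ?_, ?_⟩
  · refine ((continuous_quad v).tendsto z |>.comp h1).congr fun n => ?_
    exact (h.conj _ (hw n)).symm
  · refine (h2.pow 2).congr fun n => ?_
    rw [norm_pow, div_pow]
    push_cast
    rfl

theorem gr_neg (h : IsBottcher v ψ) {z u : ℂ} (hz : (z, u) ∈ gr ψ) : (-z, -u) ∈ gr ψ := by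
  obtain ⟨w, hw, h1, h2⟩ := mem_gr_iff.1 hz
  refine mem_gr_iff.2 ⟨fun n => -w n, fun n => by rw [norm_neg]; exact hw n, ?_, ?_⟩
  · refine h1.neg.congr fun n => ?_
    rw [h.neg (hw n)]
  · refine h2.neg.congr fun n => ?_
    rw [norm_neg, neg_div]

theorem gr_lift (h : IsBottcher v ψ) {z u : ℂ} (hz : (quad v z, u) ∈ gr ψ) :
    ∃ w, w ^ 2 = u ∧ (z, w) ∈ gr ψ := by
  obtain ⟨x, hx, h1, h2⟩ := mem_gr_iff.1 hz
  have hroot : ∀ n, ∃ y : ℂ, y ^ 2 = x n ∧ ‖ψ y - z‖ ≤ ‖ψ y + z‖ := by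
    intro n
    obtain ⟨y, hy⟩ := IsAlgClosed.exists_pow_nat_eq (x n) two_pos
    have hy1 : 1 < ‖y‖ := by
      have := hx n
      rw [← hy, norm_pow] at this
      nlinarith [norm_nonneg y]
    rcases le_total ‖ψ y - z‖ ‖ψ y + z‖ with hc | hc
    · exact ⟨y, hy, hc⟩
    · refine ⟨-y, by rw [neg_sq, hy], ?_⟩
      rw [h.neg hy1, ← neg_add', norm_neg, neg_add_eq_sub, ← neg_sub, norm_neg]
      exact hc
  choose y hy hyz using hroot
  have hy1 : ∀ n, 1 < ‖y n‖ := by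
    intro n
    have := hx n
    rw [← hy n, norm_pow] at this
    nlinarith [norm_nonneg (y n)]
  have h3 : Tendsto (fun n => ψ (y n)) atTop (𝓝 z) := by
    rw [tendsto_iff_norm_sub_tendsto_zero]
    have h4 : Tendsto (fun n => ‖ψ (x n) - quad v z‖) atTop (𝓝 0) :=
      tendsto_iff_norm_sub_tendsto_zero.1 h1
    have h5 : Tendsto (fun n => Real.sqrt ‖ψ (x n) - quad v z‖) atTop (𝓝 0) := by
      simpa using h4.sqrt
    refine squeeze_zero (fun n => norm_nonneg _) (fun n => ?_) h5
    refine Real.le_sqrt_of_sq_le ?_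
    have h6 : ψ (x n) - quad v z = (ψ (y n) - z) * (ψ (y n) + z) := by
      rw [← hy n, h.conj _ (hy1 n), quad, quad]; ring
    rw [h6, norm_mul, sq]
    exact mul_le_mul_of_nonneg_left (hyz n) (norm_nonneg _)
  obtain ⟨w, k, hk, hw, hwz⟩ := exists_subseq_mem_gr hy1 h3
  refine ⟨w, tendsto_nhds_unique (hw.pow 2) ((h2.comp hk.tendsto_atTop).congr fun n => ?_), hwz⟩
  simp only [Function.comp]
  rw [div_pow, ← hy (k n), norm_pow]
  push_cast
  rfl

end IsBottcher

/-- The arc of the unit circle of half-length `a` centred at `u`. -/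
def arc (u : ℂ) (a : ℝ) : Set ℂ := (fun θ : ℝ => u * Complex.exp (θ * Complex.I)) '' Icc (-a) a

theorem mem_arc_self (u : ℂ) {a : ℝ} (ha : 0 ≤ a) : u ∈ arc u a :=
  ⟨0, ⟨by linarith, ha⟩, by simp⟩

theorem arc_zero (u : ℂ) : arc u 0 = {u} := by
  simp [arc]

theorem arc_mono (u : ℂ) {a b : ℝ} (h : a ≤ b) : arc u a ⊆ arc u b :=
  image_mono (Icc_subset_Icc (neg_le_neg h) h)

theorem isCompact_arc (u : ℂ) (a : ℝ) : IsCompact (arc u a) :=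
  isCompact_Icc.image (by fun_prop)

/-- Open sectors shrinking to an arc of the unit circle. -/
def sector (u : ℂ) (a : ℝ) (n : ℕ) : Set ℂ :=
  (fun s => u * Complex.exp s) '' (Ioo (0 : ℝ) (1 / (n + 1)) ×ℂ
    Ioo (-(a + 1 / (n + 1))) (a + 1 / (n + 1)))

theorem sector_norm {u : ℂ} (hu : ‖u‖ = 1) {a : ℝ} {n : ℕ} {w : ℂ} (hw : w ∈ sector u a n) :
    1 < ‖w‖ ∧ ‖w‖ < Real.exp (1 / (n + 1)) ∧ w / (‖w‖ : ℂ) ∈ arc u (a + 1 / (n + 1)) := by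
  obtain ⟨s, ⟨⟨h1, h2⟩, h3, h4⟩, rfl⟩ := hw
  have hn : ‖u * Complex.exp s‖ = Real.exp s.re := by
    rw [norm_mul, hu, one_mul, Complex.norm_exp]
  simp only [hn]
  refine ⟨Real.one_lt_exp_iff.2 h1, Real.exp_lt_exp.2 h2, s.im, ⟨h3.le, h4.le⟩, ?_⟩
  simp only
  rw [mul_div_assoc, Complex.ofReal_exp, ← Complex.exp_sub]
  congr 2
  exact (sub_eq_of_eq_add' (Complex.re_add_im s).symm).symm

theorem mem_sector {u : ℂ} (hu : ‖u‖ = 1) {a : ℝ} {n : ℕ} {w : ℂ} (hw : 1 < ‖w‖)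
    (hw2 : ‖w‖ < Real.exp (1 / (n + 1))) {b : ℝ} (hb : |b| ≤ a)
    (harg : |Complex.arg (w / (u * Complex.exp (b * Complex.I)))| < 1 / (n + 1)) :
    w ∈ sector u a n := by
  have hw0 := ne_zero_of_one_lt hw
  have hu0 : u ≠ 0 := by rintro rfl; simp at hu
  set e := u * Complex.exp (b * Complex.I) with he
  have he1 : ‖e‖ = 1 := by rw [he, norm_mul, hu, Complex.norm_exp_ofReal_mul_I, one_mul]
  have he0 : e ≠ 0 := by intro h; rw [h, norm_zero] at he1; exact zero_ne_one he1
  refine ⟨b * Complex.I + Complex.log (w / e), ⟨?_, ?_⟩, ?_⟩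
  · have : (b * Complex.I + Complex.log (w / e)).re = Real.log ‖w‖ := by
      simp [Complex.log_re, he1]
    simp only [mem_preimage, this]
    exact ⟨Real.log_pos hw, (Real.log_lt_iff_lt_exp (by linarith)).2 hw2⟩
  · have : (b * Complex.I + Complex.log (w / e)).im = b + Complex.arg (w / e) := by
      simp [Complex.log_im]
    simp only [mem_preimage, this]
    rw [abs_lt] at harg
    rw [abs_le] at hb
    constructor <;> linarith
  · simp only
    rw [Complex.exp_add, Complex.exp_log (div_ne_zero hw0 he0), ← mul_assoc, ← he,
      mul_div_cancel₀ _ he0]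

theorem sector_anti (u : ℂ) (a : ℝ) : Antitone (sector u a) := by
  intro m n hmn
  have h1 : (1 : ℝ) / (n + 1) ≤ 1 / (m + 1) := one_div_le_one_div_of_le (by positivity)
    (by exact_mod_cast Nat.add_le_add_right hmn 1)
  refine image_mono fun s hs => ⟨⟨hs.1.1, hs.1.2.trans_le h1⟩, ?_, ?_⟩
  · exact lt_of_le_of_lt (by linarith) hs.2.1
  · exact hs.2.2.trans_le (by linarith)

theorem tendsto_one_div_succ : Tendsto (fun n : ℕ => (1 : ℝ) / (n + 1)) atTop (𝓝 0) :=
  tendsto_one_div_add_atTop_nhds_zero_nat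

namespace IsBottcher

theorem imp_arc_eq (h : IsBottcher v ψ) {u : ℂ} (hu : ‖u‖ = 1) (a : ℝ) :
    imp v ψ (arc u a) = ⋂ n, closure (ψ '' sector u a n) := by
  ext z
  constructor
  · rintro ⟨hzJ, e, ⟨b, hb, rfl⟩, hze⟩
    obtain ⟨w, hw, h1, h2⟩ := mem_gr_iff.1 hze
    simp only at h2
    set e := u * Complex.exp (b * Complex.I) with he
    have he1 : ‖e‖ = 1 := by rw [he, norm_mul, hu, Complex.norm_exp_ofReal_mul_I, one_mul]
    have he0 : e ≠ 0 := by intro h; rw [h, norm_zero] at he1; exact zero_ne_one he1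
    have h3 := h.tendsto_norm_one (Eventually.of_forall hw) (julia_subset_filled v hzJ) h1
    have h4 : Tendsto (fun n => Complex.arg (w n / e)) atTop (𝓝 0) := by
      have h5 : Tendsto (fun n => Complex.arg (w n / (‖w n‖ : ℂ) / e)) atTop (𝓝 0) := by
        have h6 := (Complex.continuousAt_arg (x := 1) (by simp)).tendsto
        rw [Complex.arg_one] at h6
        refine h6.comp ?_
        simpa [div_self he0] using h2.div_const e
      refine h5.congr fun n => ?_
      have : w n / (‖w n‖ : ℂ) / e = ((‖w n‖⁻¹ : ℝ) : ℂ) * (w n / e) := by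
        push_cast; ring
      rw [this, Complex.arg_real_mul _ (inv_pos.2 (zero_lt_one.trans (hw n)))]
    refine mem_iInter.2 fun n => mem_closure_of_tendsto h1 ?_
    have hpos : (0 : ℝ) < 1 / (n + 1) := by positivity
    filter_upwards [h3.eventually_lt_const (Real.one_lt_exp_iff.2 hpos),
      (h4.abs.eventually_lt_const (by simpa using hpos) : ∀ᶠ m in atTop, _ < (1 : ℝ) / (n + 1))]
      with m hm1 hm2
    exact mem_image_of_mem ψ (mem_sector hu (hw m) hm1 (abs_le.2 hb) hm2)
  · intro hz
    have hex : ∀ n : ℕ, ∃ w ∈ sector u a n, dist (ψ w) z < 1 / (n + 1) := by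
      intro n
      obtain ⟨_, ⟨w, hw, rfl⟩, hd⟩ := Metric.mem_closure_iff.1 (mem_iInter.1 hz n) (1 / (n + 1))
        (by positivity)
      exact ⟨w, hw, by rwa [dist_comm]⟩
    choose w hw hd using hex
    have h1 : Tendsto (fun n => ψ (w n)) atTop (𝓝 z) := by
      rw [tendsto_iff_dist_tendsto_zero]
      exact squeeze_zero (fun _ => dist_nonneg) (fun n => (hd n).le) tendsto_one_div_succ
    have hw1 : ∀ n, 1 < ‖w n‖ := fun n => (sector_norm hu (hw n)).1
    have h2 : Tendsto (fun n => ‖w n‖) atTop (𝓝 1) := by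
      refine tendsto_of_tendsto_of_tendsto_of_le_of_le tendsto_const_nhds
        (h := fun n : ℕ => Real.exp (1 / (n + 1))) ?_ (fun n => (hw1 n).le)
        fun n => (sector_norm hu (hw n)).2.1.le
      have := (Real.continuous_exp.tendsto 0).comp tendsto_one_div_succ
      rwa [Real.exp_zero] at this
    obtain ⟨e, k, hk, hke, hze⟩ := exists_subseq_mem_gr hw1 h1
    have hzJ : z ∈ julia v := by
      rw [mem_julia_iff]
      refine ⟨?_, h.ang_subset univ ⟨e, mem_univ _, hze⟩⟩
      by_contra hzK
      obtain ⟨w', hw', rfl⟩ := h.exists_eq hzK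
      have h3 := (h.tendsto_of_comp (Eventually.of_forall hw1) hw' h1).norm
      exact hw'.ne (tendsto_nhds_unique h2 h3)
    refine ⟨hzJ, e, ?_, hze⟩
    choose θ hθ hθe using fun n => (sector_norm hu (hw (k n))).2.2
    have hb : ∀ n, θ n ∈ Icc (-(a + 1)) (a + 1) := by
      intro n
      have : (1 : ℝ) / (k n + 1) ≤ 1 := by
        rw [div_le_one (by positivity)]
        linarith [(k n).cast_nonneg (α := ℝ)]
      exact ⟨by linarith [(hθ n).1], by linarith [(hθ n).2]⟩
    obtain ⟨t, -, m, hm, ht⟩ := isCompact_Icc.tendsto_subseq hb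
    have hk' : Tendsto (fun n => (1 : ℝ) / (k (m n) + 1)) atTop (𝓝 0) :=
      tendsto_one_div_succ.comp (hk.comp hm).tendsto_atTop
    refine ⟨t, ⟨?_, ?_⟩, ?_⟩
    · have h4 : Tendsto (fun n => -(a + 1 / ((k (m n) : ℝ) + 1))) atTop (𝓝 (-a)) := by
        simpa using (hk'.const_add a).neg
      exact le_of_tendsto_of_tendsto' h4 ht fun n => (hθ _).1
    · have h4 : Tendsto (fun n => (a + 1 / ((k (m n) : ℝ) + 1))) atTop (𝓝 a) := by
        simpa using hk'.const_add a
      exact le_of_tendsto_of_tendsto' ht h4 fun n => (hθ _).2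
    · have h5 : Continuous fun θ : ℝ => u * Complex.exp (θ * Complex.I) := by fun_prop
      refine tendsto_nhds_unique ((h5.tendsto t).comp ht) ((hke.comp hm.tendsto_atTop).congr ?_)
      intro n
      exact (hθe (m n)).symm

theorem exists_norm_psi_le (h : IsBottcher v ψ) :
    ∃ R, ∀ w, 1 < ‖w‖ → ‖w‖ ≤ 4 → ‖ψ w‖ ≤ R := by
  have hc : IsCompact {w : ℂ | 2 ≤ ‖w‖ ∧ ‖w‖ ≤ 4} := by
    refine (isCompact_closedBall (0 : ℂ) 4).of_isClosed_subset ?_ fun w hw => ?_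
    · exact (isClosed_le continuous_const continuous_norm).inter
        (isClosed_le continuous_norm continuous_const)
    · simpa using hw.2
  obtain ⟨M, hM⟩ := hc.exists_bound_of_continuousOn (f := ψ) fun w hw =>
    (h.continuousAt (lt_of_lt_of_le one_lt_two hw.1)).continuousWithinAt
  refine ⟨max M (‖v‖ + 2), ?_⟩
  have key : ∀ n : ℕ, ∀ w : ℂ, 1 < ‖w‖ → ‖w‖ ≤ 4 → 2 ≤ ‖w‖ ^ 2 ^ n →
      ‖ψ w‖ ≤ max M (‖v‖ + 2) := by
    intro n
    induction n with
    | zero => exact fun w _ h4 h2 => (hM w ⟨by simpa using h2, h4⟩).trans (le_max_left _ _)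
    | succ n ih =>
      intro w h1 h4 h2
      rcases le_or_gt 2 ‖w‖ with hw | hw
      · exact (hM w ⟨hw, h4⟩).trans (le_max_left _ _)
      have h5 := ih (w ^ 2) (one_lt_norm_pow h1 2 two_ne_zero)
        (by rw [norm_pow]; nlinarith) (by rw [norm_pow, ← pow_mul, ← pow_succ']; exact h2)
      by_contra! hcon
      have h6 := two_mul_norm_le_norm_quad (v := v) ((le_max_right M _).trans hcon.le)
      rw [← h.conj w h1] at h6
      linarith [(norm_nonneg (ψ w))]
  intro w h1 h4
  obtain ⟨n, hn⟩ := pow_unbounded_of_one_lt 2 h1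
  exact key n w h1 h4 (hn.le.trans (pow_le_pow_right₀ h1.le n.lt_two_pow_self.le))

theorem isConnected_imp_arc (h : IsBottcher v ψ) {u : ℂ} (hu : ‖u‖ = 1) {a : ℝ} (ha : 0 ≤ a) :
    IsConnected (imp v ψ (arc u a)) := by
  have hanti : Antitone fun n => closure (ψ '' sector u a n) := fun m n hmn =>
    closure_mono (image_mono (sector_anti u a hmn))
  obtain ⟨R, hR⟩ : ∃ R, ∀ n, closure (ψ '' sector u a n) ⊆ closedBall 0 R := by
    obtain ⟨R, hR⟩ := h.exists_norm_psi_le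
    refine ⟨R, fun n => closure_minimal ?_ isClosed_closedBall⟩
    rintro _ ⟨w, hw, rfl⟩
    obtain ⟨h1, h2, -⟩ := sector_norm hu hw
    have h3 : Real.exp (1 / (n + 1)) ≤ 4 := by
      have h4 : (1 : ℝ) / (n + 1) ≤ 1 := by
        rw [div_le_one (by positivity)]
        linarith [n.cast_nonneg (α := ℝ)]
      linarith [Real.exp_le_exp.2 h4, Real.exp_one_lt_three]
    simpa using hR w h1 (h2.le.trans h3)
  have hc : ∀ n, IsCompact (closure (ψ '' sector u a n)) := fun n =>
    (isCompact_closedBall 0 R).of_isClosed_subset isClosed_closure (hR n)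
  rw [h.imp_arc_eq hu]
  constructor
  · refine IsCompact.nonempty_iInter_of_sequence_nonempty_isCompact_isClosed _
      (fun n => hanti n.le_succ) (fun n => ?_) (hc 0) fun n => isClosed_closure
    refine Set.Nonempty.closure (Set.Nonempty.image _ (Set.Nonempty.image _ ?_))
    have hpos : (0 : ℝ) < 1 / (n + 1) := by positivity
    refine ⟨((1 / (n + 1) / 2 : ℝ) : ℂ), ⟨?_, ?_⟩, ?_, ?_⟩ <;>
      simp only [Complex.ofReal_re, Complex.ofReal_im] <;> linarith
  · refine isPreconnected_iInter_of_antitone hanti hc fun n => IsPreconnected.closure ?_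
    refine IsPreconnected.image ?_ _ fun w hw =>
      (h.continuousAt (sector_norm hu hw).1).continuousWithinAt
    refine IsPreconnected.image ?_ _ (by fun_prop)
    exact (((convex_Ioo _ _).linear_preimage Complex.reLm).inter
      ((convex_Ioo _ _).linear_preimage Complex.imLm)).isPreconnected

theorem isConnected_imp (h : IsBottcher v ψ) {u : ℂ} (hu : ‖u‖ = 1) :
    IsConnected (imp v ψ {u}) := by
  rw [← arc_zero u]
  exact h.isConnected_imp_arc hu le_rfl

end IsBottcher

end CremerJulia

namespace CremerJulia
open Set Filter Topology Metric MeasureTheory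
open scoped ENNReal

theorem det_smulRight_deriv (c : ℂ) :
    ((ContinuousLinearMap.toSpanSingleton ℂ c).restrictScalars ℝ).det = ‖c‖ ^ 2 := by
  have : ((((ContinuousLinearMap.toSpanSingleton ℂ c).restrictScalars ℝ : ℂ →L[ℝ] ℂ)) : ℂ →ₗ[ℝ] ℂ)
      = Algebra.lmul ℝ ℂ c := by
    ext
    simp [mul_comm]
  rw [ContinuousLinearMap.det, this, ← Complex.normSq_eq_norm_sq, ← Algebra.norm_complex_apply]
  rfl

theorem lintegral_deriv_sq_eq_volume_image {h : ℂ → ℂ} {R : Set ℂ} (hR : IsOpen R)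
    (hd : DifferentiableOn ℂ h R) (hinj : InjOn h R) :
    ∫⁻ z in R, ‖deriv h z‖ₑ ^ 2 = volume (h '' R) := by
  rw [← lintegral_abs_det_fderiv_eq_addHaar_image volume hR.measurableSet
    (f' := fun z => (ContinuousLinearMap.toSpanSingleton ℂ (deriv h z)).restrictScalars ℝ)
    (fun z hz => ((hd.differentiableAt (hR.mem_nhds hz)).hasDerivAt.hasFDerivAt.restrictScalars
      ℝ).hasFDerivWithinAt) hinj]
  refine lintegral_congr fun z => ?_
  rw [det_smulRight_deriv, abs_of_nonneg (by positivity), ENNReal.ofReal_pow (norm_nonneg _),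
    ofReal_norm]

theorem setLIntegral_reProdIm {f : ℂ → ℝ≥0∞} (hf : Measurable f) (I J : Set ℝ) :
    ∫⁻ z in I ×ℂ J, f z = ∫⁻ x in I, ∫⁻ y in J, f (x + y * Complex.I) := by
  have h1 := (Complex.volume_preserving_equiv_real_prod.symm).setLIntegral_comp_preimage_emb
    Complex.measurableEquivRealProd.symm.measurableEmbedding f (I ×ℂ J)
  have h2 : Complex.measurableEquivRealProd.symm ⁻¹' (I ×ℂ J) = I ×ˢ J := by
    ext ⟨a, b⟩
    simp [Complex.mem_reProdIm, Complex.measurableEquivRealProd_symm_apply]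
  rw [← h1, h2, Measure.volume_eq_prod, ← Measure.prod_restrict, lintegral_prod]
  · simp only [Complex.measurableEquivRealProd_symm_apply, Complex.mk_eq_add_mul_I]
  · exact (hf.comp Complex.measurableEquivRealProd.symm.measurable).aemeasurable

theorem setLIntegral_reProdIm_symm {f : ℂ → ℝ≥0∞} (hf : Measurable f) (I J : Set ℝ) :
    ∫⁻ z in I ×ℂ J, f z = ∫⁻ y in J, ∫⁻ x in I, f (x + y * Complex.I) := by
  rw [setLIntegral_reProdIm hf, lintegral_lintegral_swap]
  exact (hf.comp (by fun_prop)).aemeasurable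

theorem exists_mem_Ioo_lintegral_le {g : ℝ → ℝ≥0∞} (hg : Measurable g) {a b : ℝ} (hab : a < b)
    {A : ℝ≥0∞} (hA : ∫⁻ x in Ioo a b, g x ≤ A) :
    ∃ x ∈ Ioo a b, g x ≤ A / ENNReal.ofReal (b - a) := by
  have hv : volume (Ioo a b) = ENNReal.ofReal (b - a) := Real.volume_Ioo
  have h0 : volume (Ioo a b) ≠ 0 := by rw [hv]; simpa using hab
  have h1 : volume (Ioo a b) ≠ ∞ := by rw [hv]; exact ENNReal.ofReal_ne_top
  obtain ⟨x, hx, hle⟩ := exists_le_setLAverage h0 h1 hg.aemeasurable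
  refine ⟨x, hx, hle.trans ?_⟩
  rw [setLAverage_eq, hv]
  gcongr

theorem enorm_le_add_sq (a : ℝ≥0∞) {κ : ℝ≥0∞} (h0 : κ ≠ 0) (h1 : κ ≠ ∞) : a ≤ κ + κ⁻¹ * a ^ 2 := by
  rcases le_total a κ with h | h
  · exact h.trans le_self_add
  · calc a = κ⁻¹ * (κ * a) := by rw [← mul_assoc, ENNReal.inv_mul_cancel h0 h1, one_mul]
      _ ≤ κ⁻¹ * (a * a) := by gcongr
      _ = κ⁻¹ * a ^ 2 := by rw [sq]
      _ ≤ _ := le_add_self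

theorem norm_sub_le_of_line {h : ℂ → ℂ} {O : Set ℂ} (hO : IsOpen O) (hd : DifferentiableOn ℂ h O)
    {γ : ℝ → ℂ} {d : ℂ} (hdn : ‖d‖ = 1) (hγ : ∀ x, HasDerivAt γ d x) {I : Set ℝ}
    (hI : OrdConnected I) (hγO : ∀ x ∈ I, γ x ∈ O) {κ ε : ℝ} (hκ : 0 < κ) {m : ℝ} (hm : 0 ≤ m)
    (hvol : volume I ≤ ENNReal.ofReal m) (hε : 0 ≤ ε)
    (hdir : ∫⁻ x in I, ‖deriv h (γ x)‖ₑ ^ 2 ≤ ENNReal.ofReal ε) {x y : ℝ} (hx : x ∈ I)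
    (hy : y ∈ I) :
    ‖h (γ x) - h (γ y)‖ ≤ κ * m + κ⁻¹ * ε := by
  wlog hxy : y ≤ x generalizing x y
  · rw [norm_sub_rev]
    exact this hy hx (le_of_not_ge hxy)
  have hsub : Icc y x ⊆ I := hI.out hy hx
  have hder : ∀ t ∈ uIcc y x, HasDerivAt (fun t => h (γ t)) (d * deriv h (γ t)) t := by
    intro t ht
    rw [uIcc_of_le hxy] at ht
    have h1 := (hd.differentiableAt (hO.mem_nhds (hγO t (hsub ht)))).hasDerivAt
    have := h1.scomp t (hγ t)
    simpa [Function.comp_def] using! this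
  have hγc : Continuous γ := continuous_iff_continuousAt.2 fun t => (hγ t).continuousAt
  have hcont : ContinuousOn (fun t => d * deriv h (γ t)) (uIcc y x) := by
    rw [uIcc_of_le hxy]
    refine continuousOn_const.mul ?_
    exact (hd.deriv hO).continuousOn.comp hγc.continuousOn fun t ht => hγO t (hsub ht)
  have hftc := intervalIntegral.integral_eq_sub_of_hasDerivAt hder hcont.intervalIntegrable
  rw [← hftc, intervalIntegral.integral_of_le hxy, ← ENNReal.ofReal_le_ofReal_iff (by positivity),
    ofReal_norm]
  refine (enorm_integral_le_lintegral_enorm _).trans ?_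
  have hκ0 : ENNReal.ofReal κ ≠ 0 := by simpa using hκ
  calc ∫⁻ t in Ioc y x, ‖d * deriv h (γ t)‖ₑ
      ≤ ∫⁻ t in I, ‖d * deriv h (γ t)‖ₑ :=
        lintegral_mono_set (Ioc_subset_Icc_self.trans hsub)
    _ = ∫⁻ t in I, ‖deriv h (γ t)‖ₑ := by
        refine lintegral_congr fun t => ?_
        rw [enorm_mul, ← ofReal_norm d, hdn, ENNReal.ofReal_one, one_mul]
    _ ≤ ∫⁻ t in I, (ENNReal.ofReal κ + (ENNReal.ofReal κ)⁻¹ * ‖deriv h (γ t)‖ₑ ^ 2) :=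
        lintegral_mono fun t => enorm_le_add_sq _ hκ0 ENNReal.ofReal_ne_top
    _ = ENNReal.ofReal κ * volume I +
          (ENNReal.ofReal κ)⁻¹ * ∫⁻ t in I, ‖deriv h (γ t)‖ₑ ^ 2 := by
        rw [lintegral_add_left measurable_const, setLIntegral_const, lintegral_const_mul]
        exact ((measurable_deriv h).comp hγc.measurable).enorm.pow_const 2
    _ ≤ ENNReal.ofReal κ * ENNReal.ofReal m + (ENNReal.ofReal κ)⁻¹ * ENNReal.ofReal ε := by
        gcongr
    _ = ENNReal.ofReal (κ * m + κ⁻¹ * ε) := by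
        rw [ENNReal.ofReal_add (by positivity) (by positivity), ENNReal.ofReal_mul hκ.le,
          ENNReal.ofReal_mul (by positivity), ENNReal.ofReal_inv_of_pos hκ]

theorem exists_small_box {f : ℂ → ℝ≥0∞} {t : ℝ}
    (hA : ∫⁻ z in Ioo 0 1 ×ℂ Ioo (t - 2) (t + 2), f z ≠ ∞) {η δ : ℝ} (hη : 0 < η) (hδ : 0 < δ) :
    ∃ w, 0 < w ∧ w < δ ∧
      ∫⁻ z in Ioo 0 w ×ℂ Ioo (t - 2 * w) (t + 2 * w), f z ≤ ENNReal.ofReal η := by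
  have hlim : Tendsto (fun w : ℝ => (volume.restrict (Ioo 0 1 ×ℂ Ioo (t - 2) (t + 2)))
      (Ioo 0 w ×ℂ Ioo (t - 2 * w) (t + 2 * w))) (𝓝 0) (𝓝 0) := by
    have h1 : ∀ w : ℝ, volume (Ioo 0 w ×ℂ Ioo (t - 2 * w) (t + 2 * w)) =
        ENNReal.ofReal w * ENNReal.ofReal (4 * w) := by
      intro w
      have h2 := setLIntegral_reProdIm (f := fun _ => 1) measurable_const (Ioo 0 w)
        (Ioo (t - 2 * w) (t + 2 * w))
      simp only [setLIntegral_const, Real.volume_Ioo, one_mul, sub_zero] at h2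
      rw [h2, mul_comm]
      congr 2
      ring
    refine tendsto_of_tendsto_of_tendsto_of_le_of_le tendsto_const_nhds (h := fun w : ℝ =>
      ENNReal.ofReal w * ENNReal.ofReal (4 * w)) ?_ (fun _ => zero_le) fun w => ?_
    · have h3 : Tendsto (fun w : ℝ => ENNReal.ofReal w) (𝓝 0) (𝓝 0) := by
        simpa using (ENNReal.continuous_ofReal.tendsto 0)
      have h4 : Tendsto (fun w : ℝ => ENNReal.ofReal (4 * w)) (𝓝 0) (𝓝 0) := by
        have := (ENNReal.continuous_ofReal.comp (continuous_const_mul (4 : ℝ))).tendsto 0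
        simpa only [Function.comp_def, mul_zero, ENNReal.ofReal_zero] using this
      simpa using ENNReal.Tendsto.mul h3 (by simp) h4 (by simp)
    · exact (Measure.restrict_apply_le _ _).trans (h1 w).le
  have h2 := tendsto_setLIntegral_zero hA hlim
  have h3 : ∀ᶠ w in 𝓝[>] (0 : ℝ), ∫⁻ z in Ioo 0 w ×ℂ Ioo (t - 2 * w) (t + 2 * w), f z
      ∂(volume.restrict (Ioo 0 1 ×ℂ Ioo (t - 2) (t + 2))) < ENNReal.ofReal η :=
    (h2.mono_left nhdsWithin_le_nhds).eventually_lt_const (by simpa using hη)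
  have h4 : ∀ᶠ w in 𝓝[>] (0 : ℝ), w ∈ Ioo 0 (min δ 1) :=
    Ioo_mem_nhdsGT (lt_min hδ one_pos)
  obtain ⟨w, hw1, hw0, hw2⟩ := (h3.and h4).exists
  refine ⟨w, hw0, hw2.trans_le (min_le_left _ _), ?_⟩
  have hw3 : w < 1 := hw2.trans_le (min_le_right _ _)
  rw [Measure.restrict_restrict ((isOpen_Ioo.reProdIm isOpen_Ioo).measurableSet),
    inter_eq_self_of_subset_left] at hw1
  · exact hw1.le
  · intro s hs
    exact ⟨⟨hs.1.1, hs.1.2.trans hw3⟩, by linarith [hs.2.1], by linarith [hs.2.2]⟩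

theorem exists_short_crosscut {h : ℂ → ℂ} {t : ℝ} (hd : DifferentiableOn ℂ h {s | 0 < s.re})
    (hA : ∫⁻ z in Ioo 0 1 ×ℂ Ioo (t - 2) (t + 2), ‖deriv h z‖ₑ ^ 2 ≠ ∞)
    {ε δ : ℝ} (hε : 0 < ε) (hδ : 0 < δ) :
    ∃ x α β : ℝ, 0 < x ∧ x < δ ∧ t - δ < α ∧ α < t ∧ t < β ∧ β < t + δ ∧
      (∀ s : ℂ, 0 < s.re → s.re ≤ x → s.im = α ∨ s.im = β →
        ‖h s - h (x + s.im * Complex.I)‖ ≤ ε) ∧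
      (∀ s : ℂ, s.re = x → α ≤ s.im → s.im ≤ β → ‖h s - h (x + t * Complex.I)‖ ≤ ε) := by
  obtain ⟨w, hw, hwδ, hI⟩ := exists_small_box hA (η := (ε / 5) ^ 2) (by positivity)
    (half_pos hδ)
  have hmeas : Measurable fun z => ‖deriv h z‖ₑ ^ 2 := (measurable_deriv h).enorm.pow_const 2
  have hO : IsOpen {s : ℂ | 0 < s.re} := isOpen_lt continuous_const Complex.continuous_re
  have hdiv : ∀ l : ℝ, l = w → ENNReal.ofReal ((ε / 5) ^ 2) / ENNReal.ofReal l =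
      ENNReal.ofReal ((ε / 5) ^ 2 / w) := by
    rintro l rfl
    rw [ENNReal.ofReal_div_of_pos hw]
  have hm1 : Measurable fun y : ℝ => ∫⁻ x in Ioo 0 w, ‖deriv h (x + y * Complex.I)‖ₑ ^ 2 :=
    (hmeas.comp (by fun_prop : Measurable fun q : ℝ × ℝ =>
      (q.2 + q.1 * Complex.I : ℂ))).lintegral_prod_right'
  have hm2 : Measurable fun x : ℝ => ∫⁻ y in Ioo (t - 2 * w) (t + 2 * w),
      ‖deriv h (x + y * Complex.I)‖ₑ ^ 2 :=
    (hmeas.comp (by fun_prop : Measurable fun q : ℝ × ℝ =>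
      (q.1 + q.2 * Complex.I : ℂ))).lintegral_prod_right'
  have hI1 := hI
  rw [setLIntegral_reProdIm_symm hmeas] at hI1
  have hI2 := hI
  rw [setLIntegral_reProdIm hmeas] at hI2
  obtain ⟨α, hα, hαI⟩ := exists_mem_Ioo_lintegral_le hm1 (a := t - 2 * w) (b := t - w)
    (by linarith) ((lintegral_mono_set (Ioo_subset_Ioo le_rfl (by linarith))).trans hI1)
  obtain ⟨β, hβ, hβI⟩ := exists_mem_Ioo_lintegral_le hm1 (a := t + w) (b := t + 2 * w)
    (by linarith) ((lintegral_mono_set (Ioo_subset_Ioo (by linarith) le_rfl)).trans hI1)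
  obtain ⟨x, hx, hxI⟩ := exists_mem_Ioo_lintegral_le hm2 (a := 0) (b := w) hw hI2
  rw [hdiv _ (by ring)] at hαI hβI hxI
  have hκ : 0 < ε / 5 / w := by positivity
  refine ⟨x, α, β, hx.1, by linarith [hx.2], by linarith [hα.1], by linarith [hα.2],
    by linarith [hβ.1], by linarith [hβ.2], ?_, ?_⟩
  · have key : ∀ y : ℝ, ∫⁻ x in Ioo 0 w, ‖deriv h (x + y * Complex.I)‖ₑ ^ 2 ≤
        ENNReal.ofReal ((ε / 5) ^ 2 / w) → ∀ s : ℂ, 0 < s.re → s.re ≤ x → s.im = y →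
        ‖h s - h (x + s.im * Complex.I)‖ ≤ ε := by
      rintro y hy s h0 hsx rfl
      have := norm_sub_le_of_line hO hd (γ := fun r : ℝ => (r + s.im * Complex.I : ℂ)) (d := 1)
        (by simp) (fun r => (Complex.ofRealCLM.hasDerivAt (x := r)).add_const _) ordConnected_Ioo
        (I := Ioo 0 w) (fun r hr => by simpa using hr.1) hκ hw.le (by simp) (by positivity) hy
        (x := s.re) (y := x) ⟨h0, hsx.trans_lt hx.2⟩ hx
      rw [Complex.re_add_im] at this
      refine this.trans (le_of_eq_of_le ?_ (by linarith : 2 * (ε / 5) ≤ ε))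
      field_simp
      ring
    rintro s h0 hsx (hs | hs)
    · exact key α hαI s h0 hsx hs
    · exact key β hβI s h0 hsx hs
  · intro s hsx h1 h2
    have := norm_sub_le_of_line hO hd (γ := fun r : ℝ => (x + r * Complex.I : ℂ))
      (d := Complex.I) (by simp)
      (fun r => by
        simpa using ((Complex.ofRealCLM.hasDerivAt (x := r)).mul_const Complex.I).const_add (x : ℂ))
      ordConnected_Ioo
      (I := Ioo (t - 2 * w) (t + 2 * w)) (fun r hr => by simpa using hx.1) hκ (m := 4 * w)
      (by positivity)
      (by rw [Real.volume_Ioo]; exact ENNReal.ofReal_le_ofReal (by linarith)) (by positivity) hxI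
      (x := s.im) (y := t) ⟨by linarith [hα.1], by linarith [hβ.2]⟩ ⟨by linarith, by linarith⟩
    rw [← hsx, Complex.re_add_im] at this
    rw [← hsx]
    refine this.trans (le_of_eq ?_)
    field_simp
    ring

end CremerJulia

namespace CremerJulia
open Set Filter Topology Metric MeasureTheory
open scoped ENNReal

/-- Three sides of a box in logarithmic coordinates. -/
def sides (x α β : ℝ) : Set ℂ :=
  {s | 0 < s.re ∧ s.re ≤ x ∧ (s.im = α ∨ s.im = β)} ∪ {s | s.re = x ∧ α ≤ s.im ∧ s.im ≤ β}

theorem exists_transversal {h : ℂ → ℂ} {σ d : ℂ} (hd : HasStrictDerivAt h d σ) (hd0 : d ≠ 0)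
    {V : Set ℂ} (hV : V ∈ 𝓝 σ) : ∃ η > 0, ∀ y : ℝ, |y| ≤ η →
      ∃ s ∈ V, h s = h σ + y * d ∧ (0 < y → σ.re < s.re) ∧ (y < 0 → s.re < σ.re) := by
  set G := hd.localInverse h d σ hd0 with hG
  have hG0 : G (h σ) = σ := HasStrictFDerivAt.localInverse_apply_image _
  have hγ : HasDerivAt (fun y : ℝ => h σ + y * d) d 0 := by
    simpa using ((Complex.ofRealCLM.hasDerivAt (x := 0)).mul_const d).const_add (h σ)
  have hγ0 : h σ + ((0 : ℝ) : ℂ) * d = h σ := by simp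
  have hγc : Tendsto (fun y : ℝ => h σ + y * d) (𝓝 0) (𝓝 (h σ)) := by
    simpa using hγ.continuousAt.tendsto
  have hg : HasDerivAt (fun y : ℝ => G (h σ + y * d)) 1 0 := by
    have h1 : HasDerivAt G d⁻¹ (h σ + ((0 : ℝ) : ℂ) * d) := by
      rw [hγ0]; exact (hd.to_localInverse hd0).hasDerivAt
    have h2 := h1.scomp 0 hγ
    simpa [Function.comp_def, hd0] using! h2
  have hr : HasDerivAt (fun y : ℝ => (G (h σ + y * d)).re) 1 0 := by
    simpa using! Complex.reCLM.hasFDerivAt.comp_hasDerivAt 0 hg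
  have h3 := hr.isLittleO.def (c := 1 / 2) (by norm_num)
  have h4 : ∀ᶠ y : ℝ in 𝓝 0, G (h σ + y * d) ∈ V := by
    have h5 : Tendsto (fun y : ℝ => G (h σ + y * d)) (𝓝 0) (𝓝 σ) := by
      have := hg.continuousAt.tendsto
      simpa [hG0] using this
    exact h5 hV
  have h6 := hγc.eventually (hd.eventually_right_inverse hd0)
  obtain ⟨η, hη, hball⟩ := Metric.eventually_nhds_iff.1 (h3.and (h4.and h6))
  refine ⟨η / 2, half_pos hη, fun y hy => ?_⟩
  obtain ⟨h7, h8, h9⟩ := hball (y := y) (by rw [dist_zero_right, Real.norm_eq_abs]; linarith)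
  refine ⟨_, h8, h9, fun hy0 => ?_, fun hy0 => ?_⟩
  · simp [hG0, abs_of_pos hy0] at h7
    linarith [(abs_le.1 h7).1]
  · simp [hG0, abs_of_neg hy0] at h7
    linarith [(abs_le.1 h7).2]

variable {v : ℂ} {ψ : ℂ → ℂ}

theorem one_lt_norm_exp {s : ℂ} (hs : 0 < s.re) : 1 < ‖Complex.exp s‖ := by
  rw [Complex.norm_exp]; exact Real.one_lt_exp_iff.2 hs

namespace IsBottcher

theorem differentiableOn_exp (h : IsBottcher v ψ) :
    DifferentiableOn ℂ (fun s => ψ (Complex.exp s)) {s | 0 < s.re} :=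
  h.diff.comp Complex.differentiable_exp.differentiableOn fun _ hs => one_lt_norm_exp hs

theorem eq_of_exp (h : IsBottcher v ψ) {s s' : ℂ} (hs : 0 < s.re) (hs' : 0 < s'.re)
    (he : ψ (Complex.exp s) = ψ (Complex.exp s')) : s.re = s'.re ∧
      (|s.im - s'.im| < 2 * Real.pi → s = s') := by
  have h1 := h.inj (one_lt_norm_exp hs) (one_lt_norm_exp hs') he
  have h2 : s.re = s'.re := by
    have := congrArg norm h1
    rwa [Complex.norm_exp, Complex.norm_exp, Real.exp_eq_exp] at this
  refine ⟨h2, fun h3 => eq_of_exp_eq_of_norm_lt h1 ?_⟩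
  have : s - s' = ((s.im - s'.im : ℝ) : ℂ) * Complex.I := by
    apply Complex.ext <;> simp [h2]
  rwa [this, norm_mul, Complex.norm_I, mul_one, Complex.norm_real]

theorem exists_crosscut (h : IsBottcher v ψ) (t : ℝ) : ∃ ξ ∈ julia v, ∀ δ > 0, ∃ x α β : ℝ,
    0 < x ∧ x < δ ∧ t - δ < α ∧ α < t ∧ t < β ∧ β < t + δ ∧
      ∀ s ∈ sides x α β, ψ (Complex.exp s) ∈ ball ξ δ := by
  set H : ℂ → ℂ := fun s => ψ (Complex.exp s) with hH
  obtain ⟨R, hR⟩ := h.exists_norm_psi_le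
  have hA : ∫⁻ z in Ioo 0 1 ×ℂ Ioo (t - 2) (t + 2), ‖deriv H z‖ₑ ^ 2 ≠ ∞ := by
    rw [lintegral_deriv_sq_eq_volume_image (isOpen_Ioo.reProdIm isOpen_Ioo)
      (h.differentiableOn_exp.mono fun s hs => hs.1.1)]
    · refine (lt_of_le_of_lt (measure_mono (t := closedBall (0 : ℂ) R) ?_)
        measure_closedBall_lt_top).ne
      rintro _ ⟨s, hs, rfl⟩
      rw [mem_closedBall_zero_iff]
      refine hR _ (one_lt_norm_exp hs.1.1) ?_
      rw [Complex.norm_exp]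
      linarith [Real.exp_le_exp.2 hs.1.2.le, Real.exp_one_lt_three]
    · intro s hs s' hs' he
      refine (h.eq_of_exp hs.1.1 hs'.1.1 he).2 ?_
      have := Real.pi_gt_three
      rw [abs_lt]
      constructor <;> linarith [hs.2.1, hs.2.2, hs'.2.1, hs'.2.2]
  have hpos : ∀ n : ℕ, (0 : ℝ) < 1 / (n + 1) := fun n => by positivity
  choose x α β hx0 hx1 hα1 hα2 hβ1 hβ2 hh hv using fun n : ℕ =>
    exists_short_crosscut h.differentiableOn_exp hA (hpos n) (hpos n)
  have hq1 : ∀ n, 1 < ‖Complex.exp (x n + t * Complex.I)‖ := fun n =>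
    one_lt_norm_exp (by simpa using hx0 n)
  have hqn : ∀ n, ‖Complex.exp (x n + t * Complex.I)‖ = Real.exp (x n) := fun n => by
    rw [Complex.norm_exp]; simp
  have hxlim : Tendsto x atTop (𝓝 0) := squeeze_zero (fun n => (hx0 n).le) (fun n => (hx1 n).le)
    tendsto_one_div_succ
  have hx_le : ∀ n, x n ≤ 1 := fun n => (hx1 n).le.trans (by
    rw [div_le_one (by positivity)]; linarith [n.cast_nonneg (α := ℝ)])
  obtain ⟨ξ, -, k, hk, hξ⟩ := (isCompact_closedBall (0 : ℂ) R).tendsto_subseq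
    (x := fun n => H (x n + t * Complex.I)) fun n => by
      rw [mem_closedBall_zero_iff]
      refine hR _ (hq1 n) ?_
      rw [hqn]
      linarith [Real.exp_le_exp.2 (hx_le n), Real.exp_one_lt_three]
  obtain ⟨u, -, -, -, hu⟩ := exists_subseq_mem_gr (fun n => hq1 (k n)) hξ
  have hξJ : ξ ∈ julia v := by
    rw [mem_julia_iff]
    refine ⟨?_, h.ang_subset univ ⟨u, mem_univ _, hu⟩⟩
    by_contra hK
    obtain ⟨w, hw, rfl⟩ := h.exists_eq hK
    have h1 := (h.tendsto_of_comp (Eventually.of_forall fun n => hq1 (k n)) hw hξ).norm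
    have h2 : Tendsto (fun n => ‖Complex.exp (x (k n) + t * Complex.I)‖) atTop (𝓝 1) := by
      have := (Real.continuous_exp.tendsto 0).comp (hxlim.comp hk.tendsto_atTop)
      rw [Real.exp_zero] at this
      exact this.congr fun n => (hqn _).symm
    exact hw.ne (tendsto_nhds_unique h2 h1)
  refine ⟨ξ, hξJ, fun δ hδ => ?_⟩
  have hk1 : Tendsto (fun n => (1 : ℝ) / (k n + 1)) atTop (𝓝 0) :=
    tendsto_one_div_succ.comp hk.tendsto_atTop
  obtain ⟨n, hn1, hn2⟩ := ((hk1.eventually_lt_const (by positivity : 0 < δ / 3)).and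
    (hξ.eventually (ball_mem_nhds ξ (by positivity : 0 < δ / 3)))).exists
  refine ⟨x (k n), α (k n), β (k n), hx0 _, by linarith [hx1 (k n)], by linarith [hα1 (k n)],
    hα2 _, hβ1 _, by linarith [hβ2 (k n)], ?_⟩
  have hvert : ∀ s : ℂ, s.re = x (k n) → α (k n) ≤ s.im → s.im ≤ β (k n) →
      dist (H s) ξ < 2 * (δ / 3) := by
    intro s h1 h2 h3
    have h4 := hv (k n) s h1 h2 h3
    rw [← dist_eq_norm] at h4
    have h5 : dist (H (x (k n) + t * Complex.I)) ξ < δ / 3 := hn2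
    have := dist_triangle (H s) (H (x (k n) + t * Complex.I)) ξ
    linarith
  rintro s (⟨h0, h1, h2⟩ | ⟨h1, h2, h3⟩)
  · have h4 := hh (k n) s h0 h1 h2
    rw [← dist_eq_norm] at h4
    have h5 := hvert (x (k n) + s.im * Complex.I) (by simp)
      (by rcases h2 with h2 | h2 <;> simp [h2] <;> linarith [hα2 (k n), hβ1 (k n)])
      (by rcases h2 with h2 | h2 <;> simp [h2] <;> linarith [hα2 (k n), hβ1 (k n)])
    have := dist_triangle (H s) (H (x (k n) + s.im * Complex.I)) ξ
    rw [mem_ball]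
    change dist (H s) ξ < δ
    linarith
  · rw [mem_ball]
    change dist (H s) ξ < δ
    linarith [hvert s h1 h2 h3]

end IsBottcher

end CremerJulia

namespace CremerJulia
open Set Filter Topology Metric

variable {v : ℂ} {ψ : ℂ → ℂ}

theorem convex_reProdIm {S T : Set ℝ} (hS : Convex ℝ S) (hT : Convex ℝ T) :
    Convex ℝ (S ×ℂ T) :=
  (hS.linear_preimage Complex.reLm).inter (hT.linear_preimage Complex.imLm)

theorem isPreconnected_sides_left {x α τ : ℝ} (hx : 0 < x) (hτ : α < τ) :
    IsPreconnected ({s : ℂ | 0 < s.re ∧ s.re ≤ x ∧ s.im = α} ∪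
      {s | s.re = x ∧ α ≤ s.im ∧ s.im < τ}) := by
  have h1 : Convex ℝ {s : ℂ | 0 < s.re ∧ s.re ≤ x ∧ s.im = α} := by
    have : {s : ℂ | 0 < s.re ∧ s.re ≤ x ∧ s.im = α} = Ioc 0 x ×ℂ {α} := by
      ext s; simp [Complex.mem_reProdIm, and_assoc]
    rw [this]; exact convex_reProdIm (convex_Ioc 0 x) (convex_singleton α)
  have h2 : Convex ℝ {s : ℂ | s.re = x ∧ α ≤ s.im ∧ s.im < τ} := by
    have : {s : ℂ | s.re = x ∧ α ≤ s.im ∧ s.im < τ} = {x} ×ℂ Ico α τ := by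
      ext s; simp [Complex.mem_reProdIm]
    rw [this]; exact convex_reProdIm (convex_singleton x) (convex_Ico α τ)
  refine IsPreconnected.union ⟨x, α⟩ ?_ ?_ h1.isPreconnected h2.isPreconnected
  · exact ⟨hx, le_rfl, rfl⟩
  · exact ⟨rfl, le_rfl, hτ⟩

theorem isPreconnected_sides_right {x β τ : ℝ} (hx : 0 < x) (hτ : τ < β) :
    IsPreconnected ({s : ℂ | 0 < s.re ∧ s.re ≤ x ∧ s.im = β} ∪
      {s | s.re = x ∧ τ < s.im ∧ s.im ≤ β}) := by
  have h1 : Convex ℝ {s : ℂ | 0 < s.re ∧ s.re ≤ x ∧ s.im = β} := by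
    have : {s : ℂ | 0 < s.re ∧ s.re ≤ x ∧ s.im = β} = Ioc 0 x ×ℂ {β} := by
      ext s; simp [Complex.mem_reProdIm, and_assoc]
    rw [this]; exact convex_reProdIm (convex_Ioc 0 x) (convex_singleton β)
  have h2 : Convex ℝ {s : ℂ | s.re = x ∧ τ < s.im ∧ s.im ≤ β} := by
    have : {s : ℂ | s.re = x ∧ τ < s.im ∧ s.im ≤ β} = {x} ×ℂ Ioc τ β := by
      ext s; simp [Complex.mem_reProdIm]
    rw [this]; exact convex_reProdIm (convex_singleton x) (convex_Ioc τ β)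
  refine IsPreconnected.union ⟨x, β⟩ ?_ ?_ h1.isPreconnected h2.isPreconnected
  · exact ⟨hx, le_rfl, rfl⟩
  · exact ⟨rfl, hτ, le_rfl⟩

theorem isPreconnected_union_of_closure {T S : Set ℂ} (hT : IsPreconnected T)
    (hS : IsPreconnected S) {z : ℂ} (hzT : z ∈ T) (hzS : z ∈ closure S) :
    IsPreconnected (T ∪ S) := by
  have h1 : IsPreconnected (insert z S) := hS.subset_closure (subset_insert z S)
    (insert_subset hzS subset_closure)
  have h2 := hT.union z hzT (mem_insert z S) h1
  have : T ∪ insert z S = T ∪ S := by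
    ext w; simp only [mem_union, mem_insert_iff]
    constructor
    · rintro (h | rfl | h)
      exacts [Or.inl h, Or.inl hzT, Or.inr h]
    · rintro (h | h)
      exacts [Or.inl h, Or.inr (Or.inr h)]
  rwa [this] at h2

theorem hasDerivAt_vertical {h : ℂ → ℂ} {d : ℂ} {x θ : ℝ}
    (hd : HasDerivAt h d (x + θ * Complex.I)) :
    HasDerivAt (fun θ : ℝ => h (x + θ * Complex.I)) (Complex.I * d) θ := by
  have h1 : HasDerivAt (fun θ : ℝ => (x : ℂ) + θ * Complex.I) Complex.I θ := by
    simpa using ((Complex.ofRealCLM.hasDerivAt (x := θ)).mul_const Complex.I).const_add (x : ℂ)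
  simpa [Function.comp_def, mul_comm] using! hd.scomp θ h1

theorem eventually_sign_of_hasDerivAt {g : ℝ → ℝ} {τ : ℝ} (hg : HasDerivAt g (-1) τ)
    (h0 : g τ = 0) : (∀ᶠ θ in 𝓝[<] τ, 0 < g θ) ∧ ∀ᶠ θ in 𝓝[>] τ, g θ < 0 := by
  have h3 := hg.isLittleO.def (c := 1 / 2) (by norm_num)
  constructor
  · filter_upwards [nhdsWithin_le_nhds h3, self_mem_nhdsWithin] with θ h1 h2
    rw [mem_Iio] at h2
    simp [h0, abs_of_neg (sub_neg.2 h2)] at h1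
    linarith [(abs_le.1 h1).1]
  · filter_upwards [nhdsWithin_le_nhds h3, self_mem_nhdsWithin] with θ h1 h2
    rw [mem_Ioi] at h2
    simp [h0, abs_of_pos (sub_pos.2 h2)] at h1
    linarith [(abs_le.1 h1).2]

/-- Nearest points of a closed set are accessible along segments. -/
theorem exists_nearest {S : Set ℂ} (hS : IsClosed S) {b : ℂ} (hb : b ∈ S) (q : ℂ) :
    ∃ z ∈ S, dist q z ≤ dist q b ∧ ∀ x ∈ segment ℝ q z, x ∈ S → x = z := by
  obtain ⟨z, hz, hq⟩ := hS.exists_infDist_eq_dist ⟨b, hb⟩ q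
  refine ⟨z, hz, hq ▸ infDist_le_dist_of_mem hb, fun x hx hxS => ?_⟩
  have h1 := dist_add_dist_of_mem_segment hx
  have h2 := infDist_le_dist_of_mem (x := q) hxS
  rw [hq] at h2
  exact dist_le_zero.1 (by linarith)

namespace IsBottcher

theorem mem_julia_of_tendsto_exp (h : IsBottcher v ψ) {s : ℕ → ℂ} {z : ℂ} (hs : ∀ n, 0 < (s n).re)
    (h0 : Tendsto (fun n => (s n).re) atTop (𝓝 0))
    (hz : Tendsto (fun n => ψ (Complex.exp (s n))) atTop (𝓝 z)) : z ∈ julia v := by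
  rw [mem_julia_iff]
  constructor
  · by_contra hK
    obtain ⟨w, hw, rfl⟩ := h.exists_eq hK
    have h1 := (h.tendsto_of_comp (Eventually.of_forall fun n => one_lt_norm_exp (hs n)) hw hz).norm
    have h2 : Tendsto (fun n => ‖Complex.exp (s n)‖) atTop (𝓝 1) := by
      have := (Real.continuous_exp.tendsto 0).comp h0
      rw [Real.exp_zero] at this
      exact this.congr fun n => (Complex.norm_exp _).symm
    exact hw.ne (tendsto_nhds_unique h2 h1)
  · have : z ∈ closure (filled v)ᶜ :=
      mem_closure_of_tendsto hz (Eventually.of_forall fun n => h.notMem (one_lt_norm_exp (hs n)))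
    rwa [closure_compl_filled] at this

theorem closure_image_exp_subset (h : IsBottcher v ψ) {S : Set ℂ} (hpos : ∀ s ∈ S, 0 < s.re)
    (hbd : Bornology.IsBounded S) (hcl : ∀ s ∈ closure S, 0 < s.re → s ∈ S) :
    closure ((fun s => ψ (Complex.exp s)) '' S) ⊆ (fun s => ψ (Complex.exp s)) '' S ∪ julia v := by
  intro z hz
  obtain ⟨y, hy, hlim⟩ := mem_closure_iff_seq_limit.1 hz
  choose s hs hsy using hy
  obtain ⟨σ, hσ, k, hk, hlimσ⟩ := hbd.isCompact_closure.tendsto_subseq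
    (x := s) fun n => subset_closure (hs n)
  have hre : Tendsto (fun n => (s (k n)).re) atTop (𝓝 σ.re) :=
    (Complex.continuous_re.tendsto σ).comp hlimσ
  have hz' : Tendsto (fun n => ψ (Complex.exp (s (k n)))) atTop (𝓝 z) := by
    have := hlim.comp hk.tendsto_atTop
    refine this.congr fun n => ?_
    exact (hsy (k n)).symm
  rcases (ge_of_tendsto' hre fun n => (hpos _ (hs (k n))).le : 0 ≤ σ.re).eq_or_lt with h0 | h0
  · right
    exact h.mem_julia_of_tendsto_exp (fun n => hpos _ (hs (k n))) (h0 ▸ hre) hz'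
  · left
    refine ⟨σ, hcl σ hσ h0, ?_⟩
    have h1 : ContinuousAt (fun s => ψ (Complex.exp s)) σ :=
      (h.differentiableOn_exp.differentiableAt
        ((isOpen_lt continuous_const Complex.continuous_re).mem_nhds h0)).continuousAt
    exact tendsto_nhds_unique (h1.tendsto.comp hlimσ) hz'

theorem exists_mem_closure_julia (h : IsBottcher v ψ) {S : Set ℂ} {ξ : ℂ} {δ x α : ℝ} (hx : 0 < x)
    (hS : ∀ s : ℂ, 0 < s.re → s.re ≤ x → s.im = α → s ∈ S)
    (hball : ∀ s ∈ S, ψ (Complex.exp s) ∈ ball ξ δ) :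
    ∃ z ∈ julia v, z ∈ closedBall ξ δ ∧ z ∈ closure ((fun s => ψ (Complex.exp s)) '' S) := by
  set s : ℕ → ℂ := fun n => ⟨x * (1 / (n + 1)), α⟩ with hs
  have hpos : ∀ n, 0 < (s n).re := fun n => by simp only [hs]; positivity
  have hmem : ∀ n, s n ∈ S := fun n => hS _ (hpos n)
    (mul_le_of_le_one_right hx.le (by
      rw [div_le_one (by positivity)]; linarith [n.cast_nonneg (α := ℝ)])) rfl
  have h0 : Tendsto (fun n => (s n).re) atTop (𝓝 0) := by
    simpa [hs] using tendsto_one_div_succ.const_mul x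
  obtain ⟨z, hz, k, hk, hlim⟩ := (isCompact_closedBall ξ δ).tendsto_subseq
    (x := fun n => ψ (Complex.exp (s n))) fun n => ball_subset_closedBall (hball _ (hmem n))
  exact ⟨z, h.mem_julia_of_tendsto_exp (fun n => hpos (k n)) (h0.comp hk.tendsto_atTop) hlim, hz,
    mem_closure_of_tendsto hlim (Eventually.of_forall fun n => ⟨_, hmem (k n), rfl⟩)⟩

theorem exists_deriv_ne_zero (h : IsBottcher v ψ) {x α β : ℝ} (hx : 0 < x) (hαβ : α < β)
    (hβ : β - α < 1) : ∃ τ, α < τ ∧ τ < β ∧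
      deriv (fun s => ψ (Complex.exp s)) (x + τ * Complex.I) ≠ 0 := by
  by_contra! hcon
  set H : ℂ → ℂ := fun s => ψ (Complex.exp s)
  have hder : ∀ θ ∈ Icc ((2 * α + β) / 3) ((α + 2 * β) / 3),
      HasDerivAt (fun θ : ℝ => H (x + θ * Complex.I)) 0 θ := by
    intro θ hθ
    have h1 : HasDerivAt H (deriv H (x + θ * Complex.I)) (x + θ * Complex.I) :=
      (h.differentiableOn_exp.differentiableAt
        ((isOpen_lt continuous_const Complex.continuous_re).mem_nhds (by simpa using hx))).hasDerivAt
    rw [hcon θ (by linarith [hθ.1]) (by linarith [hθ.2])] at h1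
    simpa using hasDerivAt_vertical h1
  have h2 := constant_of_has_deriv_right_zero
    (fun θ hθ => (hder θ hθ).continuousAt.continuousWithinAt)
    (fun θ hθ => (hder θ (Ico_subset_Icc_self hθ)).hasDerivWithinAt) ((α + 2 * β) / 3)
    ⟨by linarith, le_rfl⟩
  have h3 := (h.eq_of_exp (by simpa using hx) (by simpa using hx) h2).2 (by
    simp
    rw [abs_lt]
    have := Real.pi_gt_three
    constructor <;> linarith)
  have := congrArg Complex.im h3
  simp at this
  linarith

/-- Two disjoint subcontinua of the Julia set which are neighbourhoods of the end of a null
sequence of crosscuts at an angle, and of a point of the impression of that angle, do not exist. -/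
theorem crosscut_false (h : IsBottcher v ψ) {t : ℝ} {ξ y : ℂ} {T T' : Set ℂ} {δ₁ δ₂ : ℝ}
    (hξ : ξ ∈ julia v)
    (hcross : ∀ δ > 0, ∃ x α β : ℝ,
      0 < x ∧ x < δ ∧ t - δ < α ∧ α < t ∧ t < β ∧ β < t + δ ∧
        ∀ s ∈ sides x α β, ψ (Complex.exp s) ∈ ball ξ δ)
    (hy : y ∈ imp v ψ {Complex.exp (t * Complex.I)})
    (hT : IsClosed T) (hTp : IsPreconnected T) (hTJ : T ⊆ julia v)
    (hTp' : IsPreconnected T') (hTJ' : T' ⊆ julia v)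
    (hdisj : Disjoint T T')
    (hδ₁ : 0 < δ₁) (hδ₁T : julia v ∩ ball ξ δ₁ ⊆ T)
    (hδ₂ : 0 < δ₂) (hδ₂T : julia v ∩ ball y δ₂ ⊆ T') : False := by
  set H : ℂ → ℂ := fun s => ψ (Complex.exp s) with hH
  have hξT : ξ ∈ T := hδ₁T ⟨hξ, mem_ball_self hδ₁⟩
  have hyT' : y ∈ T' := hδ₂T ⟨hy.1, mem_ball_self hδ₂⟩
  have hJU : ∀ w, 1 < ‖w‖ → ψ w ∉ julia v := fun w hw hJ => h.notMem hw (julia_subset_filled v hJ)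
  have hHJ : ∀ s : ℂ, 0 < s.re → H s ∉ julia v := fun s hs => hJU _ (one_lt_norm_exp hs)
  -- an accessible point of the second set
  obtain ⟨u, hu, hyu⟩ := hy.2
  rw [mem_singleton_iff] at hu
  subst hu
  obtain ⟨w, hw, hwy, -⟩ := mem_gr_iff.1 hyu
  obtain ⟨n₀, hn₀⟩ := (hwy.eventually (ball_mem_nhds y (half_pos hδ₂))).exists
  set w₀ := w n₀ with hw₀
  obtain ⟨z, hzJ, hqz, hseg⟩ := exists_nearest (isClosed_julia v) hy.1 (ψ w₀)
  have hzT' : z ∈ T' := hδ₂T ⟨hzJ, by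
    rw [mem_ball]
    have := dist_triangle z (ψ w₀) y
    rw [dist_comm z (ψ w₀)] at this
    linarith⟩
  have hξseg : ξ ∉ segment ℝ (ψ w₀) z := fun hm =>
    Set.disjoint_left.1 hdisj hξT (by rw [hseg ξ hm hξ]; exact hzT')
  have hsegcl : IsClosed (segment ℝ (ψ w₀) z) := by
    rw [segment_eq_image_lineMap]
    exact (isCompact_Icc.image (by fun_prop)).isClosed
  obtain ⟨η₁, hη₁, hball₁⟩ := Metric.isOpen_iff.1 hsegcl.isOpen_compl ξ hξseg
  obtain ⟨η₀, hη₀, hball₀⟩ := Metric.isOpen_iff.1 hT.isOpen_compl y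
    fun hm => Set.disjoint_left.1 hdisj hm hyT'
  have hξy : ξ ∉ ball y η₀ := fun hm => hball₀ hm hξT
  rw [mem_ball, not_lt] at hξy
  have hlog : 0 < Real.log ‖w₀‖ := Real.log_pos (hw n₀)
  -- the crosscut
  obtain ⟨δ, hδ, hδle⟩ : ∃ δ > 0, δ < δ₁ ∧ δ < Real.log ‖w₀‖ ∧ δ < 1 / 2 ∧ δ < η₁ ∧ δ < η₀ / 2 := by
    refine ⟨min (min (min δ₁ (Real.log ‖w₀‖)) (1 / 2)) (min η₁ (η₀ / 2)) / 2, by positivity, ?_⟩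
    set m := min (min (min δ₁ (Real.log ‖w₀‖)) (1 / 2)) (min η₁ (η₀ / 2)) with hm
    have hmpos : 0 < m := by positivity
    have h1 : m ≤ δ₁ := (min_le_left _ _).trans ((min_le_left _ _).trans (min_le_left _ _))
    have h2 : m ≤ Real.log ‖w₀‖ :=
      (min_le_left _ _).trans ((min_le_left _ _).trans (min_le_right _ _))
    have h3 : m ≤ 1 / 2 := (min_le_left _ _).trans (min_le_right _ _)
    have h4 : m ≤ η₁ := (min_le_right _ _).trans (min_le_left _ _)
    have h5 : m ≤ η₀ / 2 := (min_le_right _ _).trans (min_le_right _ _)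
    refine ⟨?_, ?_, ?_, ?_, ?_⟩ <;> linarith
  obtain ⟨hδδ₁, hδlog, hδhalf, hδη₁, hδη₀⟩ := hδle
  obtain ⟨x, α, β, hx0, hxδ, hα1, hα2, hβ1, hβ2, hsides⟩ := hcross δ hδ
  have hpos : ∀ s ∈ sides x α β, 0 < s.re := by
    rintro s (hs | hs)
    exacts [hs.1, hs.1 ▸ hx0]
  have hrex : ∀ s ∈ sides x α β, s.re ≤ x := by
    rintro s (hs | hs)
    exacts [hs.2.1, hs.1.le]
  have him : ∀ s ∈ sides x α β, α ≤ s.im ∧ s.im ≤ β := by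
    rintro s (⟨-, -, hs | hs⟩ | hs)
    · rw [hs]; constructor <;> linarith
    · rw [hs]; constructor <;> linarith
    · exact hs.2
  have hinj : ∀ s s' : ℂ, 0 < s.re → 0 < s'.re → α ≤ s.im → s.im ≤ β → α ≤ s'.im → s'.im ≤ β →
      H s = H s' → s = s' := by
    intro s s' h1 h2 h3 h4 h5 h6 he
    refine (h.eq_of_exp h1 h2 he).2 ?_
    have := Real.pi_gt_three
    rw [abs_lt]
    constructor <;> linarith
  obtain ⟨τ, hατ, hτβ, hd0⟩ := h.exists_deriv_ne_zero hx0 (hα2.trans hβ1) (by linarith)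
  set σ : ℂ := x + τ * Complex.I with hσ
  have hσre : σ.re = x := by simp [hσ]
  have hσim : σ.im = τ := by simp [hσ]
  have hσs : σ ∈ sides x α β := Or.inr ⟨hσre, by rw [hσim]; exact hατ.le, by rw [hσim]; exact hτβ.le⟩
  set d := deriv H σ with hd
  have hhalf : IsOpen {s : ℂ | 0 < s.re} := isOpen_lt continuous_const Complex.continuous_re
  have hstrict : HasStrictDerivAt H d σ := by
    have : AnalyticAt ℂ H σ := h.differentiableOn_exp.analyticAt
      (hhalf.mem_nhds (by simpa [hσ] using hx0))
    exact this.hasStrictDerivAt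
  set Z := T ∪ H '' sides x α β with hZ
  have hTU : ∀ s : ℂ, 0 < s.re → H s ∉ T := fun s hs hm => hHJ s hs (hTJ hm)
  have hZcl : IsClosed Z := by
    have hbd : Bornology.IsBounded (sides x α β) :=
      ((isBounded_Icc (0 : ℝ) x).reProdIm (isBounded_Icc α β)).subset fun s hs =>
        ⟨⟨(hpos s hs).le, hrex s hs⟩, him s hs⟩
    have hcl : ∀ s ∈ closure (sides x α β), 0 < s.re → s ∈ sides x α β := by
      have h3 : IsClosed ({s : ℂ | 0 ≤ s.re ∧ s.re ≤ x ∧ (s.im = α ∨ s.im = β)} ∪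
          {s | s.re = x ∧ α ≤ s.im ∧ s.im ≤ β}) := by
        refine IsClosed.union ?_ ?_
        · refine (isClosed_le continuous_const Complex.continuous_re).inter
            ((isClosed_le Complex.continuous_re continuous_const).inter
            ((isClosed_eq Complex.continuous_im continuous_const).union
            (isClosed_eq Complex.continuous_im continuous_const)))
        · exact (isClosed_eq Complex.continuous_re continuous_const).inter
            ((isClosed_le continuous_const Complex.continuous_im).inter
            (isClosed_le Complex.continuous_im continuous_const))
      have h5 : sides x α β ⊆ {s : ℂ | 0 ≤ s.re ∧ s.re ≤ x ∧ (s.im = α ∨ s.im = β)} ∪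
          {s | s.re = x ∧ α ≤ s.im ∧ s.im ≤ β} :=
        union_subset_union_left _ fun s hs => ⟨hs.1.le, hs.2⟩
      intro s hs hs0
      rcases closure_minimal h5 h3 hs with h4 | h4
      exacts [Or.inl ⟨hs0, h4.2⟩, Or.inr h4]
    refine isClosed_of_closure_subset ?_
    rw [hZ, closure_union, hT.closure_eq]
    refine union_subset subset_union_left fun ζ hζ => ?_
    rcases h.closure_image_exp_subset hpos hbd hcl hζ with h1 | h1
    · exact Or.inr h1
    · left
      refine hδ₁T ⟨h1, ?_⟩
      have h2 : closure (H '' sides x α β) ⊆ closedBall ξ δ :=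
        closure_minimal (by rintro _ ⟨s, hs, rfl⟩; exact ball_subset_closedBall (hsides s hs))
          isClosed_closedBall
      exact lt_of_le_of_lt (h2 hζ) hδδ₁
  have hHc : ContinuousOn H {s | 0 < s.re} := h.differentiableOn_exp.continuousOn
  have hpre : IsPreconnected (Z \ {H σ}) := by
    set L₁ : Set ℂ := {s : ℂ | 0 < s.re ∧ s.re ≤ x ∧ s.im = α} ∪
      {s | s.re = x ∧ α ≤ s.im ∧ s.im < τ} with hL₁
    set L₂ : Set ℂ := {s : ℂ | 0 < s.re ∧ s.re ≤ x ∧ s.im = β} ∪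
      {s | s.re = x ∧ τ < s.im ∧ s.im ≤ β} with hL₂
    have hL₁s : L₁ ⊆ sides x α β := by
      rintro s (hs | hs)
      exacts [Or.inl ⟨hs.1, hs.2.1, Or.inl hs.2.2⟩, Or.inr ⟨hs.1, hs.2.1, hs.2.2.le.trans hτβ.le⟩]
    have hL₂s : L₂ ⊆ sides x α β := by
      rintro s (hs | hs)
      exacts [Or.inl ⟨hs.1, hs.2.1, Or.inr hs.2.2⟩, Or.inr ⟨hs.1, hατ.le.trans hs.2.1.le, hs.2.2⟩]
    have heq : Z \ {H σ} = (T ∪ H '' L₁) ∪ (T ∪ H '' L₂) := by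
      ext ζ
      constructor
      · rintro ⟨hζ | ⟨s, hs, rfl⟩, hne⟩
        · exact Or.inl (Or.inl hζ)
        · rcases hs with ⟨h1, h2, h3 | h3⟩ | ⟨h1, h2, h3⟩
          · exact Or.inl (Or.inr ⟨s, Or.inl ⟨h1, h2, h3⟩, rfl⟩)
          · exact Or.inr (Or.inr ⟨s, Or.inl ⟨h1, h2, h3⟩, rfl⟩)
          · rcases lt_trichotomy s.im τ with h4 | h4 | h4
            · exact Or.inl (Or.inr ⟨s, Or.inr ⟨h1, h2, h4⟩, rfl⟩)
            · refine absurd ?_ hne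
              have : s = σ := Complex.ext (by rw [h1, hσre]) (by rw [h4, hσim])
              rw [this]; rfl
            · exact Or.inr (Or.inr ⟨s, Or.inr ⟨h1, h4, h3⟩, rfl⟩)
      · have key : ∀ s ∈ sides x α β, s ≠ σ → H s ∈ Z \ {H σ} := fun s hs hne =>
          ⟨Or.inr ⟨s, hs, rfl⟩, fun he => hne (hinj s σ (hpos s hs) (hpos σ hσs) (him s hs).1
            (him s hs).2 (him σ hσs).1 (him σ hσs).2 he)⟩
        have hT1 : T ⊆ Z \ {H σ} := fun ζ hζ => ⟨Or.inl hζ, fun he => by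
          rw [mem_singleton_iff] at he
          exact hTU σ (hpos σ hσs) (he ▸ hζ)⟩
        rintro ((hζ | ⟨s, hs, rfl⟩) | (hζ | ⟨s, hs, rfl⟩))
        · exact hT1 hζ
        · refine key s (hL₁s hs) ?_
          rintro rfl
          rw [hL₁] at hs
          rcases hs with hs | hs
          · have := hs.2.2; rw [hσim] at this; exact hατ.ne' this
          · have := hs.2.2; rw [hσim] at this; exact lt_irrefl _ this
        · exact hT1 hζ
        · refine key s (hL₂s hs) ?_
          rintro rfl
          rw [hL₂] at hs
          rcases hs with hs | hs
          · have := hs.2.2; rw [hσim] at this; exact hτβ.ne this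
          · have := hs.2.1; rw [hσim] at this; exact lt_irrefl _ this
    rw [heq]
    have hc₁ : IsPreconnected (T ∪ H '' L₁) := by
      obtain ⟨ζ, hζ1, hζ2, hζ3⟩ := h.exists_mem_closure_julia (S := L₁) (α := α) hx0
        (fun s h1 h2 h3 => Or.inl ⟨h1, h2, h3⟩) fun s hs => hsides s (hL₁s hs)
      exact isPreconnected_union_of_closure hTp ((isPreconnected_sides_left hx0 hατ).image _
        (hHc.mono fun s hs => hpos s (hL₁s hs))) (hδ₁T ⟨hζ1, lt_of_le_of_lt hζ2 hδδ₁⟩) hζ3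
    have hc₂ : IsPreconnected (T ∪ H '' L₂) := by
      obtain ⟨ζ, hζ1, hζ2, hζ3⟩ := h.exists_mem_closure_julia (S := L₂) (α := β) hx0
        (fun s h1 h2 h3 => Or.inl ⟨h1, h2, h3⟩) fun s hs => hsides s (hL₂s hs)
      exact isPreconnected_union_of_closure hTp ((isPreconnected_sides_right hx0 hτβ).image _
        (hHc.mono fun s hs => hpos s (hL₂s hs))) (hδ₁T ⟨hζ1, lt_of_le_of_lt hζ2 hδδ₁⟩) hζ3
    exact hc₁.union ξ (Or.inl hξT) (Or.inl hξT) hc₂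
  -- the connecting set
  set box : Set ℂ := Ioo 0 x ×ℂ Ioo α β with hbox
  set O : Set ℂ := ψ '' {w | Real.exp x < ‖w‖} with hO
  have hOsub : {w : ℂ | Real.exp x < ‖w‖} ⊆ {w | 1 < ‖w‖} := fun w hw =>
    (Real.one_lt_exp_iff.2 hx0).trans hw
  have hbox0 : ∀ s ∈ box, 0 < s.re := fun s hs => hs.1.1
  have hOZ : ∀ w : ℂ, Real.exp x < ‖w‖ → ψ w ∉ Z := by
    rintro w hw (hm | ⟨s, hs, he⟩)
    · exact hJU w (hOsub hw) (hTJ hm)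
    · have := h.inj (one_lt_norm_exp (hpos s hs)) (hOsub hw) he
      rw [← this, Complex.norm_exp, Real.exp_lt_exp] at hw
      linarith [hrex s hs]
  have hboxZ : ∀ s ∈ box, H s ∉ Z := by
    rintro s hs (hm | ⟨s', hs', he⟩)
    · exact hTU s (hbox0 s hs) hm
    · have := hinj s' s (hpos s' hs') (hbox0 s hs) (him s' hs').1 (him s' hs').2 hs.2.1.le hs.2.2.le
        he
      subst this
      rcases hs' with ⟨-, -, h1 | h1⟩ | ⟨h1, -⟩
      · exact hs.2.1.ne' h1
      · exact hs.2.2.ne h1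
      · exact hs.1.2.ne h1
  set C := ((T' ∪ ball y (η₀ / 2)) ∪ (segment ℝ (ψ w₀) z ∪ O)) ∪ H '' box with hC
  have hw₀O : ψ w₀ ∈ O := ⟨w₀, by
    rw [mem_ofPred_eq, ← Real.lt_log_iff_exp_lt (zero_lt_one.trans (hw n₀))]
    linarith, rfl⟩
  have hCpre : IsPreconnected C := by
    have c1 : IsPreconnected (T' ∪ ball y (η₀ / 2)) :=
      hTp'.union y hyT' (mem_ball_self (half_pos hη₀)) (convex_ball y _).isPreconnected
    have c2 : IsPreconnected (segment ℝ (ψ w₀) z ∪ O) :=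
      (convex_segment _ _).isPreconnected.union (ψ w₀) (left_mem_segment ℝ _ _) hw₀O
        ((isPreconnected_norm_gt (Real.exp_pos x)).image _ (h.diff.continuousOn.mono hOsub))
    have c3 : IsPreconnected (H '' box) :=
      (convex_reProdIm (convex_Ioo 0 x) (convex_Ioo α β)).isPreconnected.image _
        (hHc.mono fun s hs => hbox0 s hs)
    have c4 := c1.union z (Or.inl hzT') (Or.inl (right_mem_segment ℝ _ _)) c2
    have hy' : y ∈ imp v ψ (arc (Complex.exp (t * Complex.I)) 0) := by
      rw [arc_zero]; exact hy
    rw [h.imp_arc_eq (Complex.norm_exp_ofReal_mul_I t) 0, mem_iInter] at hy'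
    obtain ⟨n, hn⟩ := (tendsto_one_div_succ.eventually_lt_const
      (show (0 : ℝ) < min x (min (t - α) (β - t)) from
        lt_min hx0 (lt_min (by linarith) (by linarith)))).exists
    obtain ⟨_, hb, _, ⟨s, hs, rfl⟩, rfl⟩ := mem_closure_iff.1 (hy' n) (ball y (η₀ / 2)) isOpen_ball
      (mem_ball_self (half_pos hη₀))
    have hadd : Complex.exp (t * Complex.I) * Complex.exp s = Complex.exp (t * Complex.I + s) :=
      (Complex.exp_add _ _).symm
    simp only [hadd] at hb
    obtain ⟨hn1, hn2, hn3⟩ : (1 : ℝ) / (n + 1) < x ∧ (1 : ℝ) / (n + 1) < t - α ∧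
        (1 : ℝ) / (n + 1) < β - t := by
      simpa [lt_min_iff] using hn
    refine c4.union _ (Or.inl (Or.inr hb)) ⟨t * Complex.I + s, ?_, rfl⟩ c3
    refine ⟨⟨?_, ?_⟩, ?_, ?_⟩
    · simpa using hs.1.1
    · simpa using hs.1.2.trans hn1
    · have := hs.2.1; simp at this ⊢; simp at hn2; linarith
    · have := hs.2.2; simp at this ⊢; simp at hn3; linarith
  have hCZ : Disjoint C Z := by
    rw [Set.disjoint_left]
    have hsb : ∀ ζ ∈ H '' sides x α β, ζ ∈ ball ξ δ := by
      rintro _ ⟨s, hs, rfl⟩; exact hsides s hs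
    rintro ζ (((hζ | hζ) | (hζ | ⟨w, hw, rfl⟩)) | ⟨s, hs, rfl⟩) hζZ
    · rcases hζZ with h1 | ⟨s, hs, rfl⟩
      · exact Set.disjoint_left.1 hdisj h1 hζ
      · exact hHJ s (hpos s hs) (hTJ' hζ)
    · rcases hζZ with h1 | h1
      · exact hball₀ (ball_subset_ball (half_le_self hη₀.le) hζ) h1
      · have h2 := hsb ζ h1
        rw [mem_ball] at h2 hζ
        have := dist_triangle ξ ζ y
        rw [dist_comm ξ ζ] at this
        linarith
    · rcases hζZ with h1 | h1
      · have := hseg ζ hζ (hTJ h1)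
        exact Set.disjoint_left.1 hdisj h1 (this ▸ hzT')
      · exact hball₁ (ball_subset_ball hδη₁.le (hsb ζ h1)) hζ
    · exact hOZ w hw hζZ
    · exact hboxZ s hs hζZ
  -- the transversal
  have hV : {s : ℂ | 0 < s.re ∧ α < s.im ∧ s.im < β} ∈ 𝓝 σ := by
    refine IsOpen.mem_nhds (hhalf.inter ((isOpen_lt continuous_const Complex.continuous_im).inter
      (isOpen_lt Complex.continuous_im continuous_const))) ⟨?_, ?_, ?_⟩
    · simpa [hσ] using hx0
    · simpa [hσ] using hατ
    · simpa [hσ] using hτβ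
  obtain ⟨η, hη, htr⟩ := exists_transversal hstrict hd0 hV
  have htrpos : ∀ y : ℝ, |y| ≤ η → 0 < y → H σ + y * d ∈ O := by
    intro y hy hy0
    obtain ⟨s, hs, he, h1, -⟩ := htr y hy
    rw [← he]
    refine ⟨Complex.exp s, ?_, rfl⟩
    rw [mem_ofPred_eq, Complex.norm_exp, Real.exp_lt_exp, ← hσre]
    exact h1 hy0
  have htrneg : ∀ y : ℝ, |y| ≤ η → y < 0 → H σ + y * d ∈ H '' box := by
    intro y hy hy0
    obtain ⟨s, hs, he, -, h1⟩ := htr y hy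
    rw [← he]
    exact ⟨s, ⟨⟨hs.1, hσre ▸ h1 hy0⟩, hs.2⟩, rfl⟩
  have hId : ∀ y : ℂ, y * Complex.I * (-Complex.I * d) = y * d := fun y => by
    linear_combination (-y * d) * Complex.I_mul_I
  have hd' : -Complex.I * d ≠ 0 := mul_ne_zero (neg_ne_zero.2 Complex.I_ne_zero) hd0
  have hder : HasDerivAt (fun θ : ℝ => ((H (x + θ * Complex.I) - H σ) / (-Complex.I * d)).re)
      (-1) τ := by
    have h1 := ((hasDerivAt_vertical hstrict.hasDerivAt).sub_const (H σ)).div_const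
      (-Complex.I * d)
    have h2 : Complex.I * d / (-Complex.I * d) = -1 := by
      rw [neg_mul, div_neg, div_self (mul_ne_zero Complex.I_ne_zero hd0)]
    rw [h2] at h1
    simpa using! Complex.reCLM.hasFDerivAt.comp_hasDerivAt τ h1
  obtain ⟨hs1, hs2⟩ := eventually_sign_of_hasDerivAt hder (by simp [hσ])
  have hlim : Tendsto (fun θ : ℝ => H (x + θ * Complex.I)) (𝓝 τ) (𝓝 (H σ)) :=
    (hasDerivAt_vertical hstrict.hasDerivAt).continuousAt.tendsto
  have hmemZ : ∀ θ : ℝ, α < θ → θ < β → H (x + θ * Complex.I) ∈ Z := fun θ h1 h2 =>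
    Or.inr ⟨_, Or.inr ⟨by simp, by simpa using h1.le, by simpa using h2.le⟩, rfl⟩
  refine false_of_jump hZcl hη hd' (Or.inr ⟨σ, hσs, rfl⟩) hpre ?_ ?_ ?_ hCpre hCZ ?_ ?_
  · intro y hy hm
    rw [hId] at hm
    rcases lt_trichotomy y 0 with h1 | h1 | h1
    · obtain ⟨s, hs, he⟩ := htrneg y hy h1
      exact absurd (he ▸ hm) (hboxZ s hs)
    · exact h1
    · obtain ⟨w, hw, he⟩ := htrpos y hy h1
      exact absurd (he ▸ hm) (hOZ w hw)
  · refine mem_closure_of_tendsto (hlim.mono_left nhdsWithin_le_nhds) ?_ (b := 𝓝[<] τ)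
    filter_upwards [hs1, nhdsWithin_le_nhds (eventually_gt_nhds hατ), self_mem_nhdsWithin]
      with θ h1 h2 h3
    exact ⟨hmemZ θ h2 (h3.trans hτβ), h1⟩
  · refine mem_closure_of_tendsto (hlim.mono_left nhdsWithin_le_nhds) ?_ (b := 𝓝[>] τ)
    filter_upwards [hs2, nhdsWithin_le_nhds (eventually_lt_nhds hτβ), self_mem_nhdsWithin]
      with θ h1 h2 h3
    exact ⟨hmemZ θ (hατ.trans h3) h2, h1⟩
  · rw [hId]
    exact Or.inl (Or.inr (Or.inr (htrpos η (abs_of_pos hη).le hη)))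
  · have : H σ - η * Complex.I * (-Complex.I * d) = H σ + ((-η : ℝ) : ℂ) * d := by
      rw [hId]; push_cast; ring
    rw [this]
    exact Or.inr (htrneg (-η) (by rw [abs_neg, abs_of_pos hη]) (by linarith))

/-- Monotone maps of the Julia set to locally connected spaces collapse impressions. -/
theorem map_eq_of_mem_imp (h : IsBottcher v ψ) {A : Type*} [MetricSpace A]
    [LocallyConnectedSpace A] {φ : julia v → A} (hφ : Topology.IsCoinducing φ)
    (hfib : ∀ a, IsConnected (φ ⁻¹' {a})) {u : ℂ} (hu : ‖u‖ = 1) (x y : julia v)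
    (hx : (x : ℂ) ∈ imp v ψ {u}) (hy : (y : ℂ) ∈ imp v ψ {u}) : φ x = φ y := by
  obtain ⟨t, rfl⟩ : ∃ t : ℝ, Complex.exp (t * Complex.I) = u :=
    ⟨Complex.arg u, by simpa [hu] using Complex.norm_mul_exp_arg_mul_I u⟩
  obtain ⟨ξ, hξ, hcross⟩ := h.exists_crosscut t
  suffices key : ∀ y : julia v, (y : ℂ) ∈ imp v ψ {Complex.exp (t * Complex.I)} →
      φ ⟨ξ, hξ⟩ = φ y from (key x hx).symm.trans (key y hy)
  clear hx hy x y
  intro y hy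
  by_contra hne
  set r := dist (φ ⟨ξ, hξ⟩) (φ y) / 3 with hr
  have hr0 : 0 < r := div_pos (dist_pos.2 hne) (by norm_num)
  have hcont : Continuous φ := hφ.continuous
  have hnb : ∀ z : julia v, ∃ T : Set ℂ, IsClosed T ∧ IsPreconnected T ∧ T ⊆ julia v ∧
      (∃ δ > 0, julia v ∩ ball (z : ℂ) δ ⊆ T) ∧ ∀ w : julia v, (w : ℂ) ∈ T →
        dist (φ w) (φ z) ≤ r := by
    intro z
    obtain ⟨B, ⟨hBo, hzB, hBc⟩, hBr⟩ := (LocallyConnectedSpace.open_connected_basis (φ z)).mem_iff.1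
      (ball_mem_nhds (φ z) hr0)
    have hCr : closure B ⊆ closedBall (φ z) r :=
      closure_minimal (hBr.trans ball_subset_closedBall) isClosed_closedBall
    refine ⟨Subtype.val '' (φ ⁻¹' closure B), ?_, ?_, ?_, ?_, ?_⟩
    · exact (isClosed_julia v).isClosedEmbedding_subtypeVal.isClosedMap _
        (isClosed_closure.preimage hcont)
    · exact ((hφ.isConnected_preimage_of_isClosed hfib isClosed_closure hBc.closure).image _
        continuous_subtype_val.continuousOn).isPreconnected
    · rintro _ ⟨w, -, rfl⟩; exact w.2
    · obtain ⟨δ, hδ, hball⟩ := Metric.isOpen_iff.1 (hBo.preimage hcont) z hzB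
      refine ⟨δ, hδ, fun w hw => ⟨⟨w, hw.1⟩, subset_closure (hball ?_), rfl⟩⟩
      exact hw.2
    · rintro w ⟨w', hw', he⟩
      rw [← Subtype.ext he]
      exact hCr hw'
  obtain ⟨T, hT, hTp, hTJ, ⟨δ₁, hδ₁, hδ₁T⟩, hTr⟩ := hnb ⟨ξ, hξ⟩
  obtain ⟨T', -, hTp', hTJ', ⟨δ₂, hδ₂, hδ₂T⟩, hTr'⟩ := hnb y
  refine h.crosscut_false hξ hcross hy hT hTp hTJ hTp' hTJ' ?_ hδ₁ hδ₁T hδ₂ hδ₂T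
  rw [Set.disjoint_left]
  intro w hw hw'
  have h1 := hTr ⟨w, hTJ hw⟩ hw
  have h2 := hTr' ⟨w, hTJ hw⟩ hw'
  have h3 := dist_triangle_left (φ ⟨ξ, hξ⟩) (φ y) (φ ⟨w, hTJ hw⟩)
  linarith

end IsBottcher

end CremerJulia

namespace CremerJulia
open Set Filter Topology Metric

variable {v : ℂ} {ψ : ℂ → ℂ}

/-- In a compact set, points in no common connected subset are separated by open sets. -/
theorem exists_separation {F : Set ℂ} (hF : IsCompact F) {x y : ℂ} (hx : x ∈ F) (hy : y ∈ F)
    (hno : ∀ C ⊆ F, IsPreconnected C → x ∈ C → y ∉ C) :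
    ∃ U V : Set ℂ, IsOpen U ∧ IsOpen V ∧ Disjoint U V ∧ F ⊆ U ∪ V ∧ x ∈ U ∧ y ∈ V := by
  have : CompactSpace F := isCompact_iff_compactSpace.1 hF
  have h1 : (⟨y, hy⟩ : F) ∉ connectedComponent (⟨x, hx⟩ : F) := fun hm =>
    hno (Subtype.val '' connectedComponent (⟨x, hx⟩ : F)) (by rintro _ ⟨z, -, rfl⟩; exact z.2)
      (isPreconnected_connectedComponent.image _ continuous_subtype_val.continuousOn)
      ⟨_, mem_connectedComponent, rfl⟩ ⟨_, hm, rfl⟩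
  rw [connectedComponent_eq_iInter_isClopen, mem_iInter] at h1
  push Not at h1
  obtain ⟨⟨Z, hZ, hxZ⟩, hyZ⟩ := h1
  have hK : ∀ Y : Set F, IsClosed Y → IsCompact (Subtype.val '' Y) := fun Y hY =>
    hY.isCompact.image continuous_subtype_val
  have hdis : Disjoint (Subtype.val '' Z) (Subtype.val '' Zᶜ) := by
    rw [Set.disjoint_left]
    rintro _ ⟨a, ha, rfl⟩ ⟨b, hb, he⟩
    exact hb (Subtype.ext he ▸ ha)
  obtain ⟨U, V, hU, hV, hZU, hZV, hUV⟩ :=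
    SeparatedNhds.of_isCompact_isCompact (hK Z hZ.1) (hK Zᶜ hZ.2.isClosed_compl) hdis
  refine ⟨U, V, hU, hV, hUV, fun z hz => ?_, hZU ⟨_, hxZ, rfl⟩, hZV ⟨_, hyZ, rfl⟩⟩
  by_cases hzZ : (⟨z, hz⟩ : F) ∈ Z
  exacts [Or.inl (hZU ⟨_, hzZ, rfl⟩), Or.inr (hZV ⟨_, hzZ, rfl⟩)]

/-- Closed equivalence relations on the Julia set identifying the points of each impression. -/
structure IsLamination (v : ℂ) (ψ : ℂ → ℂ) (S : Set (ℂ × ℂ)) : Prop where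
  closed : IsClosed S
  sub : ∀ x y, (x, y) ∈ S → x ∈ julia v ∧ y ∈ julia v
  refl : ∀ x ∈ julia v, (x, x) ∈ S
  symm : ∀ x y, (x, y) ∈ S → (y, x) ∈ S
  trans : ∀ x y z, (x, y) ∈ S → (y, z) ∈ S → (x, z) ∈ S
  imp : ∀ u x y, x ∈ julia v → y ∈ julia v → (x, u) ∈ gr ψ → (y, u) ∈ gr ψ → (x, y) ∈ S

/-- The smallest such relation. -/
def core (v : ℂ) (ψ : ℂ → ℂ) : Set (ℂ × ℂ) := {q | ∀ S, IsLamination v ψ S → q ∈ S}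

theorem core_subset {S : Set (ℂ × ℂ)} (hS : IsLamination v ψ S) : core v ψ ⊆ S :=
  fun _ hq => hq S hS

theorem isLamination_prod : IsLamination v ψ (julia v ×ˢ julia v) where
  closed := (isClosed_julia v).prod (isClosed_julia v)
  sub _ _ h := h
  refl _ h := ⟨h, h⟩
  symm _ _ h := ⟨h.2, h.1⟩
  trans _ _ _ h h' := ⟨h.1, h'.2⟩
  imp _ _ _ h h' _ _ := ⟨h, h'⟩

theorem isLamination_core : IsLamination v ψ (core v ψ) where
  closed := by
    have : core v ψ = ⋂₀ {S | IsLamination v ψ S} := by ext; simp [core]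
    rw [this]; exact isClosed_sInter fun S hS => IsLamination.closed hS
  sub _ _ h := core_subset isLamination_prod h
  refl x hx S hS := hS.refl x hx
  symm x y h S hS := hS.symm x y (h S hS)
  trans x y z h h' S hS := hS.trans x y z (h S hS) (h' S hS)
  imp u x y hx hy h h' S hS := hS.imp u x y hx hy h h'

namespace IsBottcher

theorem quad_mem_core (h : IsBottcher v ψ) {x y : ℂ} (hxy : (x, y) ∈ core v ψ) :
    (quad v x, quad v y) ∈ core v ψ := by
  have hc := isLamination_core (v := v) (ψ := ψ)
  have : IsLamination v ψ {q | (quad v q.1, quad v q.2) ∈ core v ψ} :=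
    { closed := hc.closed.preimage (((continuous_quad v).comp continuous_fst).prodMk
        ((continuous_quad v).comp continuous_snd))
      sub := fun x y h => ⟨quad_mem_julia_iff.1 (hc.sub _ _ h).1,
        quad_mem_julia_iff.1 (hc.sub _ _ h).2⟩
      refl := fun x hx => hc.refl _ (quad_mem_julia_iff.2 hx)
      symm := fun x y h => hc.symm _ _ h
      trans := fun x y z h h' => hc.trans _ _ _ h h'
      imp := fun u x y hx hy h1 h2 => hc.imp _ _ _ (quad_mem_julia_iff.2 hx)
        (quad_mem_julia_iff.2 hy) (h.gr_quad h1) (h.gr_quad h2) }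
  exact core_subset this hxy

theorem neg_mem_core (h : IsBottcher v ψ) {x y : ℂ} (hxy : (x, y) ∈ core v ψ) :
    (-x, -y) ∈ core v ψ := by
  have hc := isLamination_core (v := v) (ψ := ψ)
  have : IsLamination v ψ {q | (-q.1, -q.2) ∈ core v ψ} :=
    { closed := hc.closed.preimage (continuous_fst.neg.prodMk continuous_snd.neg)
      sub := fun x y h => ⟨neg_mem_julia_iff.1 (hc.sub _ _ h).1,
        neg_mem_julia_iff.1 (hc.sub _ _ h).2⟩
      refl := fun x hx => hc.refl _ (neg_mem_julia_iff.2 hx)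
      symm := fun x y h => hc.symm _ _ h
      trans := fun x y z h h' => hc.trans _ _ _ h h'
      imp := fun u x y hx hy h1 h2 => hc.imp _ _ _ (neg_mem_julia_iff.2 hx)
        (neg_mem_julia_iff.2 hy) (h.gr_neg h1) (h.gr_neg h2) }
  exact core_subset this hxy

theorem core_lift (h : IsBottcher v ψ) {a b : ℂ} (hab : (a, b) ∈ core v ψ) :
    ∃ x y, quad v x = a ∧ quad v y = b ∧ (x, y) ∈ core v ψ := by
  have hc := isLamination_core (v := v) (ψ := ψ)
  have hq : Continuous fun q : ℂ × ℂ => (quad v q.1, quad v q.2) :=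
    ((continuous_quad v).comp continuous_fst).prodMk ((continuous_quad v).comp continuous_snd)
  have : IsLamination v ψ ((fun q : ℂ × ℂ => (quad v q.1, quad v q.2)) '' core v ψ) := by
    refine ⟨?_, ?_, ?_, ?_, ?_, ?_⟩
    · refine (IsCompact.image ?_ hq).isClosed
      exact ((isCompact_julia v).prod (isCompact_julia v)).of_isClosed_subset hc.closed
        (core_subset isLamination_prod)
    · rintro _ _ ⟨⟨x, y⟩, hxy, he⟩
      rw [Prod.mk.injEq] at he
      rw [← he.1, ← he.2]
      exact ⟨quad_mem_julia_iff.2 (hc.sub _ _ hxy).1, quad_mem_julia_iff.2 (hc.sub _ _ hxy).2⟩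
    · intro a ha
      obtain ⟨x, rfl⟩ := exists_quad_eq v a
      exact ⟨(x, x), hc.refl x (quad_mem_julia_iff.1 ha), rfl⟩
    · rintro _ _ ⟨⟨x, y⟩, hxy, he⟩
      rw [Prod.mk.injEq] at he
      rw [← he.1, ← he.2]
      exact ⟨(y, x), hc.symm _ _ hxy, rfl⟩
    · rintro _ _ _ ⟨⟨x, y⟩, hxy, he⟩ ⟨⟨y', z⟩, hyz, he'⟩
      rw [Prod.mk.injEq] at he he'
      rw [← he.1, ← he'.2]
      have h1 : quad v y = quad v y' := he.2.trans he'.1.symm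
      rcases quad_eq_quad_iff.1 h1 with rfl | rfl
      · exact ⟨(x, z), hc.trans _ _ _ hxy hyz, rfl⟩
      · refine ⟨(x, -z), hc.trans _ _ _ hxy (h.neg_mem_core hyz), ?_⟩
        simp [quad_neg]
    · intro u a b ha hb hau hbu
      obtain ⟨x, rfl⟩ := exists_quad_eq v a
      obtain ⟨y, rfl⟩ := exists_quad_eq v b
      obtain ⟨w, hw, hxw⟩ := h.gr_lift hau
      obtain ⟨w', hw', hyw⟩ := h.gr_lift hbu
      have hx := quad_mem_julia_iff.1 ha
      have hy := quad_mem_julia_iff.1 hb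
      rcases sq_eq_sq_iff_eq_or_eq_neg.1 (hw.trans hw'.symm) with rfl | rfl
      · exact ⟨(x, y), hc.imp _ _ _ hx hy hxw hyw, rfl⟩
      · refine ⟨(x, -y), hc.imp _ _ _ hx (neg_mem_julia_iff.2 hy) hxw (h.gr_neg hyw), ?_⟩
        simp [quad_neg]
  obtain ⟨⟨x, y⟩, hxy, he⟩ := core_subset this hab
  rw [Prod.mk.injEq] at he
  exact ⟨x, y, he.1, he.2, hxy⟩

theorem exists_connected_of_mem_core (h : IsBottcher v ψ) {x y : ℂ} (hxy : (x, y) ∈ core v ψ) :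
    ∃ C ⊆ {z | (x, z) ∈ core v ψ}, IsPreconnected C ∧ x ∈ C ∧ y ∈ C := by
  have hc := isLamination_core (v := v) (ψ := ψ)
  set S : Set (ℂ × ℂ) := {q | q ∈ core v ψ ∧
    ∃ C ⊆ {z | (q.1, z) ∈ core v ψ}, IsPreconnected C ∧ q.1 ∈ C ∧ q.2 ∈ C} with hS
  have hlam : IsLamination v ψ S := by
    refine ⟨?_, ?_, ?_, ?_, ?_, ?_⟩
    · refine isClosed_of_closure_subset fun q hq => ?_
      obtain ⟨s, hs, hlim⟩ := mem_closure_iff_seq_limit.1 hq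
      have hqc : q ∈ core v ψ := hc.closed.mem_of_tendsto hlim (Eventually.of_forall fun n => (hs n).1)
      refine ⟨hqc, ?_⟩
      by_contra hno
      set F : Set ℂ := {z | (q.1, z) ∈ core v ψ} with hF
      have hFc : IsCompact F := (isCompact_julia v).of_isClosed_subset
        (hc.closed.preimage (Continuous.prodMk continuous_const continuous_id))
        fun z hz => (hc.sub _ _ hz).2
      obtain ⟨U, V, hU, hV, hUV, hFUV, hxU, hyV⟩ := exists_separation hFc
        (x := q.1) (y := q.2) (hc.refl _ (hc.sub _ _ hqc).1) hqc
        fun C hC hCp hx hy => hno ⟨C, hC, hCp, hx, hy⟩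
      have h1 : Tendsto (fun n => (s n).1) atTop (𝓝 q.1) := (continuous_fst.tendsto q).comp hlim
      have h2 : Tendsto (fun n => (s n).2) atTop (𝓝 q.2) := (continuous_snd.tendsto q).comp hlim
      have h3 : ∃ᶠ n in atTop, ∃ z, ((s n).1, z) ∈ core v ψ ∧ z ∉ U ∪ V := by
        refine Eventually.frequently ?_
        filter_upwards [h1.eventually (hU.mem_nhds hxU), h2.eventually (hV.mem_nhds hyV)]
          with n hn1 hn2
        obtain ⟨C, hC, hCp, hxC, hyC⟩ := (hs n).2
        by_contra! hcon
        rcases hCp.subset_or_subset hU hV hUV fun z hz => hcon z (hC hz) with h4 | h4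
        · exact Set.disjoint_left.1 hUV (h4 hyC) hn2
        · exact Set.disjoint_left.1 hUV hn1 (h4 hxC)
      obtain ⟨k, hk, hz⟩ := extraction_of_frequently_atTop h3
      choose z hz1 hz2 using hz
      obtain ⟨ζ, -, m, hm, hζ⟩ := (isCompact_julia v).tendsto_subseq
        (x := z) fun n => (hc.sub _ _ (hz1 n)).2
      have h5 : (q.1, ζ) ∈ core v ψ := by
        refine hc.closed.mem_of_tendsto (f := fun n => ((s (k (m n))).1, z (m n)))
          (Tendsto.prodMk_nhds ?_ hζ) (Eventually.of_forall fun n => hz1 (m n))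
        exact h1.comp (hk.tendsto_atTop.comp hm.tendsto_atTop)
      have h6 : ζ ∈ (U ∪ V)ᶜ := (hU.union hV).isClosed_compl.mem_of_tendsto hζ
        (Eventually.of_forall fun n => hz2 (m n))
      exact h6 (hFUV h5)
    · exact fun x y hq => hc.sub _ _ hq.1
    · exact fun x hx => ⟨hc.refl x hx, {x}, by simpa using hc.refl x hx,
        isPreconnected_singleton, rfl, rfl⟩
    · rintro x y ⟨hq, C, hC, hCp, hx, hy⟩
      exact ⟨hc.symm _ _ hq, C, fun z hz => hc.trans _ _ _ (hc.symm _ _ hq) (hC hz), hCp, hy, hx⟩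
    · rintro x y z ⟨hq, C, hC, hCp, hx, hy⟩ ⟨hq', C', hC', hCp', hx', hy'⟩
      refine ⟨hc.trans _ _ _ hq hq', C ∪ C', union_subset hC fun w hw =>
        hc.trans _ _ _ hq (hC' hw), hCp.union y hy hx' hCp', Or.inl hx, Or.inr hy'⟩
    · intro u x y hx hy hxu hyu
      refine ⟨hc.imp u x y hx hy hxu hyu, imp v ψ {u}, fun z hz => ?_,
        (h.isConnected_imp (norm_eq_one_of_mem_gr hxu)).isPreconnected,
        ⟨hx, u, rfl, hxu⟩, ⟨hy, u, rfl, hyu⟩⟩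
      obtain ⟨hzJ, u', hu', hzu⟩ := hz
      rw [mem_singleton_iff] at hu'
      exact hc.imp u x z hx hzJ hxu (hu' ▸ hzu)
  exact (core_subset hlam hxy).2

end IsBottcher

/-- An invariant closed set of angles whose impression is a continuum through `p`. -/
structure IsTrap (v : ℂ) (ψ : ℂ → ℂ) (p : ℂ) (E : Set ℂ) : Prop where
  closed : IsClosed E
  norm : ∀ u ∈ E, ‖u‖ = 1
  mem : p ∈ imp v ψ E
  sat : ∀ x u, x ∈ imp v ψ E → (x, u) ∈ gr ψ → u ∈ E
  sq : ∀ u ∈ E, u ^ 2 ∈ E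
  root : ∀ u ∈ E, ∃ e ∈ E, e ^ 2 = u
  conn : IsPreconnected (imp v ψ E)
  neg : ∀ u ∈ E, -u ∉ E

/-- Any two square roots up to rotation by half the angle. -/
theorem exists_half_angle {u e : ℂ} {θ : ℝ} (he : u ^ 2 = e ^ 2 * Complex.exp (θ * Complex.I)) :
    u = e * Complex.exp ((θ / 2 : ℝ) * Complex.I) ∨
      -u = e * Complex.exp ((θ / 2 : ℝ) * Complex.I) := by
  have : u ^ 2 = (e * Complex.exp ((θ / 2 : ℝ) * Complex.I)) ^ 2 := by
    rw [he, mul_pow, ← Complex.exp_nat_mul]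
    congr 2
    push_cast; ring
  rcases sq_eq_sq_iff_eq_or_eq_neg.1 this with h | h
  · exact Or.inl h
  · exact Or.inr (by rw [h, neg_neg])

/-- The closed neighbourhood of angular size `a` of a set of angles. -/
def nb (E : Set ℂ) (a : ℝ) : Set ℂ := {u | ∃ e ∈ E, u ∈ arc e a}

theorem mem_nb {E : Set ℂ} {a : ℝ} {u : ℂ} :
    u ∈ nb E a ↔ ∃ e ∈ E, ∃ θ : ℝ, |θ| ≤ a ∧ u = e * Complex.exp (θ * Complex.I) := by
  constructor
  · rintro ⟨e, he, θ, hθ, rfl⟩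
    exact ⟨e, he, θ, abs_le.2 hθ, rfl⟩
  · rintro ⟨e, he, θ, hθ, rfl⟩
    exact ⟨e, he, θ, abs_le.1 hθ, rfl⟩

theorem nb_mono (E : Set ℂ) {a b : ℝ} (h : a ≤ b) : nb E a ⊆ nb E b :=
  fun _ ⟨e, he, hu⟩ => ⟨e, he, arc_mono e h hu⟩

theorem subset_nb (E : Set ℂ) {a : ℝ} (h : 0 ≤ a) : E ⊆ nb E a :=
  fun e he => ⟨e, he, mem_arc_self e h⟩

theorem exists_dist_le_of_mem_nb {E : Set ℂ} (hE : ∀ u ∈ E, ‖u‖ = 1) {a : ℝ} {u : ℂ}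
    (hu : u ∈ nb E a) : ∃ e ∈ E, dist u e ≤ a := by
  obtain ⟨e, he, θ, hθ, rfl⟩ := mem_nb.1 hu
  refine ⟨e, he, ?_⟩
  have h1 := Real.norm_exp_I_mul_ofReal_sub_one_le (x := θ)
  rw [dist_eq_norm]
  have : e * Complex.exp (θ * Complex.I) - e = e * (Complex.exp (Complex.I * θ) - 1) := by
    rw [mul_comm Complex.I]; ring
  rw [this, norm_mul, hE e he, one_mul]
  exact h1.trans hθ

theorem mem_of_forall_nb {E : Set ℂ} (hE : IsClosed E) (hE1 : ∀ u ∈ E, ‖u‖ = 1) {u : ℂ} {a : ℝ}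
    (hu : ∀ n : ℕ, u ∈ nb E (a / 2 ^ n)) : u ∈ E := by
  rw [← hE.closure_eq, Metric.mem_closure_iff]
  intro ε hε
  have : Tendsto (fun n : ℕ => a / 2 ^ n) atTop (𝓝 0) := by
    simpa [div_eq_mul_inv] using (tendsto_pow_atTop_nhds_zero_of_lt_one (r := (2 : ℝ)⁻¹)
      (by norm_num) (by norm_num)).const_mul a
  obtain ⟨n, hn⟩ := (this.eventually_lt_const hε).exists
  obtain ⟨e, he, hd⟩ := exists_dist_le_of_mem_nb hE1 (hu n)
  exact ⟨e, he, hd.trans_lt hn⟩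

theorem isCompact_nb {E : Set ℂ} (hE : IsClosed E) (hE1 : ∀ u ∈ E, ‖u‖ = 1) (a : ℝ) :
    IsCompact (nb E a) := by
  have hEc : IsCompact E := (isCompact_sphere (0 : ℂ) 1).of_isClosed_subset hE
    fun u hu => by simpa using hE1 u hu
  have : nb E a = (fun q : ℂ × ℝ => q.1 * Complex.exp (q.2 * Complex.I)) '' (E ×ˢ Icc (-a) a) := by
    ext u; constructor
    · rintro ⟨e, he, θ, hθ, rfl⟩; exact ⟨(e, θ), ⟨he, hθ⟩, rfl⟩
    · rintro ⟨⟨e, θ⟩, ⟨he, hθ⟩, rfl⟩; exact ⟨e, he, θ, hθ, rfl⟩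
  rw [this]
  exact (hEc.prod isCompact_Icc).image (by fun_prop)

theorem eq_mul_exp_arg {u e : ℂ} (hu : ‖u‖ = 1) (he : ‖e‖ = 1) :
    u = e * Complex.exp (Complex.arg (u / e) * Complex.I) := by
  have he0 : e ≠ 0 := by rintro rfl; simp at he
  have h1 := Complex.norm_mul_exp_arg_mul_I (u / e)
  rw [norm_div, hu, he, div_one, Complex.ofReal_one, one_mul] at h1
  rw [h1, mul_div_cancel₀ _ he0]

namespace IsBottcher

theorem exists_isTrap (h : IsBottcher v ψ) {S : Set (ℂ × ℂ)} (hS : IsLamination v ψ S)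
    {a b : ℂ} (ha : a ∈ julia v) (hb : b ∈ julia v) (hab : (a, b) ∉ S) {p : ℂ}
    (hp : quad v p = p) (hpJ : p ∈ julia v) : ∃ E, IsTrap v ψ p E := by
  have hc := isLamination_core (v := v) (ψ := ψ)
  set Q : Set ℂ := {x | (p, x) ∈ core v ψ} with hQ
  have hQJ : Q ⊆ julia v := fun x hx => (hc.sub _ _ hx).2
  have hpQ : p ∈ Q := hc.refl p hpJ
  have hQcl : IsClosed Q := hc.closed.preimage (Continuous.prodMk continuous_const continuous_id)
  set E : Set ℂ := {u | ∃ x ∈ Q, (x, u) ∈ gr ψ} with hE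
  have hsat : ∀ u ∈ E, ∀ x ∈ julia v, (x, u) ∈ gr ψ → x ∈ Q := by
    rintro u ⟨y, hy, hyu⟩ x hx hxu
    exact hc.trans _ _ _ hy (hc.imp u y x (hQJ hy) hx hyu hxu)
  have himp : imp v ψ E = Q := by
    ext x; constructor
    · rintro ⟨hx, u, hu, hxu⟩; exact hsat u hu x hx hxu
    · intro hx
      obtain ⟨u, hu⟩ := h.exists_angle (mem_julia_iff.1 (hQJ hx)).2
      exact ⟨hQJ hx, u, ⟨x, hx, hu⟩, hu⟩
  have hE1 : ∀ u ∈ E, ‖u‖ = 1 := by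
    rintro u ⟨x, -, hu⟩; exact norm_eq_one_of_mem_gr hu
  have hquad : ∀ x ∈ Q, quad v x ∈ Q := fun x hx => by
    have := h.quad_mem_core hx
    rwa [hp] at this
  have hlift : ∀ x ∈ Q, ∃ y ∈ Q, quad v y = x := by
    intro x hx
    obtain ⟨p', x', hp', hx', hpx⟩ := h.core_lift hx
    rcases quad_eq_quad_iff.1 (hp'.trans hp.symm) with rfl | rfl
    · exact ⟨x', hpx, hx'⟩
    · refine ⟨-x', ?_, by rw [quad_neg, hx']⟩
      have := h.neg_mem_core hpx
      rwa [neg_neg] at this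
  have hroot : ∀ u ∈ E, ∃ e ∈ E, e ^ 2 = u := by
    rintro u ⟨x, hx, hxu⟩
    obtain ⟨y, hy, rfl⟩ := hlift x hx
    obtain ⟨w, hw, hyw⟩ := h.gr_lift hxu
    exact ⟨w, ⟨y, hy, hyw⟩, hw⟩
  have hEcl : IsClosed E := by
    refine isClosed_of_closure_subset fun u hu => ?_
    obtain ⟨w, hw, hlim⟩ := mem_closure_iff_seq_limit.1 hu
    choose x hx hxw using hw
    obtain ⟨z, -, k, hk, hz⟩ := (isCompact_julia v).tendsto_subseq (x := x) fun n => hQJ (hx n)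
    exact ⟨z, hQcl.mem_of_tendsto hz (Eventually.of_forall fun n => hx (k n)),
      isClosed_closure.mem_of_tendsto (hz.prodMk_nhds (hlim.comp hk.tendsto_atTop))
        (Eventually.of_forall fun n => hxw (k n))⟩
  refine ⟨E, hEcl, hE1, himp ▸ hpQ, ?_, ?_, hroot, ?_, ?_⟩
  · intro x u hx hxu
    rw [himp] at hx
    exact ⟨x, hx, hxu⟩
  · rintro u ⟨x, hx, hxu⟩
    exact ⟨quad v x, hquad x hx, h.gr_quad hxu⟩
  · rw [himp]
    refine isPreconnected_of_forall p fun x hx => ?_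
    obtain ⟨C, hC, hCp, h1, h2⟩ := h.exists_connected_of_mem_core hx
    exact ⟨C, hC, h1, h2, hCp⟩
  · rintro u ⟨x, hx, hxu⟩ hneg
    have hx' : -x ∈ Q := hsat _ hneg _ (neg_mem_julia_iff.2 (hQJ hx)) (h.gr_neg hxu)
    have hp' : (p, -p) ∈ core v ψ :=
      hc.trans _ _ _ hx' (hc.symm _ _ (h.neg_mem_core hx))
    have hback : ∀ x, quad v x ∈ Q → x ∈ Q := by
      intro x hx
      obtain ⟨y, hy, he⟩ := hlift _ hx
      rcases quad_eq_quad_iff.1 he with rfl | rfl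
      · exact hy
      · have := hc.trans _ _ _ hp' (h.neg_mem_core hy)
        rwa [neg_neg] at this
    have hEback : ∀ e ∈ E, ∀ w, w ^ 2 = e → w ∈ E := by
      rintro e he w hw
      have hw1 : ‖w‖ = 1 := by
        have := hE1 e he
        rw [← hw, norm_pow] at this
        exact (pow_eq_one_iff_of_nonneg (norm_nonneg w) two_ne_zero).1 this
      obtain ⟨y, hyJ, w', hw', hyw⟩ := (h.isConnected_imp hw1).nonempty
      rw [mem_singleton_iff] at hw'
      subst hw'
      exact ⟨y, hback y (hsat e he _ (quad_mem_julia_iff.2 hyJ) (hw ▸ h.gr_quad hyw)), hyw⟩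
    have hdense : ∀ n : ℕ, ∀ w : ℂ, ‖w‖ = 1 → w ∈ nb E (Real.pi / 2 ^ n) := by
      intro n
      induction n with
      | zero =>
        intro w hw
        have hu : u ∈ E := ⟨x, hx, hxu⟩
        refine mem_nb.2 ⟨u, hu, _, ?_, eq_mul_exp_arg hw (hE1 u hu)⟩
        simpa using Complex.abs_arg_le_pi _
      | succ n ih =>
        intro w hw
        obtain ⟨e, he, θ, hθ, hwe⟩ := mem_nb.1 (ih (w ^ 2) (by rw [norm_pow, hw, one_pow]))
        obtain ⟨e', he', rfl⟩ := hroot e he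
        have h2 : |θ / 2| ≤ Real.pi / 2 ^ (n + 1) := by
          rw [abs_div, abs_two, pow_succ, ← div_div]
          gcongr
        rcases exists_half_angle hwe with h1 | h1
        · exact mem_nb.2 ⟨e', he', _, h2, h1⟩
        · refine mem_nb.2 ⟨-e', hEback _ he _ (neg_sq e'), _, h2, ?_⟩
          rw [neg_mul, ← h1, neg_neg]
    have hall : ∀ x ∈ julia v, x ∈ Q := by
      intro x hx
      obtain ⟨w, hw⟩ := h.exists_angle (mem_julia_iff.1 hx).2
      exact hsat w (mem_of_forall_nb hEcl hE1 fun n => hdense n w (norm_eq_one_of_mem_gr hw)) x hx hw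
    exact hab (core_subset hS (hc.trans _ _ _ (hc.symm _ _ (hall a ha)) (hall b hb)))

end IsBottcher

end CremerJulia

namespace CremerJulia
open Set Filter Topology Metric

variable {v p : ℂ} {ψ : ℂ → ℂ} {E : Set ℂ}

theorem mem_of_tendsto_nb (hE : IsClosed E) (hE1 : ∀ u ∈ E, ‖u‖ = 1) {a : ℕ → ℝ} {w : ℕ → ℂ} {u : ℂ}
    (ha : Tendsto a atTop (𝓝 0)) (hw : ∀ n, w n ∈ nb E (a n)) (hu : Tendsto w atTop (𝓝 u)) :
    u ∈ E := by
  choose e he hd using fun n => exists_dist_le_of_mem_nb hE1 (hw n)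
  have he' : Tendsto e atTop (𝓝 u) := by
    refine tendsto_iff_dist_tendsto_zero.2 ?_
    have h1 := (ha.add (tendsto_iff_dist_tendsto_zero.1 hu))
    rw [add_zero] at h1
    refine squeeze_zero (fun _ => dist_nonneg) (fun n => ?_) h1
    exact (dist_triangle_left _ _ (w n)).trans (add_le_add_left (hd n) _)
  exact hE.mem_of_tendsto he' (Eventually.of_forall he)

namespace IsTrap

theorem norm_of_mem_nb (hT : IsTrap v ψ p E) {a : ℝ} {u : ℂ} (hu : u ∈ nb E a) : ‖u‖ = 1 := by
  obtain ⟨e, he, θ, -, rfl⟩ := mem_nb.1 hu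
  rw [norm_mul, Complex.norm_exp_ofReal_mul_I, hT.norm e he, one_mul]

theorem isClosed_nb (hT : IsTrap v ψ p E) (a : ℝ) : IsClosed (nb E a) :=
  (isCompact_nb hT.closed hT.norm a).isClosed

theorem exists_nb_neg (hT : IsTrap v ψ p E) : ∃ ε > 0, ∀ u ∈ nb E ε, -u ∉ nb E ε := by
  by_contra! hcon
  choose w hw hw' using fun n : ℕ => hcon (1 / (n + 1)) (by positivity)
  obtain ⟨u, -, k, hk, hlim⟩ := (isCompact_sphere (0 : ℂ) 1).tendsto_subseq (x := w)
    fun n => by simpa using hT.norm_of_mem_nb (hw n)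
  have h0 := tendsto_one_div_succ.comp hk.tendsto_atTop
  exact hT.neg u (mem_of_tendsto_nb hT.closed hT.norm h0 (fun n => hw (k n)) hlim)
    (mem_of_tendsto_nb hT.closed hT.norm h0 (fun n => hw' (k n)) hlim.neg)

theorem exists_neg_notMem_ang (hT : IsTrap v ψ p E) (h : IsBottcher v ψ) :
    ∃ ε > 0, ∀ z ∈ ang ψ (nb E ε), -z ∉ ang ψ (nb E ε) := by
  obtain ⟨ε, hε, hneg⟩ := hT.exists_nb_neg
  by_contra! hcon
  choose z hz hz' using fun n : ℕ => hcon (ε * (1 / (n + 1))) (by positivity)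
  choose w hw hzw using hz
  choose w' hw' hzw' using hz'
  have hle : ∀ n : ℕ, ε * (1 / (n + 1)) ≤ ε := fun n =>
    mul_le_of_le_one_right hε.le (by
      rw [div_le_one (by positivity)]; linarith [n.cast_nonneg (α := ℝ)])
  have hzw2 : ∀ n, (z n, -w' n) ∈ gr ψ := fun n => by simpa using h.gr_neg (hzw' n)
  have hzK : ∀ n, z n ∈ filled v := by
    intro n
    by_contra hK
    obtain ⟨x, hx, he⟩ := h.exists_eq hK
    have h1 := h.eq_of_mem_gr hx (he ▸ hzw n)
    have h2 := h.eq_of_mem_gr hx (he ▸ hzw2 n)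
    refine hneg _ (nb_mono E (hle n) (hw n)) ?_
    rw [h1, ← h2, neg_neg]
    exact nb_mono E (hle n) (hw' n)
  obtain ⟨⟨x, u, u'⟩, -, k, hk, hlim⟩ := ((isCompact_filled v).prod
    ((isCompact_sphere (0 : ℂ) 1).prod (isCompact_sphere (0 : ℂ) 1))).tendsto_subseq
    (x := fun n => (z n, w n, w' n)) fun n => ⟨hzK n,
      by simpa using hT.norm_of_mem_nb (hw n), by simpa using hT.norm_of_mem_nb (hw' n)⟩
  have hx : Tendsto (fun n => z (k n)) atTop (𝓝 x) := (continuous_fst.tendsto _).comp hlim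
  have hu : Tendsto (fun n => w (k n)) atTop (𝓝 u) :=
    ((continuous_fst.comp continuous_snd).tendsto _).comp hlim
  have hu' : Tendsto (fun n => w' (k n)) atTop (𝓝 u') :=
    ((continuous_snd.comp continuous_snd).tendsto _).comp hlim
  have h0 : Tendsto (fun n : ℕ => ε * (1 / ((k n : ℝ) + 1))) atTop (𝓝 0) := by
    simpa using (tendsto_one_div_succ.comp hk.tendsto_atTop).const_mul ε
  have huE := mem_of_tendsto_nb hT.closed hT.norm h0 (fun n => hw (k n)) hu
  have huE' := mem_of_tendsto_nb hT.closed hT.norm h0 (fun n => hw' (k n)) hu'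
  have hxu : (x, u) ∈ gr ψ := isClosed_closure.mem_of_tendsto (hx.prodMk_nhds hu)
    (Eventually.of_forall fun n => hzw (k n))
  have hxu' : (x, -u') ∈ gr ψ := isClosed_closure.mem_of_tendsto (hx.prodMk_nhds hu'.neg)
    (Eventually.of_forall fun n => hzw2 (k n))
  have hxJ : x ∈ julia v := mem_julia_iff.2 ⟨(isClosed_filled v).mem_of_tendsto hx
    (Eventually.of_forall fun n => hzK (k n)), h.ang_subset univ ⟨u, mem_univ _, hxu⟩⟩
  exact hT.neg u' huE' (hT.sat x _ ⟨hxJ, u, huE, hxu⟩ hxu')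

theorem sqrt_mem_nb (hT : IsTrap v ψ p E) {a : ℝ} {u : ℂ} (hu : u ^ 2 ∈ nb E a) :
    u ∈ nb E (a / 2) ∨ -u ∈ nb E (a / 2) := by
  obtain ⟨e, he, θ, hθ, heq⟩ := mem_nb.1 hu
  obtain ⟨e', he', rfl⟩ := hT.root e he
  have h2 : |θ / 2| ≤ a / 2 := by rw [abs_div, abs_two]; gcongr
  exact (exists_half_angle heq).imp (fun h => mem_nb.2 ⟨e', he', _, h2, h⟩)
    fun h => mem_nb.2 ⟨e', he', _, h2, h⟩

/-- Angles whose orbits under squaring stay near a trap belong to it. -/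
theorem mem_of_forall_pow (hT : IsTrap v ψ p E) {ε : ℝ} (hε : 0 < ε)
    (hneg : ∀ u ∈ nb E ε, -u ∉ nb E ε) {u : ℂ} (hu : ∀ n : ℕ, u ^ 2 ^ n ∈ nb E ε) : u ∈ E := by
  refine mem_of_forall_nb hT.closed hT.norm (a := ε) fun n => ?_
  have key : ∀ n m : ℕ, u ^ 2 ^ m ∈ nb E (ε / 2 ^ n) := by
    intro n
    induction n with
    | zero => simpa using hu
    | succ n ih =>
      intro m
      have h1 := ih (m + 1)
      rw [pow_succ, pow_mul] at h1
      rcases hT.sqrt_mem_nb h1 with h2 | h2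
      · rwa [pow_succ, ← div_div]
      · refine absurd (nb_mono E ?_ h2) (hneg _ (hu m))
        rw [div_div]
        exact div_le_self hε.le (one_le_mul_of_one_le_of_one_le (one_le_pow₀ one_le_two) one_le_two)
  simpa using key n 0

theorem isPreconnected_imp_nb (hT : IsTrap v ψ p E) (h : IsBottcher v ψ) {a : ℝ} (ha : 0 ≤ a) :
    IsPreconnected (imp v ψ (nb E a)) := by
  refine isPreconnected_of_forall p ?_
  rintro x ⟨hxJ, u, ⟨e, he, hu⟩, hxu⟩
  have h1 := h.isConnected_imp_arc (hT.norm e he) ha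
  obtain ⟨y, hyJ, e', he', hye⟩ := (h.isConnected_imp (hT.norm e he)).nonempty
  rw [mem_singleton_iff] at he'
  rw [he'] at hye
  refine ⟨imp v ψ E ∪ imp v ψ (arc e a), ?_, Or.inl hT.mem, Or.inr ⟨hxJ, u, hu, hxu⟩,
    hT.conn.union y ⟨hyJ, e, he, hye⟩ ⟨hyJ, e, mem_arc_self e ha, hye⟩ h1.isPreconnected⟩
  exact union_subset (imp_mono (subset_nb E ha)) (imp_mono fun w hw => ⟨e, he, hw⟩)

end IsTrap

end CremerJulia

namespace CremerJulia
open Set Filter Topology Metric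

variable {v p : ℂ}

/-- A form of Montel's theorem along an ultrafilter: a pointwise bounded family with locally
bounded derivatives has a locally uniform limit. -/
theorem exists_limit_of_deriv_bound {W : Set ℂ} (hW : IsOpen W) {F : ℕ → ℂ → ℂ}
    (hF : ∀ n, DifferentiableOn ℂ (F n) W)
    (hd : ∀ z ∈ W, ∃ r > 0, ∃ L : ℝ, ∀ n, ∀ x ∈ ball z r ∩ W, ‖deriv (F n) x‖ ≤ L)
    (hb : ∀ z ∈ W, ∃ C : ℝ, ∀ n, ‖F n z‖ ≤ C) (l : Ultrafilter ℕ) :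
    ∃ f, DifferentiableOn ℂ f W ∧ TendstoLocallyUniformlyOn F f l W := by
  have hpt : ∀ z, ∃ a : ℂ, z ∈ W → Tendsto (fun n => F n z) l (𝓝 a) := by
    intro z
    by_cases hz : z ∈ W
    · obtain ⟨C, hC⟩ := hb z hz
      obtain ⟨a, -, ha⟩ := (isCompact_closedBall (0 : ℂ) C).ultrafilter_le_nhds
        (l.map fun n => F n z) (le_principal_iff.2 (mem_map.2 (univ_mem' fun n => by
          simpa using hC n)))
      exact ⟨a, fun _ => ha⟩
    · exact ⟨0, fun h => absurd h hz⟩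
  choose f hf using hpt
  have hlim : TendstoLocallyUniformlyOn F f l W := by
    rw [Metric.tendstoLocallyUniformlyOn_iff]
    intro ε hε x hx
    obtain ⟨r, hr, L, hL⟩ := hd x hx
    obtain ⟨r', hr', hsub⟩ := Metric.isOpen_iff.1 hW x hx
    set L' := max L 1 with hL'
    have hL'0 : 0 < L' := lt_max_of_lt_right one_pos
    set δ := min (min r r') (ε / (4 * L')) with hδ
    have hδ0 : 0 < δ := by positivity
    have hlip : ∀ n, ∀ y ∈ ball x δ, ‖F n y - F n x‖ ≤ ε / 4 := by
      intro n y hy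
      have hsub1 : ball x δ ⊆ ball x r ∩ W := fun w hw =>
        ⟨ball_subset_ball ((min_le_left _ _).trans (min_le_left _ _)) hw,
          hsub (ball_subset_ball ((min_le_left _ _).trans (min_le_right _ _)) hw)⟩
      have h1 := (convex_ball x δ).norm_image_sub_le_of_norm_deriv_le (f := F n) (C := L')
        (fun w hw => (hF n).differentiableAt (hW.mem_nhds (hsub1 hw).2))
        (fun w hw => (hL n w (hsub1 hw)).trans (le_max_left _ _)) (mem_ball_self hδ0) hy
      have h2 : ‖y - x‖ ≤ ε / (4 * L') :=
        (mem_ball_iff_norm.1 hy).le.trans (min_le_right _ _)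
      calc ‖F n y - F n x‖ ≤ L' * ‖y - x‖ := h1
        _ ≤ L' * (ε / (4 * L')) := by gcongr
        _ = ε / 4 := by field_simp
    refine ⟨ball x δ, mem_nhdsWithin_of_mem_nhds (ball_mem_nhds x hδ0), ?_⟩
    filter_upwards [Metric.tendsto_nhds.1 (hf x hx) (ε / 4) (by positivity)] with n hn y hy
    have hyW : y ∈ W :=
      hsub (ball_subset_ball ((min_le_left _ _).trans (min_le_right _ _)) hy)
    have h3 : ‖f y - f x‖ ≤ ε / 4 := le_of_tendsto ((hf y hyW).sub (hf x hx)).norm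
      (Eventually.of_forall fun m => hlip m y hy)
    have h4 := hlip n y hy
    rw [dist_eq_norm] at hn ⊢
    have h5 : f y - F n y = (f y - f x) - (F n x - f x) - (F n y - F n x) := by ring
    rw [h5]
    linarith [norm_sub_le (f y - f x - (F n x - f x)) (F n y - F n x),
      norm_sub_le (f y - f x) (F n x - f x)]
  exact ⟨f, hlim.differentiableOn (Eventually.of_forall hF) hW, hlim⟩

/-- Locally uniformly bounded holomorphic functions have locally bounded derivatives. -/
theorem exists_deriv_bound {W : Set ℂ} (hW : IsOpen W) {F : ℕ → ℂ → ℂ}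
    (hF : ∀ n, DifferentiableOn ℂ (F n) W) {C : ℝ} (hb : ∀ n, ∀ z ∈ W, ‖F n z‖ ≤ C) {z : ℂ}
    (hz : z ∈ W) : ∃ r > 0, ∃ L : ℝ, ∀ n, ∀ x ∈ ball z r ∩ W, ‖deriv (F n) x‖ ≤ L := by
  obtain ⟨r, hr, hsub⟩ := Metric.isOpen_iff.1 hW z hz
  refine ⟨r / 2, by positivity, C / (r / 4), fun n x hx => ?_⟩
  have hx2 := mem_ball.1 hx.1
  have hcb : closedBall x (r / 4) ⊆ W := fun y hy => hsub (by
    rw [mem_closedBall] at hy; rw [mem_ball]; linarith [dist_triangle y x z])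
  refine Complex.norm_deriv_le_of_forall_mem_sphere_norm_le (by positivity)
    (DifferentiableOn.diffContOnCl_ball (hF n) hcb) fun y hy => hb n y ?_
  exact hcb (sphere_subset_closedBall hy)

theorem exists_ball_injOn {f : ℂ → ℂ} {a : ℂ} (hf : HasStrictDerivAt f 1 a) :
    ∃ r > 0, InjOn f (ball a r) := by
  have h1 := hf.hasStrictFDerivAt.isLittleO.def (show (0 : ℝ) < 1 / 2 by norm_num)
  rw [nhds_prod_eq] at h1
  obtain ⟨r, hr, h2⟩ := (nhds_basis_ball.prod_self.eventually_iff).1 h1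
  refine ⟨r, hr, fun x hx y hy hxy => ?_⟩
  have h3 := h2 (x := (x, y)) ⟨hx, hy⟩
  simp only [hxy, sub_self, zero_sub, norm_neg] at h3
  have h4 : ‖x - y‖ ≤ 1 / 2 * ‖x - y‖ := by simpa using h3
  have h5 : ‖x - y‖ ≤ 0 := by linarith
  exact sub_eq_zero.1 (norm_le_zero_iff.1 h5)

theorem iterate_fixed (hfix : quad v p = p) (n : ℕ) : (quad v)^[n] p = p :=
  Function.iterate_fixed hfix n

theorem hasDerivAt_quad (z : ℂ) : HasDerivAt (quad v) (2 * z) z := by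
  have h := (hasDerivAt_pow 2 z).add_const v
  rw [show ((2 : ℕ) : ℂ) * z ^ (2 - 1) = 2 * z by norm_num] at h
  exact h

theorem hasDerivAt_iterate_quad (hfix : quad v p = p) (n : ℕ) :
    HasDerivAt ((quad v)^[n]) ((2 * p) ^ n) p := by
  induction n with
  | zero => simpa using! hasDerivAt_id p
  | succ n ih =>
    rw [Function.iterate_succ', pow_succ']
    refine HasDerivAt.comp p ?_ ih
    rw [iterate_fixed hfix]
    exact hasDerivAt_quad p

theorem mem_filled_of_fixed (hfix : quad v p = p) : p ∈ filled v := by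
  rw [mem_filled_iff_isBounded]
  simp only [iterate_fixed hfix]
  exact (Set.finite_range_const).isBounded

/-- A neutral fixed point in the interior of the filled Julia set is linearizable. -/
theorem exists_linearization (hfix : quad v p = p) (hlam : ‖2 * p‖ = 1)
    (hp : p ∈ interior (filled v)) :
    ∃ (U : Set ℂ) (h : ℂ → ℂ), IsOpen U ∧ p ∈ U ∧ DifferentiableOn ℂ h U ∧ InjOn h U ∧ h p = 0 ∧
      ∀ z ∈ U, quad v z ∈ U → h (quad v z) = 2 * p * h z := by
  set W := interior (filled v) with hW
  have hWo : IsOpen W := isOpen_interior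
  set c := 2 * p with hc
  have hc0 : c ≠ 0 := by rw [← norm_ne_zero_iff, hlam]; exact one_ne_zero
  have hcn : ∀ n : ℕ, ‖(c ^ n)⁻¹‖ = 1 := fun n => by rw [norm_inv, norm_pow, hlam, one_pow, inv_one]
  set R := ‖v‖ + 2 with hR
  set G : ℕ → ℂ → ℂ := fun k z => (c ^ k)⁻¹ * ((quad v)^[k] z - p) with hG
  have hGb : ∀ k, ∀ z ∈ filled v, ‖G k z‖ ≤ 2 * R := by
    intro k z hz
    rw [hG]
    simp only
    rw [norm_mul, hcn, one_mul]
    have h1 := mem_filled_iff.1 hz k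
    have h2 := norm_le_of_mem_filled (mem_filled_of_fixed hfix)
    linarith [norm_sub_le ((quad v)^[k] z) p]
  set F : ℕ → ℂ → ℂ := fun n z => ((n : ℂ) + 1)⁻¹ * ∑ k ∈ Finset.range (n + 1), G k z with hF
  have hn1 : ∀ n : ℕ, ‖((n : ℂ) + 1)⁻¹‖ = ((n : ℝ) + 1)⁻¹ := fun n => by
    rw [norm_inv, ← Nat.cast_add_one, Complex.norm_natCast, Nat.cast_add_one]
  have hFb : ∀ n, ∀ z ∈ W, ‖F n z‖ ≤ 2 * R := by
    intro n z hz
    simp only [hF]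
    rw [norm_mul, hn1, inv_mul_le_iff₀ (by positivity)]
    refine (norm_sum_le_of_le _ fun k _ => hGb k z (interior_subset hz)).trans ?_
    simp
  have hGd : ∀ k, Differentiable ℂ (G k) := fun k =>
    ((differentiable_iterate_quad v k).sub_const p).const_mul _
  have hFd : ∀ n, Differentiable ℂ (F n) := fun n =>
    (Differentiable.fun_sum fun k _ => hGd k).const_mul _
  obtain ⟨h, hhd, hlim⟩ := exists_limit_of_deriv_bound hWo (fun n => (hFd n).differentiableOn)
    (fun z hz => exists_deriv_bound hWo (fun n => (hFd n).differentiableOn) hFb hz)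
    (fun z hz => ⟨2 * R, fun n => hFb n z hz⟩) (hyperfilter ℕ)
  have hle : ((hyperfilter ℕ : Ultrafilter ℕ) : Filter ℕ) ≤ atTop := Nat.hyperfilter_le_atTop
  have hderiv : ∀ n, deriv (F n) p = 1 := by
    intro n
    have h1 : ∀ k, HasDerivAt (G k) 1 p := by
      intro k
      have := ((hasDerivAt_iterate_quad hfix k).sub_const p).const_mul ((c ^ k)⁻¹)
      rwa [inv_mul_cancel₀ (pow_ne_zero k hc0)] at this
    have h2 : HasDerivAt (F n) (((n : ℂ) + 1)⁻¹ * ∑ k ∈ Finset.range (n + 1), (1 : ℂ)) p :=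
      (HasDerivAt.fun_sum fun k _ => h1 k).const_mul _
    rw [h2.deriv]
    simp [Nat.cast_add_one_ne_zero]
  have hhp : deriv h p = 1 := by
    have h1 := (hlim.deriv (Eventually.of_forall fun n => (hFd n).differentiableOn) hWo).tendsto_at hp
    refine tendsto_nhds_unique h1 (tendsto_const_nhds.congr fun n => ?_)
    simp [hderiv n]
  have hp0 : h p = 0 := by
    refine tendsto_nhds_unique (hlim.tendsto_at hp) (tendsto_const_nhds.congr fun n => ?_)
    simp [hF, hG, iterate_fixed hfix]
  have hconj : ∀ z ∈ W, h (quad v z) = c * h z := by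
    intro z hz
    have hqz : quad v z ∈ W := quad_mem_interior_iff.2 hz
    have h1 := hlim.tendsto_at hqz
    have h2 := (hlim.tendsto_at hz).const_mul c
    rw [← sub_eq_zero]
    refine tendsto_nhds_unique (h1.sub h2) ?_
    have key : ∀ n, F n (quad v z) - c * F n z
        = ((n : ℂ) + 1)⁻¹ * (c * G (n + 1) z - c * G 0 z) := by
      intro n
      simp only [hF]
      have e : ∀ k, G k (quad v z) = c * G (k + 1) z := by
        intro k
        simp only [hG, Function.iterate_succ_apply, pow_succ]
        field_simp
      rw [mul_left_comm, ← mul_sub, Finset.mul_sum, ← Finset.sum_sub_distrib]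
      simp only [e]
      rw [Finset.sum_range_sub (fun k => c * G k z)]
    have h3 : Tendsto (fun n : ℕ => ((n : ℝ) + 1)⁻¹ * (4 * R)) atTop (𝓝 0) := by
      simpa using (tendsto_one_div_succ).mul_const (4 * R)
    refine (squeeze_zero_norm (fun n => ?_) h3).mono_left hle
    rw [key, norm_mul, hn1, ← mul_sub, norm_mul, hlam, one_mul]
    gcongr
    linarith [norm_sub_le (G (n + 1) z) (G 0 z), hGb (n + 1) z (interior_subset hz),
      hGb 0 z (interior_subset hz)]
  have hs : HasStrictDerivAt h 1 p := by
    have := ((hhd.analyticOnNhd hWo) p hp).hasStrictDerivAt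
    rwa [hhp] at this
  obtain ⟨r, hr, hinj⟩ := exists_ball_injOn hs
  exact ⟨ball p r ∩ W, h, isOpen_ball.inter hWo, ⟨mem_ball_self hr, hp⟩,
    hhd.mono inter_subset_right, hinj.mono inter_subset_left, hp0, fun z hz _ => hconj z hz.2⟩

end CremerJulia

namespace CremerJulia
open Set Filter Topology Metric

variable {v p : ℂ} {ψ : ℂ → ℂ} {E : Set ℂ}

/-- A quantitative open mapping theorem for holomorphic functions whose derivative is
controlled by its value at the centre. -/
theorem ball_subset_image_of_deriv_le {f : ℂ → ℂ} {a : ℂ} {ρ L : ℝ} (hρ : 0 < ρ) (hL : 0 ≤ L)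
    (hf : DifferentiableOn ℂ f (ball a ρ)) (h0 : deriv f a ≠ 0)
    (hd : ∀ z ∈ ball a ρ, ‖deriv f z‖ ≤ L * ‖deriv f a‖) :
    ball (f a) (ρ * ‖deriv f a‖ / (8 * (L + 1))) ⊆ f '' ball a ρ := by
  set M := ‖deriv f a‖ with hM
  have hM0 : 0 < M := norm_pos_iff.2 h0
  set s := ρ / (2 * (L + 1)) with hs
  have hs0 : 0 < s := by positivity
  have hsρ : s < ρ := by
    rw [hs, div_lt_iff₀ (by positivity)]; nlinarith
  have hdd : DifferentiableOn ℂ (deriv f) (ball a ρ) := hf.deriv isOpen_ball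
  have hsch : ∀ z ∈ ball a ρ, ‖deriv f z - deriv f a‖ ≤ (L + 1) * M / ρ * ‖z - a‖ := by
    intro z hz
    have := Complex.dist_le_div_mul_dist_of_mapsTo_ball (R₂ := (L + 1) * M) hdd
      (fun w hw => by
        rw [mem_closedBall, dist_eq_norm]
        linarith [norm_sub_le (deriv f w) (deriv f a), hd w hw]) hz
    simpa [dist_eq_norm] using this
  have hsub : closedBall a s ⊆ ball a ρ := closedBall_subset_ball hsρ
  have herr : ∀ z ∈ sphere a s, M * s / 2 ≤ ‖f z - f a‖ := by
    intro z hz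
    have h1 := (convex_closedBall a s).norm_image_sub_le_of_norm_hasDerivWithin_le
      (f := fun w => f w - deriv f a * w) (f' := fun w => deriv f w - deriv f a) (C := M / 2)
      (fun w hw => by
        have hw' := (hf.differentiableAt (isOpen_ball.mem_nhds (hsub hw))).hasDerivAt
        exact (hw'.sub (by simpa using (hasDerivAt_id w).const_mul (deriv f a))).hasDerivWithinAt)
      (fun w hw => by
        refine (hsch w (hsub hw)).trans ?_
        have : ‖w - a‖ ≤ s := by simpa [dist_eq_norm] using hw
        calc (L + 1) * M / ρ * ‖w - a‖ ≤ (L + 1) * M / ρ * s := by gcongr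
          _ = M / 2 := by rw [hs]; field_simp)
      (mem_closedBall_self hs0.le) (sphere_subset_closedBall hz)
    have h2 : ‖z - a‖ = s := by simpa [dist_eq_norm] using hz
    rw [h2] at h1
    have h3 : ‖deriv f a * (z - a)‖ = M * s := by rw [norm_mul, h2]
    have h4 : f z - f a = deriv f a * (z - a) + (f z - deriv f a * z - (f a - deriv f a * a)) := by
      ring
    rw [h4]
    have h5 := norm_sub_le (deriv f a * (z - a) + (f z - deriv f a * z - (f a - deriv f a * a)))
      (f z - deriv f a * z - (f a - deriv f a * a))
    rw [add_sub_cancel_right, h3] at h5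
    linarith
  have hfr : ∃ᶠ z in 𝓝 a, f z ≠ f a := by
    refine fun hev => h0 ?_
    have hev' : f =ᶠ[𝓝 a] fun _ => f a := hev.mono fun z hz => not_not.1 hz
    rw [hev'.deriv_eq, deriv_const]
  have key := DiffContOnCl.ball_subset_image_closedBall (hf.diffContOnCl_ball hsub) hs0 herr hfr
  have he : ρ * M / (8 * (L + 1)) = M * s / 2 / 2 := by rw [hs]; field_simp; norm_num
  rw [he]
  exact key.trans (image_mono hsub)

namespace IsTrap

theorem mem_ang_or_neg (hT : IsTrap v ψ p E) (h : IsBottcher v ψ) {ε : ℝ} (hε : 0 ≤ ε) {y : ℂ}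
    (hy : quad v y ∈ ang ψ (nb E ε)) : y ∈ ang ψ (nb E ε) ∨ -y ∈ ang ψ (nb E ε) := by
  obtain ⟨u, hu, hyu⟩ := hy
  obtain ⟨w, rfl, hw⟩ := h.gr_lift hyu
  have hle : ε / 2 ≤ ε := by linarith
  refine (hT.sqrt_mem_nb hu).imp (fun h1 => ⟨w, nb_mono E hle h1, hw⟩)
    fun h1 => ⟨-w, nb_mono E hle h1, h.gr_neg hw⟩

theorem quad_zero_notMem (hT : IsTrap v ψ p E) (h : IsBottcher v ψ) {ε : ℝ} (hε : 0 ≤ ε)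
    (hneg : ∀ z ∈ ang ψ (nb E ε), -z ∉ ang ψ (nb E ε)) : v ∉ ang ψ (nb E ε) := by
  intro hv
  have h0 : quad v 0 = v := by simp [quad]
  rw [← h0] at hv
  rcases hT.mem_ang_or_neg h hε hv with h1 | h1
  · exact hneg _ h1 (by simpa using h1)
  · exact hneg _ h1 (by simpa using h1)

theorem mem_imp_nb (hT : IsTrap v ψ p E) {ε : ℝ} (hε : 0 ≤ ε) : p ∈ imp v ψ (nb E ε) :=
  imp_mono (subset_nb E hε) hT.mem

theorem mem_ang_nb (hT : IsTrap v ψ p E) {ε : ℝ} (hε : 0 ≤ ε) : p ∈ ang ψ (nb E ε) :=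
  (hT.mem_imp_nb hε).2

theorem isClosed_ang_nb (hT : IsTrap v ψ p E) (ε : ℝ) : IsClosed (ang ψ (nb E ε)) :=
  isClosed_ang (hT.isClosed_nb ε)

end IsTrap

theorem IsBottcher.exists_mem_closure_ray (h : IsBottcher v ψ) {u : ℂ} (hu : ‖u‖ = 1) {ρ : ℝ}
    (hρ : 1 < ρ) :
    ∃ x ∈ imp v ψ {u}, x ∈ closure ((fun t : ℝ => ψ (t * u)) '' Ioc 1 ρ) := by
  obtain ⟨R, hR⟩ := h.exists_norm_psi_le
  set t : ℕ → ℝ := fun n => 1 + min (ρ - 1) 1 * (1 / ((n : ℝ) + 1)) with ht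
  have hm : 0 < min (ρ - 1) 1 := lt_min (by linarith) one_pos
  have hi : ∀ n : ℕ, (1 : ℝ) / ((n : ℝ) + 1) ≤ 1 := fun n => by
    rw [div_le_one (by positivity)]; linarith [n.cast_nonneg (α := ℝ)]
  have ht1 : ∀ n, 1 < t n := fun n => by
    simp only [ht]
    linarith [mul_pos hm (Nat.one_div_pos_of_nat (α := ℝ) (n := n))]
  have ht2 : ∀ n, t n ≤ 1 + min (ρ - 1) 1 := fun n => by
    simp only [ht]; linarith [mul_le_of_le_one_right hm.le (hi n)]
  have hnorm : ∀ n, ‖(t n : ℂ) * u‖ = t n := fun n => by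
    rw [norm_mul, hu, mul_one, Complex.norm_real, Real.norm_of_nonneg (by linarith [ht1 n])]
  obtain ⟨x, -, k, hk, hx⟩ := (isCompact_closedBall (0 : ℂ) R).tendsto_subseq
    (x := fun n => ψ (t n * u)) fun n => by
      rw [mem_closedBall_zero_iff]
      refine hR _ (by rw [hnorm]; exact ht1 n) ?_
      rw [hnorm]; linarith [ht2 n, min_le_right (ρ - 1) (1 : ℝ)]
  have hlim : Tendsto t atTop (𝓝 1) := by
    have := (tendsto_one_div_succ.const_mul (min (ρ - 1) 1)).const_add 1
    simpa [ht] using this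
  have hxu : (x, u) ∈ gr ψ := by
    refine isClosed_closure.mem_of_tendsto (hx.prodMk_nhds tendsto_const_nhds)
      (Eventually.of_forall fun n => ?_)
    have h1 := mem_gr_of_norm (ψ := ψ) (w := (t (k n) : ℂ) * u) (by rw [hnorm]; exact ht1 _)
    rw [hnorm, mul_div_cancel_left₀] at h1
    · exact h1
    · exact_mod_cast (by linarith [ht1 (k n)] : t (k n) ≠ 0)
  have hxK : x ∈ filled v := by
    by_contra hK
    obtain ⟨w, hw, rfl⟩ := h.exists_eq hK
    have h1 := h.tendsto_of_comp (g := fun n => (t (k n) : ℂ) * u)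
      (Eventually.of_forall fun n => by rw [hnorm]; exact ht1 _) hw hx
    have h2 := h1.norm
    simp only [hnorm] at h2
    have h3 := tendsto_nhds_unique h2 (hlim.comp hk.tendsto_atTop)
    rw [h3] at hw
    exact lt_irrefl _ hw
  refine ⟨x, ⟨mem_julia_iff.2 ⟨hxK, h.ang_subset univ ⟨u, mem_univ _, hxu⟩⟩, u, rfl, hxu⟩, ?_⟩
  refine mem_closure_of_tendsto hx (Eventually.of_forall fun n => ⟨t (k n), ⟨ht1 _, ?_⟩, rfl⟩)
  linarith [ht2 (k n), min_le_left (ρ - 1) (1 : ℝ)]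

theorem IsBottcher.isPreconnected_ray (h : IsBottcher v ψ) {u : ℂ} (hu : ‖u‖ = 1) {s : Set ℝ}
    (hs : s ⊆ Ioi 1) (hc : IsPreconnected s) :
    IsPreconnected ((fun t : ℝ => ψ (t * u)) '' s) := by
  refine hc.image _ fun t ht => ContinuousAt.continuousWithinAt ?_
  have h1 : 1 < ‖(t : ℂ) * u‖ := by
    have := hs ht
    rw [norm_mul, hu, mul_one, Complex.norm_real]
    exact lt_of_lt_of_le this (le_abs_self t)
  exact ContinuousAt.comp (f := fun t : ℝ => (t : ℂ) * u) (h.continuousAt h1) (by fun_prop)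

theorem IsTrap.exists_continuum (hT : IsTrap v ψ p E) (h : IsBottcher v ψ) {ε : ℝ} (hε : 0 ≤ ε)
    {y : ℂ} (hy : y ∈ ang ψ (nb E ε)) :
    ∃ Z ⊆ ang ψ (nb E ε), IsCompact Z ∧ IsPreconnected Z ∧ p ∈ Z ∧ y ∈ Z := by
  by_cases hyK : y ∈ filled v
  · exact ⟨imp v ψ (nb E ε), inter_subset_right, isCompact_imp (hT.isClosed_nb ε),
      hT.isPreconnected_imp_nb h hε, hT.mem_imp_nb hε,
      mem_julia_iff.2 ⟨hyK, h.ang_subset _ hy⟩, hy⟩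
  · obtain ⟨w, hw, rfl⟩ := h.exists_eq hyK
    obtain ⟨u, hu, hyu⟩ := hy
    have huw := h.eq_of_mem_gr hw hyu
    have hu1 : ‖u‖ = 1 := hT.norm_of_mem_nb hu
    have hwu : ((‖w‖ : ℝ) : ℂ) * u = w := by
      rw [huw, mul_div_cancel₀]
      exact_mod_cast (zero_lt_one.trans hw).ne'
    set S := (fun t : ℝ => ψ (t * u)) '' Ioc 1 ‖w‖ with hS
    have hgr : ∀ t : ℝ, 1 < t → 1 < ‖(t : ℂ) * u‖ ∧ (ψ (t * u), u) ∈ gr ψ := by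
      intro t ht
      have h1 : ‖(t : ℂ) * u‖ = t := by
        rw [norm_mul, hu1, mul_one, Complex.norm_real, Real.norm_of_nonneg (by linarith)]
      refine ⟨by rwa [h1], ?_⟩
      have h2 := mem_gr_of_norm (ψ := ψ) (w := (t : ℂ) * u) (by rwa [h1])
      rwa [h1, mul_div_cancel_left₀ _ (by exact_mod_cast (by linarith : t ≠ 0))] at h2
    have hsub : imp v ψ (nb E ε) ∪ S ⊆ ang ψ (nb E ε) := by
      refine union_subset inter_subset_right ?_
      rintro _ ⟨t, ht, rfl⟩
      exact ⟨u, hu, (hgr t ht.1).2⟩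
    have hbd : Bornology.IsBounded S := by
      obtain ⟨R, hR⟩ := h.exists_norm_psi_le
      have h1 : IsCompact ((fun t : ℝ => ψ (t * u)) '' Icc 2 ‖w‖) := by
        refine isCompact_Icc.image_of_continuousOn fun t ht => ContinuousAt.continuousWithinAt ?_
        exact ContinuousAt.comp (f := fun t : ℝ => (t : ℂ) * u)
          (h.continuousAt (hgr t (by linarith [ht.1])).1) (by fun_prop)
      refine (h1.isBounded.union (isBounded_closedBall (x := (0 : ℂ)) (r := R))).subset ?_
      rintro _ ⟨t, ht, rfl⟩
      rcases le_total 2 t with h2 | h2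
      · exact Or.inl ⟨t, ⟨h2, ht.2⟩, rfl⟩
      · right
        rw [mem_closedBall_zero_iff]
        refine hR _ (hgr t ht.1).1 ?_
        rw [norm_mul, hu1, mul_one, Complex.norm_real, Real.norm_of_nonneg (by linarith [ht.1])]
        linarith
    obtain ⟨x, hx, hxS⟩ := h.exists_mem_closure_ray hu1 hw
    refine ⟨closure (imp v ψ (nb E ε) ∪ S),
      closure_minimal hsub (hT.isClosed_ang_nb ε),
      ((isCompact_imp (hT.isClosed_nb ε)).isBounded.union hbd).isCompact_closure, ?_,
      subset_closure (Or.inl (hT.mem_imp_nb hε)), subset_closure (Or.inr ⟨‖w‖, ⟨hw, le_rfl⟩, ?_⟩)⟩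
    · refine IsPreconnected.closure (isPreconnected_union_of_closure
        (hT.isPreconnected_imp_nb h hε) (h.isPreconnected_ray hu1 (fun t ht => ht.1)
          isPreconnected_Ioc) (imp_mono (singleton_subset_iff.2 hu) hx) hxS)
    · simp only [hwu]

/-- External rays leave bounded components, so their angles are seen on the boundary. -/
theorem IsTrap.inter_subset_of_frontier (hT : IsTrap v ψ p E) (h : IsBottcher v ψ) {ε : ℝ}
    {B X : Set ℂ} (hBo : IsOpen B) (hB : Bornology.IsBounded B) (hX : frontier B ⊆ X)
    (hXY : X ∩ (interior (filled v))ᶜ ⊆ ang ψ (nb E ε)) :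
    B ∩ (interior (filled v))ᶜ ⊆ ang ψ (nb E ε) := by
  have hU : B ∩ (filled v)ᶜ ⊆ ang ψ (nb E ε) := by
    rintro z ⟨hzB, hzK⟩
    obtain ⟨w, hw, rfl⟩ := h.exists_eq hzK
    have hw0 := ne_zero_of_one_lt hw
    set u := w / (‖w‖ : ℂ) with hu
    have hu1 : ‖u‖ = 1 := dir_norm hw0
    have hwu : ((‖w‖ : ℝ) : ℂ) * u = w := by
      rw [hu, mul_div_cancel₀]
      exact_mod_cast (zero_lt_one.trans hw).ne'
    set S := (fun t : ℝ => ψ (t * u)) '' Ici ‖w‖ with hS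
    have hSpre : IsPreconnected S :=
      h.isPreconnected_ray hu1 (fun t ht => lt_of_lt_of_le hw ht) isPreconnected_Ici
    have hmemS : ψ w ∈ S := ⟨‖w‖, self_mem_Ici, by simp only [hwu]⟩
    have hnb : ¬ S ⊆ B := by
      intro hSB
      have h1 : Tendsto (fun t : ℝ => (t : ℂ) * u) atTop (Bornology.cobounded ℂ) := by
        rw [← tendsto_norm_atTop_iff_cobounded]
        simp only [norm_mul, hu1, mul_one, Complex.norm_real]
        exact tendsto_norm_atTop_atTop
      have h2 := h.tendsto.comp h1
      have h3 := h2.eventually (hB.subset hSB : Bornology.IsBounded S)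
      obtain ⟨t, ht, ht'⟩ := (h3.and (eventually_ge_atTop ‖w‖)).exists
      exact ht ⟨t, ht', rfl⟩
    have h4 : (S ∩ frontier B).Nonempty := by
      by_contra hne
      rw [not_nonempty_iff_eq_empty, ← disjoint_iff_inter_eq_empty] at hne
      refine hnb (hSpre.subset_of_closure_inter_subset hBo ⟨_, hmemS, hzB⟩ ?_)
      rintro x ⟨hx1, hx2⟩
      by_contra hxB
      exact disjoint_left.1 hne hx2 (by rw [frontier, hBo.interior_eq]; exact ⟨hx1, hxB⟩)
    obtain ⟨x, ⟨t, ht, rfl⟩, hx⟩ := h4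
    have ht1 : 1 < t := lt_of_lt_of_le hw ht
    have hn : ‖(t : ℂ) * u‖ = t := by
      rw [norm_mul, hu1, mul_one, Complex.norm_real, Real.norm_of_nonneg (by linarith)]
    have ht0 : 1 < ‖(t : ℂ) * u‖ := by rwa [hn]
    obtain ⟨u', hu', hgr⟩ := hXY ⟨hX hx, fun hi => h.notMem ht0 (interior_subset hi)⟩
    have h5 := h.eq_of_mem_gr ht0 hgr
    rw [hn, mul_div_cancel_left₀ _ (by exact_mod_cast (by linarith : t ≠ 0))] at h5
    exact ⟨u', hu', by rw [h5, hu]; exact mem_gr_of_norm hw⟩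
  rintro z ⟨hzB, hz⟩
  rw [← closure_compl_filled] at hz
  have h6 : z ∈ closure (B ∩ (filled v)ᶜ) := by
    rw [mem_closure_iff_nhds] at hz ⊢
    intro t ht
    obtain ⟨x, hx, hx'⟩ := hz _ (inter_mem ht (hBo.mem_nhds hzB))
    exact ⟨x, hx.1, hx.2, hx'⟩
  exact (closure_minimal hU (hT.isClosed_ang_nb ε)) h6

end CremerJulia

namespace CremerJulia
open Set Filter Topology Metric

variable {v p : ℂ} {ψ : ℂ → ℂ} {E : Set ℂ}

/-- The critical value `v` lies in a bounded region `B` cut off by a connected set `γ`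
through `p`, which `n` iterates of the map send close to `p`, and by points of the external
region with angle close to the trap. -/
structure IsCapture (v : ℂ) (ψ : ℂ → ℂ) (p : ℂ) (E : Set ℂ) (ε r : ℝ) (n : ℕ) (γ B : Set ℂ) :
    Prop where
  conn : IsPreconnected γ
  mem : p ∈ γ
  sub : γ ∩ (interior (filled v))ᶜ ⊆ ang ψ (nb E ε)
  maps : ∀ z ∈ γ, dist ((quad v)^[n] z) p < r
  isOpen : IsOpen B
  bounded : Bornology.IsBounded B
  frontier_sub : frontier B ⊆ γ ∪ ang ψ (nb E ε)
  inter_sub : B ∩ (interior (filled v))ᶜ ⊆ ang ψ (nb E ε)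
  value_mem : v ∈ B ∪ γ

theorem quad_mem_ang {T : Set ℂ} (h : IsBottcher v ψ) (hT : ∀ u ∈ T, u ^ 2 ∈ T) {z : ℂ}
    (hz : z ∈ ang ψ T) : quad v z ∈ ang ψ T := by
  obtain ⟨u, hu, hzu⟩ := hz
  exact ⟨u ^ 2, hT u hu, h.gr_quad hzu⟩

theorem eventually_mem_nb {a : ℝ} (ha : 0 < a) {e : ℂ} (he : e ∈ E) (he1 : ‖e‖ = 1) :
    ∀ᶠ u in 𝓝 e, ‖u‖ = 1 → u ∈ nb E a := by
  have he0 : e ≠ 0 := by rw [← norm_ne_zero_iff, he1]; exact one_ne_zero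
  have h1 : Tendsto (fun u : ℂ => Complex.arg (u / e)) (𝓝 e) (𝓝 0) := by
    have h2 : ContinuousAt (fun u : ℂ => Complex.arg (u / e)) e := by
      refine ContinuousAt.comp (f := fun u : ℂ => u / e) (Complex.continuousAt_arg ?_) (by fun_prop)
      rw [div_self he0]
      exact Complex.one_mem_slitPlane
    simpa [ContinuousAt, div_self he0] using h2
  have h3 := h1.abs
  rw [abs_zero] at h3
  filter_upwards [h3.eventually (gt_mem_nhds ha)] with u hu hu1
  refine mem_nb.2 ⟨e, he, Complex.arg (u / e), hu.le, ?_⟩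
  have h4 : ‖u / e‖ = 1 := by rw [norm_div, hu1, he1, div_one]
  have h5 := Complex.norm_mul_exp_arg_mul_I (u / e)
  rw [h4, Complex.ofReal_one, one_mul] at h5
  rw [h5, mul_div_cancel₀ _ he0]

namespace IsTrap

theorem exists_ball_inter_subset (hT : IsTrap v ψ p E) (h : IsBottcher v ψ) {ε : ℝ} (hε : 0 < ε)
    {x : ℂ} (hx : x ∈ imp v ψ E) :
    ∃ r > 0, ball x r ∩ (interior (filled v))ᶜ ⊆ ang ψ (nb E ε) := by
  by_contra! hcon
  have h1 : ∀ n : ℕ, ∃ z, z ∈ ball x (1 / (n + 1)) ∧ ∃ u, (z, u) ∈ gr ψ ∧ u ∉ nb E ε := by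
    intro n
    obtain ⟨z, hz, hz'⟩ := not_subset.1 (hcon (1 / (n + 1)) (by positivity))
    obtain ⟨u, hu⟩ := h.exists_angle hz.2
    exact ⟨z, hz.1, u, hu, fun hn => hz' ⟨u, hn, hu⟩⟩
  choose z hz u hu hun using h1
  obtain ⟨w, -, k, hk, hw⟩ := (isCompact_sphere (0 : ℂ) 1).tendsto_subseq (x := u)
    fun n => by simpa using norm_eq_one_of_mem_gr (hu n)
  have hzx : Tendsto z atTop (𝓝 x) := tendsto_iff_dist_tendsto_zero.2
    (squeeze_zero (fun _ => dist_nonneg) (fun n => (hz n).le) tendsto_one_div_succ)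
  have hxw : (x, w) ∈ gr ψ := isClosed_closure.mem_of_tendsto
    ((hzx.comp hk.tendsto_atTop).prodMk_nhds hw) (Eventually.of_forall fun n => hu (k n))
  have hwE := hT.sat x w hx hxw
  obtain ⟨n, hn⟩ := (hw.eventually (eventually_mem_nb hε hwE (hT.norm w hwE))).exists
  exact hun _ (hn (norm_eq_one_of_mem_gr (hu _)))

/-- If the next inverse branch leaves the region near the trap, the critical value is
cut off. -/
theorem exists_region (hT : IsTrap v ψ p E) (h : IsBottcher v ψ) (hfix : quad v p = p) {ε r : ℝ}
    (hε : 0 ≤ ε) (hr : 0 < r) (hneg : ∀ z ∈ ang ψ (nb E ε), -z ∉ ang ψ (nb E ε)) {f g : ℂ → ℂ}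
    (hf : ContinuousOn f (ball p r)) (hfp : f p = p)
    (hfY : f '' ball p r ∩ (interior (filled v))ᶜ ⊆ ang ψ (nb E ε))
    (hfv : ∀ z ∈ ball p r, f z ≠ v) (hg : ContinuousOn g (ball p r)) (hgp : g p = p)
    (hgf : ∀ z ∈ ball p r, quad v (g z) = f z) {x : ℂ} (hx : x ∈ ball p r)
    (hxY : g x ∉ interior (filled v)) (hxN : g x ∉ ang ψ (nb E ε)) :
    ∃ B, IsOpen B ∧ Bornology.IsBounded B ∧ v ∈ B ∧
      frontier B ⊆ f '' segment ℝ p x ∪ ang ψ (nb E ε) ∧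
      B ∩ (interior (filled v))ᶜ ⊆ ang ψ (nb E ε) := by
  have hp : p ∈ ball p r := mem_ball_self hr
  have hseg : segment ℝ p x ⊆ ball p r := (convex_ball p r).segment_subset hp hx
  have hxf : f x ∈ ang ψ (nb E ε) := by
    refine hfY ⟨mem_image_of_mem f hx, ?_⟩
    rw [← hgf x hx]
    exact fun hi => hxY (quad_mem_interior_iff.1 hi)
  obtain ⟨Z, hZY, hZc, hZpre, hpZ, hxZ⟩ := hT.exists_continuum h hε hxf
  set γ := f '' segment ℝ p x with hγ
  have hsegc : IsPreconnected (segment ℝ p x) := (convex_segment p x).isPreconnected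
  have hsegk : IsCompact (segment ℝ p x) := by
    rw [segment_eq_image_lineMap]
    exact isCompact_Icc.image AffineMap.lineMap_continuous
  have hγc : IsCompact γ := hsegk.image_of_continuousOn (hf.mono hseg)
  set X := γ ∪ Z with hX
  have hXc : IsCompact X := hγc.union hZc
  have hvX : v ∉ X := by
    rintro (⟨z, hz, hzv⟩ | hv)
    · exact hfv z (hseg hz) hzv
    · exact hT.quad_zero_notMem h hε hneg (hZY hv)
  have hXo : IsOpen Xᶜ := hXc.isClosed.isOpen_compl
  set B := connectedComponentIn Xᶜ v with hB
  have hvB : v ∈ B := mem_connectedComponentIn hvX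
  have hfr : frontier B ⊆ X := by
    simpa using frontier_connectedComponentIn_subset hXo v
  have hbd : Bornology.IsBounded B := by
    by_contra hunb
    obtain ⟨l, hl, hle⟩ := hasLog_sub_of_unbounded hXc isPreconnected_connectedComponentIn
      (disjoint_left.2 fun z hz => connectedComponentIn_subset _ _ hz) hunb hvB
    have key : ∀ s : ℂ → ℂ, ContinuousOn s X → (∀ z ∈ X, s z ^ 2 = z - v) → s p = p → False := by
      intro s hs hs2 hsp
      have hq : ∀ z ∈ X, quad v (s z) = z := fun z hz => by simp [quad, hs2 z hz]
      have hsZ : s '' Z ⊆ ang ψ (nb E ε) := by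
        have hpre : IsPreconnected (s '' Z) := hZpre.image _ (hs.mono subset_union_right)
        by_contra hns
        obtain ⟨y, hy, hy'⟩ := not_subset.1 hns
        have hcov : s '' Z ⊆ ang ψ (nb E ε) ∪ Neg.neg ⁻¹' ang ψ (nb E ε) := by
          rintro _ ⟨z, hz, rfl⟩
          refine hT.mem_ang_or_neg h hε ?_
          rw [hq z (Or.inr hz)]
          exact hZY hz
        obtain ⟨z, -, hz1, hz2⟩ := isPreconnected_closed_iff.1 hpre _ _ (hT.isClosed_ang_nb ε)
          ((hT.isClosed_ang_nb ε).preimage continuous_neg) hcov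
          ⟨p, ⟨p, hpZ, hsp⟩, hT.mem_ang_nb hε⟩ ⟨y, hy, (hcov hy).resolve_left hy'⟩
        exact hneg z hz1 hz2
      have heq : EqOn (s ∘ f) g (segment ℝ p x) := by
        refine hsegc.eq_of_sq_eq (hs.comp (hf.mono hseg) fun z hz => Or.inl ⟨z, hz, rfl⟩)
          (hg.mono hseg) ?_ ?_ (left_mem_segment ℝ p x) ?_
        · intro z hz
          have h1 := hgf z (hseg hz)
          simp only [Pi.pow_apply, Function.comp_apply]
          rw [hs2 _ (Or.inl ⟨z, hz, rfl⟩), ← h1]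
          simp [quad]
        · intro z hz h0
          have h1 := hgf z (hseg hz)
          rw [h0] at h1
          exact hfv z (hseg hz) (by rw [← h1]; simp [quad])
        · simp [hfp, hsp, hgp]
      have h2 := heq (right_mem_segment ℝ p x)
      rw [← h2] at hxN
      exact hxN (hsZ ⟨f x, hxZ, rfl⟩)
    have hs : ContinuousOn (fun z => Complex.exp (l z / 2)) X :=
      Complex.continuous_exp.comp_continuousOn (hl.div_const 2)
    have hs2 : ∀ z ∈ X, Complex.exp (l z / 2) ^ 2 = z - v := fun z hz => by
      have h1 : Complex.exp (l z) = z - v := hle z hz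
      rw [← Complex.exp_nat_mul, ← h1]
      congr 1
      push_cast
      ring
    have hpX : p ∈ X := Or.inr hpZ
    have hps : Complex.exp (l p / 2) ^ 2 = p ^ 2 := by
      rw [hs2 p hpX]
      nth_rewrite 1 [← hfix]
      simp [quad]
    rcases sq_eq_sq_iff_eq_or_eq_neg.1 hps with h1 | h1
    · exact key _ hs hs2 h1
    · refine key (fun z => -Complex.exp (l z / 2)) hs.neg (fun z hz => ?_) ?_
      · simpa only [neg_sq] using hs2 z hz
      · simp only [h1, neg_neg]
  have hfr' : frontier B ⊆ γ ∪ ang ψ (nb E ε) :=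
    hfr.trans (union_subset_union_right _ hZY)
  refine ⟨B, hXo.connectedComponentIn, hbd, hvB, hfr',
    hT.inter_subset_of_frontier h hXo.connectedComponentIn hbd hfr' ?_⟩
  rintro z ⟨⟨y, hy, rfl⟩ | hz, hzY⟩
  · exact hfY ⟨⟨y, hseg hy, rfl⟩, hzY⟩
  · exact hz

theorem exists_isCapture (hT : IsTrap v ψ p E) (h : IsBottcher v ψ) (hfix : quad v p = p)
    (hlam : ‖2 * p‖ = 1) {ε : ℝ} (hε : 0 < ε)
    (hneg : ∀ z ∈ ang ψ (nb E ε), -z ∉ ang ψ (nb E ε)) {r : ℝ} (hr : 0 < r) :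
    ∃ n γ B, IsCapture v ψ p E ε r n γ B := by
  by_contra! hcon
  obtain ⟨r₀, hr₀, hbase⟩ := hT.exists_ball_inter_subset h hε hT.mem
  set r' := min r r₀ with hr'
  have hr'0 : 0 < r' := lt_min hr hr₀
  have hp : p ∈ ball p r' := mem_ball_self hr'0
  have hind : ∀ n : ℕ, ∃ f : ℂ → ℂ, DifferentiableOn ℂ f (ball p r') ∧ f p = p ∧
      (∀ z ∈ ball p r', (quad v)^[n] (f z) = z) ∧
      f '' ball p r' ∩ (interior (filled v))ᶜ ⊆ ang ψ (nb E ε) := by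
    intro n
    induction n with
    | zero =>
      refine ⟨id, differentiableOn_id, rfl, fun z _ => rfl, ?_⟩
      rw [image_id]
      exact (inter_subset_inter_left _ (ball_subset_ball (min_le_right _ _))).trans hbase
    | succ n ih =>
      obtain ⟨f, hf, hfp, hfn, hfY⟩ := ih
      have hγ : ∀ x ∈ ball p r', ∀ B : Set ℂ, IsOpen B → Bornology.IsBounded B →
          v ∈ B ∪ f '' segment ℝ p x →
          frontier B ⊆ f '' segment ℝ p x ∪ ang ψ (nb E ε) →
          B ∩ (interior (filled v))ᶜ ⊆ ang ψ (nb E ε) → False := by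
        intro x hx B hBo hBb hv hfr hB
        have hseg : segment ℝ p x ⊆ ball p r' := (convex_ball p r').segment_subset hp hx
        refine hcon n (f '' segment ℝ p x) B ⟨?_, ⟨p, left_mem_segment ℝ p x, hfp⟩, ?_, ?_,
          hBo, hBb, hfr, hB, hv⟩
        · exact (convex_segment p x).isPreconnected.image _ (hf.continuousOn.mono hseg)
        · exact (inter_subset_inter_left _ (image_mono hseg)).trans hfY
        · rintro _ ⟨z, hz, rfl⟩
          rw [hfn z (hseg hz)]
          exact lt_of_lt_of_le (hseg hz) (min_le_left _ _)
      have hfv : ∀ z ∈ ball p r', f z ≠ v := by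
        intro z hz hzv
        refine hγ z hz ∅ isOpen_empty Bornology.isBounded_empty
          (Or.inr ⟨z, right_mem_segment ℝ p z, hzv⟩) ?_ ?_ <;> simp
      obtain ⟨g, hg, hg2, hgp⟩ := exists_holo_sqrt (convex_ball p r') isOpen_ball
        (hf.sub_const v) (fun z hz => sub_ne_zero.2 (hfv z hz)) hp (w := p) (by
          rw [hfp]; nth_rewrite 2 [← hfix]; simp [quad])
      have hgf : ∀ z ∈ ball p r', quad v (g z) = f z := fun z hz => by simp [quad, hg2 z hz]
      refine ⟨g, hg, hgp, fun z hz => ?_, ?_⟩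
      · rw [Function.iterate_succ_apply, hgf z hz, hfn z hz]
      · rintro _ ⟨⟨x, hx, rfl⟩, hxY⟩
        by_contra hxN
        obtain ⟨B, hBo, hBb, hvB, hfr, hBY⟩ := hT.exists_region h hfix hε.le hr'0 hneg
          hf.continuousOn hfp hfY hfv hg.continuousOn hgp hgf hx hxY hxN
        exact hγ x hx B hBo hBb (Or.inl hvB) hfr hBY
  choose f hf hfp hfn _ using hind
  set M := ‖v‖ + 2 + (‖p‖ + r') with hM
  have hM0 : 0 < M := by positivity
  have hball : ∀ z ∈ ball p r', ‖z‖ ≤ ‖p‖ + r' := fun z hz => by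
    have := mem_ball_iff_norm.1 hz
    linarith [norm_le_norm_add_norm_sub' z p, norm_sub_rev z p]
  have hfb : ∀ n, ∀ z ∈ ball p r', ‖f n z‖ ≤ M := by
    intro n z hz
    by_contra! hlt
    have h1 := two_pow_mul_norm_le (v := v) (z := f n z) (by linarith [norm_nonneg p]) n
    rw [hfn n z hz] at h1
    have h2 : ‖f n z‖ ≤ 2 ^ n * ‖f n z‖ :=
      le_mul_of_one_le_left (norm_nonneg _) (one_le_pow₀ one_le_two)
    linarith [hball z hz, norm_nonneg v]
  have hfd : ∀ n, ‖deriv (f n) p‖ = 1 := by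
    intro n
    have h1 : HasDerivAt (f n) (deriv (f n) p) p :=
      ((hf n).differentiableAt (isOpen_ball.mem_nhds hp)).hasDerivAt
    have h2 : HasDerivAt ((quad v)^[n] ∘ f n) ((2 * p) ^ n * deriv (f n) p) p := by
      refine HasDerivAt.comp p ?_ h1
      rw [hfp]
      exact hasDerivAt_iterate_quad hfix n
    have h3 : (quad v)^[n] ∘ f n =ᶠ[𝓝 p] id := by
      filter_upwards [isOpen_ball.mem_nhds hp] with z hz using hfn n z hz
    have h5 : (2 * p) ^ n * deriv (f n) p = 1 :=
      h2.unique ((hasDerivAt_id p).congr_of_eventuallyEq h3)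
    have h4 : ‖(2 * p) ^ n * deriv (f n) p‖ = ‖(1 : ℂ)‖ := by rw [h5]
    rwa [norm_mul, norm_pow, hlam, one_pow, one_mul, norm_one] at h4
  set L := M / (r' / 2) with hL
  have hderiv : ∀ n, ∀ z ∈ ball p (r' / 2), ‖deriv (f n) z‖ ≤ L * ‖deriv (f n) p‖ := by
    intro n z hz
    have hs : closedBall z (r' / 4) ⊆ ball p r' := fun y hy => by
      rw [mem_closedBall] at hy; rw [mem_ball] at hz ⊢
      linarith [dist_triangle y z p]
    have hcb : ball z (r' / 2) ⊆ ball p r' := fun y hy => by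
      rw [mem_ball] at hy hz ⊢
      linarith [dist_triangle y z p]
    rw [hfd, mul_one]
    have hlim : ∀ s < r' / 2, 0 < s → ‖deriv (f n) z‖ * s ≤ M := by
      intro s hs hs0
      have hsub : closedBall z s ⊆ ball p r' := (closedBall_subset_ball hs).trans hcb
      rw [← le_div_iff₀ hs0]
      exact Complex.norm_deriv_le_of_forall_mem_sphere_norm_le hs0
        ((hf n).diffContOnCl_ball hsub) fun y hy => hfb n y (hsub (sphere_subset_closedBall hy))
    rw [hL, le_div_iff₀ (by positivity)]
    have ht : Tendsto (fun s => ‖deriv (f n) z‖ * s) (𝓝[<] (r' / 2))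
        (𝓝 (‖deriv (f n) z‖ * (r' / 2))) :=
      ((continuous_const.mul continuous_id).tendsto _).mono_left nhdsWithin_le_nhds
    refine le_of_tendsto ht ?_
    filter_upwards [self_mem_nhdsWithin,
      mem_nhdsWithin_of_mem_nhds (lt_mem_nhds (half_pos hr'0))] with s hs hs0 using hlim s hs hs0
  have hL0 : 0 ≤ L := by positivity
  have hpint : p ∈ interior (filled v) := by
    rw [mem_interior]
    refine ⟨ball p (r' / 2 / (8 * (L + 1))), fun z hz => ?_, isOpen_ball,
      mem_ball_self (by positivity)⟩
    have hz' : ∀ n, ‖(quad v)^[n] z‖ ≤ ‖p‖ + r' := by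
      intro n
      have h1 := ball_subset_image_of_deriv_le (f := f n) (half_pos hr'0) hL0
        ((hf n).mono (ball_subset_ball (by linarith)))
        (by rw [← norm_ne_zero_iff, hfd]; exact one_ne_zero) (hderiv n)
      rw [hfd, mul_one, hfp] at h1
      obtain ⟨y, hy, rfl⟩ := h1 hz
      have hy' : y ∈ ball p r' := ball_subset_ball (by linarith) hy
      rw [hfn n y hy']
      exact hball y hy'
    rw [mem_filled_iff_isBounded]
    refine (isBounded_iff_forall_norm_le.2 ⟨‖p‖ + r', ?_⟩)
    rintro _ ⟨n, rfl⟩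
    exact hz' n
  exact (mem_julia_iff.1 hT.mem.1).2 hpint

end IsTrap

end CremerJulia

namespace CremerJulia
open Set Filter Topology Metric

variable {v p : ℂ} {ψ : ℂ → ℂ} {E : Set ℂ}

theorem HasLog.union {f : ℂ → ℂ} {X Y : Set ℂ} (hX : IsClosed X) (hY : IsClosed Y)
    (hXY : Disjoint X Y) (hfX : HasLog f X) (hfY : HasLog f Y) : HasLog f (X ∪ Y) := by
  classical
  obtain ⟨l, hl, hle⟩ := hfX
  obtain ⟨m, hm, hme⟩ := hfY
  have h1 : EqOn (fun z => if z ∈ X then l z else m z) l X := fun z hz => if_pos hz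
  have h2 : EqOn (fun z => if z ∈ X then l z else m z) m Y :=
    fun z hz => if_neg fun h => disjoint_left.1 hXY h hz
  refine ⟨fun z => if z ∈ X then l z else m z,
    (hl.congr h1).union_of_isClosed (hm.congr h2) hX hY, ?_⟩
  rintro z (hz | hz)
  · rw [h1 hz]; exact hle z hz
  · rw [h2 hz]; exact hme z hz

/-- The component of the interior of the filled Julia set containing a given point. -/
def fatou (v z : ℂ) : Set ℂ := connectedComponentIn (interior (filled v)) z

theorem isOpen_fatou (v z : ℂ) : IsOpen (fatou v z) := isOpen_interior.connectedComponentIn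

theorem isPreconnected_fatou (v z : ℂ) : IsPreconnected (fatou v z) :=
  isPreconnected_connectedComponentIn

theorem fatou_subset (v z : ℂ) : fatou v z ⊆ interior (filled v) := connectedComponentIn_subset _ _

theorem mem_fatou {z : ℂ} (hz : z ∈ interior (filled v)) : z ∈ fatou v z :=
  mem_connectedComponentIn hz

theorem isBounded_fatou (v z : ℂ) : Bornology.IsBounded (fatou v z) :=
  (isCompact_filled v).isBounded.subset ((fatou_subset v z).trans interior_subset)

theorem frontier_fatou_subset (v z : ℂ) : frontier (fatou v z) ⊆ julia v := fun _ hx =>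
  mem_julia_iff.2 ⟨closure_minimal ((fatou_subset v z).trans interior_subset) (isClosed_filled v)
    (frontier_subset_closure hx), frontier_connectedComponentIn_subset isOpen_interior z hx⟩

theorem frontier_nonempty_of_isBounded {B : Set ℂ} (hB : B.Nonempty)
    (hb : Bornology.IsBounded B) : (frontier B).Nonempty := by
  refine nonempty_frontier_iff.2 ⟨hB, ?_⟩
  rintro rfl
  exact NormedSpace.unbounded_univ ℂ ℂ hb

theorem inter_frontier_nonempty {S B : Set ℂ} (hS : IsPreconnected S) (h1 : (S ∩ B).Nonempty)
    (h2 : (S ∩ Bᶜ).Nonempty) : (S ∩ frontier B).Nonempty := by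
  by_contra hcon
  have hno : ∀ x ∈ S, x ∈ closure B → x ∈ interior B := fun x hx hxc => by
    by_contra hi
    exact hcon ⟨x, hx, hxc, hi⟩
  obtain ⟨x, hx, hxB⟩ := h1
  obtain ⟨y, hy, hyB⟩ := h2
  obtain ⟨z, -, hz1, hz2⟩ := hS (interior B) (closure B)ᶜ isOpen_interior
    isClosed_closure.isOpen_compl (fun z hz => (em (z ∈ closure B)).imp (hno z hz) id)
    ⟨x, hx, hno x hx (subset_closure hxB)⟩ ⟨y, hy, fun hc => hyB (interior_subset (hno y hy hc))⟩
  exact hz2 (subset_closure (interior_subset hz1))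

theorem quad_mem_fatou {x z : ℂ} (hx : x ∈ fatou v z) : quad v x ∈ fatou v (quad v z) := by
  have hz : z ∈ interior (filled v) := by
    by_contra hz
    rw [fatou, connectedComponentIn_eq_empty hz] at hx
    exact hx
  have hsub : quad v '' fatou v z ⊆ fatou v (quad v z) := by
    refine ((isPreconnected_fatou v z).image _
      (continuous_quad v).continuousOn).subset_connectedComponentIn ⟨z, mem_fatou hz, rfl⟩ ?_
    rintro _ ⟨y, hy, rfl⟩
    exact quad_mem_interior_iff.2 (fatou_subset v z hy)
  exact hsub ⟨x, hx, rfl⟩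

theorem quad_mem_frontier_fatou {x z : ℂ} (hx : x ∈ frontier (fatou v z)) :
    quad v x ∈ frontier (fatou v (quad v z)) := by
  rw [(isOpen_fatou _ _).frontier_eq]
  refine ⟨map_mem_closure (continuous_quad v) (frontier_subset_closure hx)
    fun y hy => quad_mem_fatou hy, fun hi => ?_⟩
  exact (mem_julia_iff.1 (quad_mem_julia_iff.2 (frontier_fatou_subset v z hx))).2
    (fatou_subset _ _ hi)

theorem iterate_mem_frontier_fatou {x z : ℂ} (hx : x ∈ frontier (fatou v z)) (n : ℕ) :
    (quad v)^[n] x ∈ frontier (fatou v ((quad v)^[n] z)) := by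
  induction n with
  | zero => exact hx
  | succ n ih =>
    simp only [Function.iterate_succ_apply']
    exact quad_mem_frontier_fatou ih

theorem neg_mem_fatou_zero {x : ℂ} (hx : x ∈ fatou v 0) : -x ∈ fatou v 0 := by
  have hz : (0 : ℂ) ∈ interior (filled v) := by
    by_contra hz
    rw [fatou, connectedComponentIn_eq_empty hz] at hx
    exact hx
  have hsub : Neg.neg '' fatou v 0 ⊆ fatou v 0 := by
    refine ((isPreconnected_fatou v 0).image _
      continuous_neg.continuousOn).subset_connectedComponentIn ⟨0, mem_fatou hz, neg_zero⟩ ?_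
    rintro _ ⟨y, hy, rfl⟩
    exact neg_mem_interior_iff.2 (fatou_subset v 0 hy)
  exact hsub ⟨x, hx, rfl⟩

theorem neg_mem_frontier_fatou_zero {x : ℂ} (hx : x ∈ frontier (fatou v 0)) :
    -x ∈ frontier (fatou v 0) := by
  rw [(isOpen_fatou _ _).frontier_eq] at hx ⊢
  exact ⟨map_mem_closure continuous_neg hx.1 fun y hy => neg_mem_fatou_zero hy,
    fun hi => hx.2 (by simpa using neg_mem_fatou_zero hi)⟩

/-- The frontier of a component of the interior is not split by disjoint closed sets. -/
theorem frontier_fatou_subset_or {z : ℂ} {Q R : Set ℂ} (hQ : IsClosed Q) (hR : IsClosed R)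
    (hQJ : Q ⊆ julia v) (hRJ : R ⊆ julia v) (hQR : Disjoint Q R)
    (hsub : frontier (fatou v z) ⊆ Q ∪ R) :
    frontier (fatou v z) ⊆ Q ∨ frontier (fatou v z) ⊆ R := by
  rcases (fatou v z).eq_empty_or_nonempty with he | ⟨a, ha⟩
  · left; simp [he]
  have key : ∀ X : Set ℂ, IsClosed X → X ⊆ julia v → ¬ frontier (fatou v z) ⊆ X →
      HasLog (fun z => z - a) X := by
    intro X hX hXJ hnot
    obtain ⟨b, hb, hbX⟩ := not_subset.1 hnot
    obtain ⟨δ, hδ, hball⟩ := Metric.isOpen_iff.1 hX.isOpen_compl b hbX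
    have hbJ := frontier_fatou_subset v z hb
    obtain ⟨c, hcK, hcb⟩ := Metric.mem_closure_iff.1
      (frontier_subset_closure (by rwa [frontier_compl] : b ∈ frontier (filled v)ᶜ)) δ hδ
    obtain ⟨w, hw, hwb⟩ := Metric.mem_closure_iff.1 (frontier_subset_closure hb) δ hδ
    have hbp : IsPreconnected (ball b δ) := (convex_ball b δ).isPreconnected
    have h1 : IsPreconnected (fatou v z ∪ ball b δ) :=
      (isPreconnected_fatou v z).union w hw (mem_ball'.2 hwb) hbp
    have h2 : IsPreconnected ((fatou v z ∪ ball b δ) ∪ (filled v)ᶜ) :=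
      h1.union c (Or.inr (mem_ball'.2 hcb)) hcK (isConnected_compl_filled v).isPreconnected
    refine hasLog_sub_of_unbounded ((isCompact_julia v).of_isClosed_subset hX hXJ) h2 ?_
      (fun hbd => not_isBounded_compl_filled v (hbd.subset subset_union_right))
      (Or.inl (Or.inl ha))
    rw [disjoint_left]
    rintro x ((hx | hx) | hx) hxX
    · exact (mem_julia_iff.1 (hXJ hxX)).2 (fatou_subset v z hx)
    · exact hball hx hxX
    · exact hx (julia_subset_filled v (hXJ hxX))
  by_contra! hcon
  refine not_hasLog_frontier (isBounded_fatou v z) ha (u := fun _ => 1) continuousOn_const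
    (fun _ _ => one_ne_zero) ?_
  simp only [div_one]
  exact ((key Q hQ hQJ hcon.1).union hQ hR hQR (key R hR hRJ hcon.2)).mono hsub

namespace IsCapture

variable {ε r : ℝ} {n : ℕ} {γ B : Set ℂ}

theorem value_mem_interior (hC : IsCapture v ψ p E ε r n γ B) (hT : IsTrap v ψ p E)
    (h : IsBottcher v ψ) (hε : 0 ≤ ε)
    (hneg : ∀ z ∈ ang ψ (nb E ε), -z ∉ ang ψ (nb E ε)) : v ∈ interior (filled v) := by
  by_contra hv
  refine hT.quad_zero_notMem h hε hneg ?_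
  rcases hC.value_mem with h1 | h1
  · exact hC.inter_sub ⟨h1, hv⟩
  · exact hC.sub ⟨h1, hv⟩

theorem frontier_inter_nonempty (hC : IsCapture v ψ p E ε r n γ B) (hT : IsTrap v ψ p E)
    (h : IsBottcher v ψ) (hv : v ∈ interior (filled v)) :
    (frontier (fatou v v) ∩ ang ψ (nb E ε)).Nonempty := by
  have hpW : p ∉ fatou v v := fun hp => (mem_julia_iff.1 hT.mem.1).2 (fatou_subset v v hp)
  have hfr : frontier (fatou v v) ⊆ (interior (filled v))ᶜ := fun x hx =>
    (mem_julia_iff.1 (frontier_fatou_subset v v hx)).2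
  by_cases hWγ : (fatou v v ∩ γ).Nonempty
  · obtain ⟨x, hx1, hx2⟩ := hWγ
    obtain ⟨y, hy1, hy2⟩ := inter_frontier_nonempty hC.conn ⟨x, hx2, hx1⟩ ⟨p, hC.mem, hpW⟩
    exact ⟨y, hy2, hC.sub ⟨hy1, hfr hy2⟩⟩
  · have hvW := mem_fatou hv
    have hvB : v ∈ B := hC.value_mem.resolve_right fun hvγ => hWγ ⟨v, hvW, hvγ⟩
    have hWB : fatou v v ⊆ B := by
      by_contra hns
      obtain ⟨x, hx, hxB⟩ := not_subset.1 hns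
      obtain ⟨y, hy1, hy2⟩ := inter_frontier_nonempty (isPreconnected_fatou v v)
        ⟨v, hvW, hvB⟩ ⟨x, hx, hxB⟩
      rcases hC.frontier_sub hy2 with hyγ | hyY
      · exact hWγ ⟨y, hy1, hyγ⟩
      · exact h.ang_subset _ hyY (fatou_subset v v hy1)
    obtain ⟨x, hx⟩ := frontier_nonempty_of_isBounded ⟨v, hvW⟩ (isBounded_fatou v v)
    refine ⟨x, hx, ?_⟩
    have hxB : x ∈ closure B := closure_mono hWB (frontier_subset_closure hx)
    rw [closure_eq_self_union_frontier] at hxB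
    rcases hxB with hxB | hxB
    · exact hC.inter_sub ⟨hxB, hfr hx⟩
    · rcases hC.frontier_sub hxB with hxγ | hxY
      · exact hC.sub ⟨hxγ, hfr hx⟩
      · exact hxY

end IsCapture

end CremerJulia

namespace CremerJulia
open Set Filter Topology Metric

variable {v p : ℂ} {ψ : ℂ → ℂ} {E : Set ℂ}

/-- Propagation of smallness along a connected set avoiding `Y`: holomorphic functions that are
small on the part of the frontier outside `Y`, and vacuously small somewhere. -/
theorem eventually_norm_le_of_frontier {D : ℕ → Set ℂ} {F : ℕ → ℂ → ℂ} {Y C : Set ℂ} {M : ℝ}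
    (hD : ∀ j, IsOpen (D j)) (hF : ∀ j, Differentiable ℂ (F j))
    (hM : ∀ j, ∀ z ∈ closure (D j), ‖F j z‖ ≤ M) (hY : IsClosed Y)
    (hfr : ∀ η > 0, ∀ᶠ j in atTop, ∀ z ∈ frontier (D j), z ∉ Y → ‖F j z‖ ≤ η)
    (hC : IsPreconnected C) (hCY : Disjoint C Y) {c : ℂ} (hc : c ∈ C) {δ : ℝ} (hδ : 0 < δ)
    (hcD : ∀ j, Disjoint (ball c δ) (D j)) {w : ℂ} (hw : w ∈ C) {η : ℝ} (hη : 0 < η) :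
    ∀ᶠ j in atTop, w ∈ D j → ‖F j w‖ ≤ η := by
  set S : Set ℂ := {u | ∃ δ > 0, ∀ η > 0, ∀ᶠ j in atTop, ∀ z ∈ D j, z ∈ ball u δ → ‖F j z‖ ≤ η}
    with hS
  have hSo : IsOpen S := by
    rw [Metric.isOpen_iff]
    rintro u ⟨δ, hδ, hu⟩
    refine ⟨δ / 2, half_pos hδ, fun u' hu' => ⟨δ / 2, half_pos hδ, fun η hη => ?_⟩⟩
    filter_upwards [hu η hη] with j hj z hz hzu
    refine hj z hz ?_
    rw [mem_ball] at *
    linarith [dist_triangle z u' u]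
  have hcS : c ∈ S := ⟨δ, hδ, fun η _ => Eventually.of_forall fun j z hz hzc =>
    (disjoint_left.1 (hcD j) hzc hz).elim⟩
  have hcl : closure S ∩ C ⊆ S := by
    rintro u ⟨huS, huC⟩
    obtain ⟨R, hR, hball⟩ := Metric.isOpen_iff.1 hY.isOpen_compl u (disjoint_left.1 hCY huC)
    obtain ⟨u₁, ⟨δ₁, hδ₁, hu₁⟩, hdist⟩ := Metric.mem_closure_iff.1 huS (R / 8) (by positivity)
    set r := R / 2 with hr
    have hr0 : 0 < r := half_pos hR
    have hrR : closedBall u₁ r ⊆ Yᶜ := fun x hx => hball (by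
      rw [mem_closedBall] at hx
      rw [mem_ball]
      linarith [dist_triangle x u₁ u, dist_comm u u₁])
    refine ⟨R / 8, by positivity, fun η hη => ?_⟩
    obtain ⟨m, hm⟩ : ∃ m : ℕ, (|M| + 1) * (1 / 2) ^ m < η := by
      have := (tendsto_pow_atTop_nhds_zero_of_lt_one (r := (1 / 2 : ℝ)) (by norm_num)
        (by norm_num)).const_mul (|M| + 1)
      rw [mul_zero] at this
      exact (this.eventually (gt_mem_nhds hη)).exists
    have hM0 : 0 < |M| + 1 := by positivity
    set A := (2 * r / δ₁) ^ m with hA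
    have hA0 : 0 < A := by positivity
    set η₁ := min η ((|M| + 1) / A) with hη₁
    have hη₁0 : 0 < η₁ := lt_min hη (by positivity)
    filter_upwards [hfr η₁ hη₁0, hu₁ η₁ hη₁0] with j hj1 hj2 z hz hzu
    rcases lt_or_ge (dist z u₁) δ₁ with hlt | hge
    · exact (hj2 z hz hlt).trans (min_le_left _ _)
    set O := D j ∩ {x | δ₁ / 2 < dist x u₁} ∩ ball u₁ r with hO
    have hOcl : ∀ x ∈ closure O, x ∈ closure (D j) ∧ δ₁ / 2 ≤ dist x u₁ ∧ dist x u₁ ≤ r := by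
      intro x hx
      refine ⟨closure_mono (fun y hy => hy.1.1) hx, ?_, ?_⟩
      · exact closure_minimal (t := {x | δ₁ / 2 ≤ dist x u₁})
          (fun y hy => (show δ₁ / 2 < dist y u₁ from hy.1.2).le)
          (isClosed_le continuous_const (by fun_prop)) hx
      · exact closure_minimal (t := closedBall u₁ r) (fun y hy => ball_subset_closedBall hy.2)
          isClosed_closedBall hx
    have hOo : IsOpen O := ((hD j).inter (isOpen_lt continuous_const (by fun_prop))).inter isOpen_ball
    set H : ℂ → ℂ := fun x => F j x * (r / (x - u₁)) ^ m with hH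
    have hHn : ∀ x, ‖H x‖ = ‖F j x‖ * (r / dist x u₁) ^ m := fun x => by
      simp only [hH, norm_mul, norm_pow, norm_div, Complex.norm_real, Real.norm_of_nonneg hr0.le,
        dist_eq_norm]
    have hHd : DiffContOnCl ℂ H O := by
      refine DifferentiableOn.diffContOnCl fun x hx => ?_
      have hx0 : x - u₁ ≠ 0 := by
        rw [← norm_ne_zero_iff, ← dist_eq_norm]
        linarith [(hOcl x hx).2.1]
      have h1 : DifferentiableAt ℂ (fun y : ℂ => (r : ℂ) / (y - u₁)) x :=
        (differentiableAt_const _).div (differentiableAt_id.sub_const _) hx0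
      exact ((hF j x).mul (h1.pow m)).differentiableWithinAt
    have hbound : ∀ x ∈ frontier O, ‖H x‖ ≤ |M| + 1 := by
      intro x hx
      obtain ⟨h1, h2, h3⟩ := hOcl x (frontier_subset_closure hx)
      have hd0 : 0 < dist x u₁ := by linarith
      rw [hHn]
      rcases h3.eq_or_lt with h3 | h3
      · rw [h3, div_self hr0.ne', one_pow, mul_one]
        linarith [hM j x h1, le_abs_self M]
      · have hsmall : ‖F j x‖ ≤ η₁ := by
          by_cases hxD : x ∈ D j
          · rcases h2.eq_or_lt with h2 | h2
            · exact hj2 x hxD (by rw [mem_ball, ← h2]; linarith)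
            · rw [hOo.frontier_eq] at hx
              exact (hx.2 ⟨⟨hxD, h2⟩, h3⟩).elim
          · exact hj1 x ((hD j).frontier_eq ▸ ⟨h1, hxD⟩) (hrR h3.le)
        have hpow : (r / dist x u₁) ^ m ≤ A := by
          refine pow_le_pow_left₀ (by positivity) ?_ m
          rw [div_le_div_iff₀ hd0 hδ₁]
          nlinarith
        calc ‖F j x‖ * (r / dist x u₁) ^ m ≤ η₁ * A := by gcongr
          _ ≤ (|M| + 1) / A * A := by gcongr; exact min_le_right _ _
          _ = |M| + 1 := div_mul_cancel₀ _ hA0.ne'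
    have hzr : dist z u₁ < r / 2 := by
      rw [mem_ball] at hzu
      linarith [dist_triangle z u u₁]
    have hz0 : 0 < dist z u₁ := hδ₁.trans_le hge
    have hzO : z ∈ O := ⟨⟨hz, show δ₁ / 2 < dist z u₁ by linarith⟩, by
      rw [mem_ball]; linarith⟩
    have hfin := Complex.norm_le_of_forall_mem_frontier_norm_le
      (isBounded_ball.subset inter_subset_right) hHd hbound (subset_closure hzO)
    rw [hHn] at hfin
    have h2 : (2 : ℝ) ^ m ≤ (r / dist z u₁) ^ m := by
      refine pow_le_pow_left₀ zero_le_two ?_ m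
      rw [le_div_iff₀ hz0]
      linarith
    have h3 : ‖F j z‖ * 2 ^ m ≤ |M| + 1 := (mul_le_mul_of_nonneg_left h2 (norm_nonneg _)).trans hfin
    refine le_trans ?_ hm.le
    rw [one_div, inv_pow, ← div_eq_mul_inv, le_div_iff₀ (by positivity)]
    exact h3
  have hsub := hC.subset_of_closure_inter_subset hSo ⟨c, hc, hcS⟩ hcl
  obtain ⟨δ', hδ', hw'⟩ := hsub hw
  filter_upwards [hw' η hη] with j hj hwj using hj w hwj (mem_ball_self hδ')

namespace IsTrap

theorem mem_ang_of_tendsto (hT : IsTrap v ψ p E) {a : ℕ → ℝ} {x : ℕ → ℂ} {y : ℂ}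
    (ha : Tendsto a atTop (𝓝 0)) (hx : ∀ n, x n ∈ ang ψ (nb E (a n)))
    (hlim : Tendsto x atTop (𝓝 y)) : y ∈ ang ψ E := by
  choose u hu hxu using hx
  obtain ⟨w, -, k, hk, hw⟩ := (isCompact_sphere (0 : ℂ) 1).tendsto_subseq (x := u)
    fun n => by simpa using norm_eq_one_of_mem_gr (hxu n)
  exact ⟨w, mem_of_tendsto_nb hT.closed hT.norm (ha.comp hk.tendsto_atTop) (fun n => hu (k n)) hw,
    isClosed_closure.mem_of_tendsto ((hlim.comp hk.tendsto_atTop).prodMk_nhds hw)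
      (Eventually.of_forall fun n => hxu (k n))⟩

theorem exists_notMem_ang_nb (hT : IsTrap v ψ p E) {x : ℂ} (hx : x ∉ ang ψ E) :
    ∃ ε > 0, x ∉ ang ψ (nb E ε) := by
  by_contra! hcon
  exact hx (hT.mem_ang_of_tendsto (a := fun n : ℕ => 1 / ((n : ℝ) + 1)) (x := fun _ => x)
    tendsto_one_div_succ (fun n => hcon _ (by positivity)) tendsto_const_nhds)

theorem neg_notMem_imp (hT : IsTrap v ψ p E) (h : IsBottcher v ψ) {x : ℂ}
    (hx : x ∈ imp v ψ E) : -x ∉ imp v ψ E := by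
  intro hx'
  obtain ⟨u, hu, hxu⟩ := hx.2
  exact hT.neg u hu (hT.sat _ _ hx' (h.gr_neg hxu))

theorem iterate_mem_imp (hT : IsTrap v ψ p E) (h : IsBottcher v ψ) {x : ℂ}
    (hx : x ∈ imp v ψ E) (n : ℕ) : (quad v)^[n] x ∈ imp v ψ E := by
  induction n with
  | zero => exact hx
  | succ n ih =>
    rw [Function.iterate_succ_apply']
    exact ⟨quad_mem_julia_iff.2 ih.1, quad_mem_ang h hT.sq ih.2⟩

theorem mem_imp_or_neg (hT : IsTrap v ψ p E) (h : IsBottcher v ψ) {x : ℂ}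
    (hx : quad v x ∈ imp v ψ E) : x ∈ imp v ψ E ∨ -x ∈ imp v ψ E := by
  have hJ : x ∈ julia v := quad_mem_julia_iff.1 hx.1
  obtain ⟨u, hu, hxu⟩ := hx.2
  obtain ⟨w, rfl, hw⟩ := h.gr_lift hxu
  obtain ⟨e, he, hew⟩ := hT.root _ hu
  rcases sq_eq_sq_iff_eq_or_eq_neg.1 hew with rfl | rfl
  · exact Or.inl ⟨hJ, e, he, hw⟩
  · exact Or.inr ⟨neg_mem_julia_iff.2 hJ, -w, he, h.gr_neg hw⟩

theorem value_mem_interior (hT : IsTrap v ψ p E) (h : IsBottcher v ψ) (hfix : quad v p = p)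
    (hlam : ‖2 * p‖ = 1) : v ∈ interior (filled v) := by
  obtain ⟨ε, hε, hneg⟩ := hT.exists_neg_notMem_ang h
  obtain ⟨n, γ, B, hC⟩ := hT.exists_isCapture h hfix hlam hε hneg one_pos
  exact hC.value_mem_interior hT h hε.le hneg

theorem iterate_value_mem_interior (hT : IsTrap v ψ p E) (h : IsBottcher v ψ)
    (hfix : quad v p = p) (hlam : ‖2 * p‖ = 1) (n : ℕ) :
    (quad v)^[n] v ∈ interior (filled v) := by
  induction n with
  | zero => exact hT.value_mem_interior h hfix hlam
  | succ n ih => rw [Function.iterate_succ_apply']; exact quad_mem_interior_iff.2 ih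

theorem frontier_inter_imp_nonempty (hT : IsTrap v ψ p E) (h : IsBottcher v ψ)
    (hfix : quad v p = p) (hlam : ‖2 * p‖ = 1) (n : ℕ) :
    (frontier (fatou v ((quad v)^[n] v)) ∩ imp v ψ E).Nonempty := by
  suffices H : (frontier (fatou v v) ∩ imp v ψ E).Nonempty by
    obtain ⟨x, hx, hxE⟩ := H
    exact ⟨(quad v)^[n] x, iterate_mem_frontier_fatou hx n, hT.iterate_mem_imp h hxE n⟩
  obtain ⟨ε, hε, hneg⟩ := hT.exists_neg_notMem_ang h
  have hv := hT.value_mem_interior h hfix hlam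
  have h1 : ∀ n : ℕ, ∃ x, x ∈ frontier (fatou v v) ∧ x ∈ ang ψ (nb E (ε * (1 / (n + 1)))) := by
    intro n
    have hle : ε * (1 / ((n : ℝ) + 1)) ≤ ε := by
      refine mul_le_of_le_one_right hε.le ?_
      rw [div_le_one (by positivity)]
      linarith [n.cast_nonneg (α := ℝ)]
    have hsub := ang_mono (ψ := ψ) (nb_mono E hle)
    obtain ⟨m, γ, B, hC⟩ := hT.exists_isCapture h hfix hlam (ε := ε * (1 / (n + 1)))
      (by positivity) (fun z hz hz' => hneg z (hsub hz) (hsub hz')) one_pos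
    exact hC.frontier_inter_nonempty hT h hv
  choose x hx hxa using h1
  have hcomp : IsCompact (frontier (fatou v v)) :=
    (isCompact_julia v).of_isClosed_subset isClosed_frontier (frontier_fatou_subset v v)
  obtain ⟨y, hy, k, hk, hxy⟩ := hcomp.tendsto_subseq hx
  have ha : Tendsto (fun n : ℕ => ε * (1 / ((n : ℝ) + 1))) atTop (𝓝 0) := by
    simpa using tendsto_one_div_succ.const_mul ε
  exact ⟨y, hy, frontier_fatou_subset v v hy,
    hT.mem_ang_of_tendsto (ha.comp hk.tendsto_atTop) (fun n => hxa (k n)) hxy⟩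

theorem not_frontier_subset_imp (hT : IsTrap v ψ p E) (h : IsBottcher v ψ)
    (hfix : quad v p = p) (hlam : ‖2 * p‖ = 1) (n : ℕ) :
    ¬ frontier (fatou v ((quad v)^[n] v)) ⊆ imp v ψ E := by
  have hclosed : IsClosed (imp v ψ E) := (isCompact_imp hT.closed).isClosed
  have key : ∀ z, frontier (fatou v (quad v z)) ⊆ imp v ψ E →
      frontier (fatou v z) ⊆ imp v ψ E ∨ frontier (fatou v z) ⊆ Neg.neg ⁻¹' imp v ψ E := by
    intro z hz
    refine frontier_fatou_subset_or hclosed (hclosed.preimage continuous_neg)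
      inter_subset_left (fun x hx => neg_mem_julia_iff.1 hx.1)
      (disjoint_left.2 fun x hx => hT.neg_notMem_imp h hx) fun x hx => ?_
    exact hT.mem_imp_or_neg h (hz (quad_mem_frontier_fatou hx))
  induction n with
  | zero =>
    intro hsub
    have h0 : quad v 0 = v := by simp [quad]
    have hv : quad v 0 ∈ interior (filled v) := by
      rw [h0]; exact hT.value_mem_interior h hfix hlam
    obtain ⟨x, hx⟩ := frontier_nonempty_of_isBounded
      ⟨0, mem_fatou (quad_mem_interior_iff.1 hv)⟩ (isBounded_fatou v 0)
    have hx' := neg_mem_frontier_fatou_zero hx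
    rcases key 0 (by rw [h0]; exact hsub) with h1 | h1
    · exact hT.neg_notMem_imp h (h1 hx) (h1 hx')
    · exact hT.neg_notMem_imp h (h1 hx) (h1 hx')
  | succ n ih =>
    intro hsub
    rw [Function.iterate_succ_apply'] at hsub
    rcases key _ hsub with h1 | h1
    · exact ih h1
    · obtain ⟨x, hx, hxE⟩ := hT.frontier_inter_imp_nonempty h hfix hlam n
      exact hT.neg_notMem_imp h hxE (h1 hx)

/-- The orbit of the critical value accumulates at the fixed point. -/
theorem exists_dist_iterate_value_lt (hT : IsTrap v ψ p E) (h : IsBottcher v ψ)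
    (hfix : quad v p = p) (hlam : ‖2 * p‖ = 1) {η : ℝ} (hη : 0 < η) :
    ∃ n, dist ((quad v)^[n] v) p < η := by
  obtain ⟨ε, hε, hneg⟩ := hT.exists_neg_notMem_ang h
  have hv := hT.value_mem_interior h hfix hlam
  obtain ⟨b, hb, hbE⟩ := not_subset.1 (hT.not_frontier_subset_imp h hfix hlam 0)
  rw [Function.iterate_zero, id] at hb
  have hbJ := frontier_fatou_subset v v hb
  obtain ⟨ε', hε', hbY⟩ := hT.exists_notMem_ang_nb fun hba => hbE ⟨hbJ, hba⟩
  have hcap : ∀ j : ℕ, ∃ n γ B, IsCapture v ψ p E (ε * (1 / (j + 1))) (1 / (j + 1)) n γ B := by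
    intro j
    have hle : ε * (1 / ((j : ℝ) + 1)) ≤ ε := by
      refine mul_le_of_le_one_right hε.le ?_
      rw [div_le_one (by positivity)]
      linarith [j.cast_nonneg (α := ℝ)]
    have hsub := ang_mono (ψ := ψ) (nb_mono E hle)
    exact hT.exists_isCapture h hfix hlam (by positivity)
      (fun z hz hz' => hneg z (hsub hz) (hsub hz')) (by positivity)
  choose n γ B hC using hcap
  set Y : Set ℂ := ang ψ (nb E ε')
  have hY : IsClosed Y := hT.isClosed_ang_nb ε'
  set D : ℕ → Set ℂ := fun j => B j ∩ (ang ψ (nb E (ε * (1 / (j + 1)))))ᶜ with hDdef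
  have hDi : ∀ j, D j ⊆ interior (filled v) := fun j x hx => by
    by_contra hi
    exact hx.2 ((hC j).inter_sub ⟨hx.1, hi⟩)
  have hDcl : ∀ j, closure (D j) ⊆ filled v := fun j =>
    closure_minimal ((hDi j).trans interior_subset) (isClosed_filled v)
  obtain ⟨δ, hδ, hball⟩ := Metric.isOpen_iff.1 hY.isOpen_compl b hbY
  obtain ⟨c, hcK, hcb⟩ := Metric.mem_closure_iff.1
    (frontier_subset_closure (by rwa [frontier_compl] : b ∈ frontier (filled v)ᶜ)) δ hδ
  obtain ⟨δ', hδ', hball'⟩ := Metric.isOpen_iff.1 (isClosed_filled v).isOpen_compl c hcK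
  obtain ⟨w, hw, hwb⟩ := Metric.mem_closure_iff.1 (frontier_subset_closure hb) δ hδ
  have hpre : IsPreconnected (fatou v v ∪ ball b δ) :=
    (isPreconnected_fatou v v).union w hw (mem_ball'.2 hwb) (convex_ball b δ).isPreconnected
  have hdisj : Disjoint (fatou v v ∪ ball b δ) Y := by
    rw [disjoint_left]
    rintro x (hx | hx) hxY
    · exact h.ang_subset _ hxY (fatou_subset v v hx)
    · exact hball hx hxY
  have hr : Tendsto (fun j : ℕ => 1 / ((j : ℝ) + 1)) atTop (𝓝 0) := tendsto_one_div_succ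
  have hεj : Tendsto (fun j : ℕ => ε * (1 / ((j : ℝ) + 1))) atTop (𝓝 0) := by
    simpa using hr.const_mul ε
  have hmain := eventually_norm_le_of_frontier (D := D)
    (F := fun j z => (quad v)^[n j] z - p) (Y := Y) (M := ‖v‖ + 2 + ‖p‖)
    (fun j => (hC j).isOpen.inter (hT.isClosed_ang_nb _).isOpen_compl)
    (fun j => (differentiable_iterate_quad v (n j)).sub_const p)
    (fun j z hz => (norm_sub_le _ _).trans (add_le_add_left
      (norm_le_of_mem_filled (iterate_mem_filled (hDcl j hz) (n j))) _)) hY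
    (fun η hη => by
      filter_upwards [hr.eventually (gt_mem_nhds hη), hεj.eventually (gt_mem_nhds hε')]
        with j hj1 hj2 z hz hzY
      have hz' : z ∉ ang ψ (nb E (ε * (1 / (j + 1)))) := fun hz' =>
        hzY (ang_mono (nb_mono E hj2.le) hz')
      have hzγ : z ∈ γ j := by
        rcases frontier_inter_subset _ _ hz with ⟨h1, -⟩ | ⟨-, h1⟩
        · exact ((hC j).frontier_sub h1).resolve_right hz'
        · rw [frontier_compl] at h1
          exact (hz' ((hT.isClosed_ang_nb _).frontier_subset h1)).elim
      rw [← dist_eq_norm]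
      exact ((hC j).maps z hzγ).le.trans hj1.le)
    hpre hdisj (Or.inr (mem_ball'.2 hcb)) hδ'
    (fun j => disjoint_left.2 fun x hx hxD => hball' hx (interior_subset (hDi j hxD)))
    (Or.inl (mem_fatou hv)) (half_pos hη)
  obtain ⟨j, hj1, hj2⟩ := (hmain.and (hr.eventually (gt_mem_nhds hη))).exists
  refine ⟨n j, ?_⟩
  rcases (hC j).value_mem with hvB | hvγ
  · have hvD : v ∈ D j := ⟨hvB, fun hva => h.ang_subset _ hva hv⟩
    rw [dist_eq_norm]
    linarith [hj1 hvD]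
  · exact ((hC j).maps v hvγ).trans hj2

end IsTrap

end CremerJulia

namespace CremerJulia
open Set Filter Topology Metric

variable {v : ℂ}

theorem HasLog.union_of_inter_subset {f : ℂ → ℂ} {X Y : Set ℂ} (hX : IsClosed X) (hY : IsClosed Y)
    {s : ℂ} (hsX : s ∈ X) (hsY : s ∈ Y) (hXY : X ∩ Y ⊆ {s}) (hfX : HasLog f X)
    (hfY : HasLog f Y) : HasLog f (X ∪ Y) := by
  classical
  obtain ⟨l, hl, hle⟩ := hfX
  obtain ⟨m, hm, hme⟩ := hfY
  set g : ℂ → ℂ := fun z => if z ∈ X then l z else m z + (l s - m s) with hg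
  have h1 : EqOn g l X := fun z hz => if_pos hz
  have h2 : EqOn g (fun z => m z + (l s - m s)) Y := fun z hz => by
    by_cases hzX : z ∈ X
    · have hzs : z = s := hXY ⟨hzX, hz⟩
      rw [h1 hzX, hzs]
      ring
    · exact if_neg hzX
  refine ⟨g, (hl.congr h1).union_of_isClosed ((hm.add continuousOn_const).congr h2) hX hY, ?_⟩
  rintro z (hz | hz)
  · rw [h1 hz]; exact hle z hz
  · rw [h2 hz, Complex.exp_add, Complex.exp_sub, hle s hsX, hme s hsY, hme z hz,
      div_self, mul_one]
    rw [← hme s hsY]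
    exact Complex.exp_ne_zero _

/-- Two points on either side of a half-line can be joined around its end. -/
theorem hasLog_div_of_side {T : Set ℂ} (hT : IsClosed T) {s d : ℂ} {η κ : ℝ} (hη : 0 < η)
    (hκ : η < κ) (hloc : ∀ ζ : ℂ, ‖ζ‖ < κ → s + ζ * d ∈ T → 0 ≤ ζ.re ∧ ζ.im = 0) :
    HasLog (fun z => (z - (s + η * Complex.I * d)) / (z - (s - η * Complex.I * d))) T := by
  set H : Set ℂ := ball 0 κ ∩ {ζ | ζ.re < 0} with hH
  have hHc : IsPreconnected H :=
    ((convex_ball 0 κ).inter (convex_halfSpace_re_lt 0)).isPreconnected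
  have hcl : ∀ y : ℝ, |y| = η → (y * Complex.I : ℂ) ∈ closure H := by
    intro y hy
    have hlim : Tendsto (fun t : ℝ => (y * Complex.I - t : ℂ)) (𝓝[>] 0) (𝓝 (y * Complex.I)) := by
      have : Continuous fun t : ℝ => (y * Complex.I - t : ℂ) := by fun_prop
      simpa using (this.tendsto 0).mono_left nhdsWithin_le_nhds
    refine mem_closure_of_tendsto hlim ?_
    have hball : ball (0 : ℂ) κ ∈ 𝓝 (y * Complex.I) := isOpen_ball.mem_nhds (by
      simp [hy, hκ])
    filter_upwards [hlim.eventually hball, self_mem_nhdsWithin] with t ht ht0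
    exact ⟨ht, by simpa using ht0⟩
  have h1 : IsPreconnected ({(η * Complex.I : ℂ), ((-η : ℝ) * Complex.I : ℂ)} ∪ H) := by
    refine hHc.subset_closure subset_union_right (union_subset ?_ subset_closure)
    rintro x (rfl | rfl)
    · exact hcl η (abs_of_pos hη)
    · exact hcl (-η) (by rw [abs_neg, abs_of_pos hη])
  have h2 := h1.image (fun ζ : ℂ => s + ζ * d) (by fun_prop)
  refine hasLog_div hT h2 ?_ ⟨η * Complex.I, Or.inl (Or.inl rfl), rfl⟩
    ⟨(-η : ℝ) * Complex.I, Or.inl (Or.inr rfl), by push_cast; ring⟩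
  rw [disjoint_left]
  rintro _ ⟨ζ, (rfl | rfl) | hζ, rfl⟩ hT'
  · have := (hloc _ (by simp [abs_of_pos hη, hκ]) hT').2
    simp at this
    exact hη.ne' this
  · have := (hloc _ (by simp [abs_of_pos hη, hκ]) hT').2
    simp at this
    exact hη.ne' this
  · exact not_le.2 hζ.2 (hloc ζ (by simpa using hζ.1) hT').1

/-- A theta curve in the filled Julia set, all of whose complementary regions adjacent to one
edge are on one side of the other edge, does not exist. -/
theorem false_of_theta {T₁ T₂ X : Set ℂ} {x s d : ℂ} {κ : ℝ} (hκ : 0 < κ) (hd : d ≠ 0)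
    (h1 : IsCompact T₁) (h2 : IsCompact T₂) (hX : IsCompact X)
    (hK : T₁ ∪ T₂ ∪ X ⊆ filled v) (hs1 : s ∈ T₁) (hs2 : s ∈ T₂) (h12 : T₁ ∩ T₂ ⊆ {s})
    (hloc1 : ∀ ζ : ℂ, ‖ζ‖ < κ → s + ζ * d ∈ T₁ → 0 ≤ ζ.re ∧ ζ.im = 0)
    (hloc2 : ∀ ζ : ℂ, ‖ζ‖ < κ → s + ζ * d ∈ T₂ → ζ.re ≤ 0 ∧ ζ.im = 0)
    (hlocX : ∀ ζ : ℂ, ‖ζ‖ < κ → s + ζ * d ∉ X)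
    (hball : ∀ ζ : ℂ, ‖ζ‖ < κ → s + ζ * d ∈ fatou v x)
    (hray1 : ∀ τ : ℝ, 0 < τ → τ < κ → s + τ * d ∈ T₁)
    (hray2 : ∀ τ : ℝ, 0 < τ → τ < κ → s - τ * d ∈ T₂)
    (hc1 : IsPreconnected (T₁ \ {s})) (hc2 : IsPreconnected (T₂ \ {s})) (hcX : IsPreconnected X)
    (hX1 : (X ∩ T₁).Nonempty) (hX2 : (X ∩ T₂).Nonempty)
    (hWX : closure (fatou v x) ∩ X ⊆ T₁ ∪ T₂) : False := by
  set Z := T₁ ∪ T₂ ∪ X with hZ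
  have hZc : IsCompact Z := (h1.union h2).union hX
  have hsX : s ∉ X := by simpa using hlocX 0 (by simpa using hκ)
  set η := κ / 2 with hη
  have hη0 : 0 < η := half_pos hκ
  have hηκ : η < κ := half_lt_self hκ
  set a := s + η * Complex.I * d with ha
  set b := s - η * Complex.I * d with hb
  have hpre : IsPreconnected (Z \ {s}) := by
    have hZs : Z \ {s} = (T₁ \ {s} ∪ X) ∪ (T₂ \ {s}) := by
      rw [hZ, union_sdiff_distrib, union_sdiff_distrib, sdiff_singleton_eq_self hsX, union_right_comm]
    rw [hZs]
    obtain ⟨y1, hy1, hy1'⟩ := hX1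
    obtain ⟨y2, hy2, hy2'⟩ := hX2
    have hne : ∀ y ∈ X, y ∉ ({s} : Set ℂ) := fun y hy h => hsX (mem_singleton_iff.1 h ▸ hy)
    have h3 : IsPreconnected (T₁ \ {s} ∪ X) :=
      hc1.union y1 (mem_sdiff_of_mem hy1' (hne y1 hy1)) hy1 hcX
    exact h3.union y2 (Or.inr hy2) (mem_sdiff_of_mem hy2' (hne y2 hy2)) hc2
  have hlim : ∀ σ : ℝ, Tendsto (fun τ : ℝ => s + ((σ * τ : ℝ) : ℂ) * d) (𝓝[>] 0) (𝓝 s) := by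
    intro σ
    have : Continuous fun τ : ℝ => s + ((σ * τ : ℝ) : ℂ) * d := by fun_prop
    simpa using (this.tendsto 0).mono_left nhdsWithin_le_nhds
  have hre : ∀ σ τ : ℝ, ((s + ((σ * τ : ℝ) : ℂ) * d - s) / d).re = σ * τ := by
    intro σ τ
    rw [add_sub_cancel_left, mul_div_cancel_right₀ _ hd, Complex.ofReal_re]
  have hpos : s ∈ closure (Z ∩ {z | 0 < ((z - s) / d).re}) := by
    refine mem_closure_of_tendsto (hlim 1) ?_
    filter_upwards [self_mem_nhdsWithin, mem_nhdsWithin_of_mem_nhds (gt_mem_nhds hκ)] with τ h0 hτ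
    refine ⟨Or.inl (Or.inl ?_), ?_⟩
    · rw [one_mul]; exact hray1 τ h0 hτ
    · change 0 < ((s + ((1 * τ : ℝ) : ℂ) * d - s) / d).re
      rw [hre, one_mul]; exact h0
  have hneg : s ∈ closure (Z ∩ {z | ((z - s) / d).re < 0}) := by
    refine mem_closure_of_tendsto (hlim (-1)) ?_
    filter_upwards [self_mem_nhdsWithin, mem_nhdsWithin_of_mem_nhds (gt_mem_nhds hκ)] with τ h0 hτ
    refine ⟨Or.inl (Or.inr ?_), ?_⟩
    · have := hray2 τ h0 hτ
      rwa [neg_one_mul, Complex.ofReal_neg, neg_mul, ← sub_eq_add_neg]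
    · change ((s + ((-1 * τ : ℝ) : ℂ) * d - s) / d).re < 0
      rw [hre, neg_one_mul]
      exact neg_lt_zero.2 h0
  have him : ∀ ζ : ℂ, ‖ζ‖ < κ → s + ζ * d ∈ Z → ζ.im = 0 := by
    rintro ζ hζ ((hz | hz) | hz)
    · exact (hloc1 ζ hζ hz).2
    · exact (hloc2 ζ hζ hz).2
    · exact (hlocX ζ hζ hz).elim
  have hseg : ∀ y : ℝ, |y| ≤ η → s + y * Complex.I * d ∈ Z → y = 0 := by
    intro y hy hyZ
    simpa using him (y * Complex.I) (by simpa using hy.trans_lt hηκ) hyZ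
  have hjump : ∀ C : Set ℂ, IsPreconnected C → Disjoint C Z → a ∈ C → b ∈ C → False :=
    fun C hC hCZ haC hbC => false_of_jump hZc.isClosed hη0 hd (Or.inl (Or.inl hs1)) hpre hseg
      hpos hneg hC hCZ haC hbC
  have haW : a ∈ fatou v x := hball (η * Complex.I) (by simpa [abs_of_pos hη0] using hηκ)
  have hbW : b ∈ fatou v x := by
    have := hball (-(η * Complex.I)) (by simpa [abs_of_pos hη0] using hηκ)
    rwa [neg_mul, ← sub_eq_add_neg] at this
  have haZ : a ∉ Z := fun h => hη0.ne' (hseg η (abs_of_pos hη0).le h)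
  have hbZ : b ∉ Z := fun h => by
    have := hseg (-η) (by rw [abs_neg, abs_of_pos hη0]) (by
      rw [hb, sub_eq_add_neg] at h; push_cast; simpa using h)
    linarith
  have hlog : HasLog (fun z => (z - a) / (z - b)) (T₁ ∪ T₂) := by
    refine HasLog.union_of_inter_subset h1.isClosed h2.isClosed hs1 hs2 h12
      (hasLog_div_of_side h1.isClosed hη0 hηκ hloc1) ?_
    have h3 := hasLog_div_of_side (d := -d) h2.isClosed hη0 hηκ (s := s) fun ζ hζ hz => by
      have := hloc2 (-ζ) (by rwa [norm_neg]) (by rwa [neg_mul, ← mul_neg])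
      simpa using this
    refine h3.inv.congr fun z _ => ?_
    rw [inv_div, ha, hb]
    congr 1 <;> ring
  have hZo : IsOpen Zᶜ := hZc.isClosed.isOpen_compl
  have hKZ : (filled v)ᶜ ⊆ Zᶜ := compl_subset_compl.2 hK
  have hbdd : ∀ y, (connectedComponentIn Zᶜ y ∩ (filled v)ᶜ).Nonempty ∨
      connectedComponentIn Zᶜ y ⊆ filled v := by
    intro y
    by_contra! hcon
    obtain ⟨z, hz, hz'⟩ := not_subset.1 hcon.2
    exact (hcon.1 ▸ (⟨hz, hz'⟩ : z ∈ connectedComponentIn Zᶜ y ∩ (filled v)ᶜ) : z ∈ (∅ : Set ℂ))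
  have key : ∀ a' b' : ℂ, a' ∈ fatou v x → a' ∉ Z → b' ∉ Z →
      (∀ C : Set ℂ, IsPreconnected C → Disjoint C Z → a' ∈ C → b' ∈ C → False) →
      HasLog (fun z => (z - a') / (z - b')) (T₁ ∪ T₂) →
      connectedComponentIn Zᶜ a' ⊆ filled v → False := by
    intro a' b' ha' ha'Z hb'Z hj hl hsub
    set B := connectedComponentIn Zᶜ a' with hB
    have haB : a' ∈ B := mem_connectedComponentIn ha'Z
    have hBZ : B ⊆ Zᶜ := connectedComponentIn_subset _ _
    have hBo : IsOpen B := hZo.connectedComponentIn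
    have hBW : B ⊆ fatou v x := by
      have h3 : B ⊆ connectedComponentIn (interior (filled v)) a' :=
        isPreconnected_connectedComponentIn.subset_connectedComponentIn haB
          (interior_maximal hsub hBo)
      rwa [← connectedComponentIn_eq ha'] at h3
    have hfr : frontier B ⊆ Z := by simpa using frontier_connectedComponentIn_subset hZo a'
    have hbB : b' ∉ closure B := by
      intro hb'
      rw [closure_eq_self_union_frontier] at hb'
      rcases hb' with hb' | hb'
      · exact hj B isPreconnected_connectedComponentIn (disjoint_left.2 fun z hz => hBZ hz) haB hb'
      · exact hb'Z (hfr hb')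
    refine not_hasLog_frontier ((isCompact_filled v).isBounded.subset hsub) haB
      (u := fun z => z - b') (by fun_prop)
      (fun z hz h0 => hbB (sub_eq_zero.1 h0 ▸ hz)) (hl.mono fun z hz => ?_)
    rcases hfr hz with hz' | hz'
    · exact hz'
    · exact hWX ⟨closure_mono hBW (frontier_subset_closure hz), hz'⟩
  rcases hbdd a with ⟨c, hca, hcK⟩ | hsub
  · rcases hbdd b with ⟨c', hcb, hcK'⟩ | hsub
    · have hKc := (isConnected_compl_filled v).isPreconnected
      have h3 := (isPreconnected_connectedComponentIn.union c hca hcK hKc).union c' (Or.inr hcK')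
        hcb (isPreconnected_connectedComponentIn (F := Zᶜ) (x := b))
      refine hjump _ h3 ?_ (Or.inl (Or.inl (mem_connectedComponentIn haZ)))
        (Or.inr (mem_connectedComponentIn hbZ))
      rw [disjoint_left]
      rintro z ((hz | hz) | hz)
      · exact connectedComponentIn_subset _ _ hz
      · exact hKZ hz
      · exact connectedComponentIn_subset _ _ hz
    · exact key b a hbW hbZ haZ (fun C hC hCZ h3 h4 => hjump C hC hCZ h4 h3)
        (hlog.inv.congr fun z _ => inv_div _ _) hsub
  · exact key a b haW haZ hbZ hjump hlog hsub

/-- A Fatou component `fatou v x` joining two disjoint pieces of the Julia set separates the two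
sides of any continuum joining these pieces outside of it. -/
theorem false_of_fatou_access {Q F R X W' : Set ℂ} {x q z : ℂ} (hQ : IsCompact Q)
    (hQc : IsPreconnected Q) (hQJ : Q ⊆ julia v) (hFJ : F ⊆ julia v) (hQF : Disjoint Q F)
    (hR : IsCompact R) (hRc : IsPreconnected R) (hRs : R ⊆ fatou v x ∪ F) (hFR : F ⊆ R)
    (hqR : q ∈ R) (hzQ : z ∈ Q) (hseg : ∀ y ∈ segment ℝ q z, y ≠ z → y ∈ fatou v x)
    (hX : IsCompact X) (hXc : IsPreconnected X) (hXs : X ⊆ W' ∪ (Q ∪ F)) (hWo : IsOpen W')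
    (hWK : W' ⊆ interior (filled v)) (hWW : Disjoint (fatou v x) W')
    (hXQ : (X ∩ Q).Nonempty) (hXR : (X ∩ R).Nonempty) : False := by
  have hJW : ∀ y ∈ julia v, y ∉ fatou v x := fun y hy hyW =>
    (mem_julia_iff.1 hy).2 (fatou_subset v x hyW)
  have hzR : z ∉ R := fun h => (hRs h).elim (hJW z (hQJ hzQ)) (disjoint_left.1 hQF hzQ)
  have hqz : q ≠ z := fun h => hzR (h ▸ hqR)
  set d := z - q with hd
  have hd0 : d ≠ 0 := sub_ne_zero.2 hqz.symm
  have hyW : ∀ σ : ℝ, 0 < σ → σ ≤ 1 → z - σ * d ∈ fatou v x := by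
    intro σ h0 h1
    refine hseg _ ?_ fun h => ?_
    · rw [segment_symm, segment_eq_image_lineMap]
      refine ⟨σ, ⟨h0.le, h1⟩, ?_⟩
      simp only [AffineMap.lineMap_apply, vsub_eq_sub, vadd_eq_add, Complex.real_smul, hd]
      ring
    · have : (σ : ℂ) * d = 0 := by linear_combination -h
      exact mul_ne_zero (Complex.ofReal_ne_zero.2 h0.ne') hd0 this
  have hinj : ∀ a b : ℂ, z - a * d = z - b * d → a = b := fun a b h =>
    mul_right_cancel₀ hd0 (by linear_combination -h)
  obtain ⟨t, ht0, ht1, htR⟩ : ∃ t : ℝ, 0 < t ∧ t < 1 ∧ ∀ σ : ℝ, 0 ≤ σ → σ ≤ t →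
      z - σ * d ∉ R := by
    have hcont : Continuous fun σ : ℝ => z - σ * d := by fun_prop
    have h3 : ∀ᶠ σ : ℝ in 𝓝 0, z - σ * d ∉ R :=
      hcont.continuousAt.eventually (hR.isClosed.isOpen_compl.mem_nhds (by simpa using hzR))
    obtain ⟨r, hr, hr'⟩ := Metric.eventually_nhds_iff.1 h3
    refine ⟨min (r / 2) (1 / 2), by positivity, by
      linarith [min_le_right (r / 2) (1 / 2 : ℝ)], fun σ h0 h1 => hr' ?_⟩
    rw [Real.dist_eq, sub_zero, abs_of_nonneg h0]
    linarith [min_le_left (r / 2) (1 / 2 : ℝ)]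
  set s := z - t * d with hs
  have hsW : s ∈ fatou v x := hyW t ht0 ht1.le
  have hsR : s ∉ R := htR t ht0.le le_rfl
  have hsQ : s ∉ Q := fun h => hJW s (hQJ h) hsW
  have hXW : closure (fatou v x) ∩ X ⊆ Q ∪ F := by
    rintro y ⟨hy, hyX⟩
    refine (hXs hyX).resolve_left fun h => ?_
    exact disjoint_left.1 (hWW.closure_left hWo) hy h
  have hsX : s ∉ X := fun h => by
    rcases hXW ⟨subset_closure hsW, h⟩ with h | h
    · exact hsQ h
    · exact hJW s (hFJ h) hsW
  obtain ⟨κ, hκ, hκt, hκ1, hloc⟩ : ∃ κ > 0, κ ≤ t ∧ κ ≤ 1 - t ∧ ∀ ζ : ℂ, ‖ζ‖ < κ →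
      s + ζ * d ∈ fatou v x ∩ (Q ∪ R ∪ X)ᶜ := by
    have hcont : Continuous fun ζ : ℂ => s + ζ * d := by fun_prop
    have ho : IsOpen (fatou v x ∩ (Q ∪ R ∪ X)ᶜ) :=
      (isOpen_fatou v x).inter ((hQ.union hR).union hX).isClosed.isOpen_compl
    have h3 : ∀ᶠ ζ : ℂ in 𝓝 0, s + ζ * d ∈ fatou v x ∩ (Q ∪ R ∪ X)ᶜ := by
      refine hcont.continuousAt.eventually (ho.mem_nhds ?_)
      simp only [zero_mul, add_zero]
      refine ⟨hsW, ?_⟩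
      rintro ((h | h) | h)
      · exact hsQ h
      · exact hsR h
      · exact hsX h
    obtain ⟨r, hr, hr'⟩ := Metric.eventually_nhds_iff.1 h3
    have h1t : 0 < 1 - t := sub_pos.2 ht1
    refine ⟨min r (min t (1 - t)), by positivity, (min_le_right _ _).trans (min_le_left _ _),
      (min_le_right _ _).trans (min_le_right _ _), fun ζ hζ => hr' ?_⟩
    rw [dist_zero_right]
    exact hζ.trans_le (min_le_left _ _)
  set y : ℝ → ℂ := fun σ => z - σ * d with hy
  have hyc : Continuous y := by fun_prop
  have hys : ∀ σ : ℝ, y σ = s → σ = t := fun σ h => by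
    exact_mod_cast hinj σ t h
  have himg : ∀ {a b : ℝ}, y '' Icc a b \ {s} = y '' (Icc a b \ {t}) := by
    intro a b
    ext w
    constructor
    · rintro ⟨⟨σ, hσ, rfl⟩, hne⟩
      exact ⟨σ, ⟨hσ, fun h => hne (by rw [mem_singleton_iff.1 h]; rfl)⟩, rfl⟩
    · rintro ⟨σ, ⟨hσ, hne⟩, rfl⟩
      exact ⟨⟨σ, hσ, rfl⟩, fun h => hne (hys σ h)⟩
  have hζ : ∀ (ζ : ℂ) (σ : ℝ), y σ = s + ζ * d → ζ = ((t - σ : ℝ) : ℂ) := by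
    intro ζ σ h
    have := hinj (t - ζ) σ (by rw [← show y σ = z - σ * d from rfl, h, hs]; ring)
    push_cast
    linear_combination -this
  have hsubK : fatou v x ⊆ filled v := (fatou_subset v x).trans interior_subset
  have hJK := julia_subset_filled v
  refine false_of_theta (T₁ := Q ∪ y '' Icc 0 t) (T₂ := R ∪ y '' Icc t 1) (X := X) (x := x)
    (s := s) (d := d) hκ hd0 (hQ.union (isCompact_Icc.image hyc))
    (hR.union (isCompact_Icc.image hyc)) hX ?_ (Or.inr ⟨t, right_mem_Icc.2 ht0.le, rfl⟩)
    (Or.inr ⟨t, left_mem_Icc.2 ht1.le, rfl⟩) ?_ ?_ ?_ (fun ζ h3 h4 => (hloc ζ h3).2 (Or.inr h4))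
    (fun ζ h3 => (hloc ζ h3).1) ?_ ?_ ?_ ?_ hXc
    (hXQ.mono (inter_subset_inter_right _ subset_union_left))
    (hXR.mono (inter_subset_inter_right _ subset_union_left))
    (hXW.trans (union_subset_union subset_union_left (hFR.trans subset_union_left)))
  · rintro w (((hw | ⟨σ, hσ, rfl⟩) | (hw | ⟨σ, hσ, rfl⟩)) | hw)
    · exact hJK (hQJ hw)
    · rcases hσ.1.eq_or_lt with rfl | h0
      · rw [hy]
        simpa using hJK (hQJ hzQ)
      · exact hsubK (hyW σ h0 (hσ.2.trans ht1.le))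
    · rcases hRs hw with hw | hw
      · exact hsubK hw
      · exact hJK (hFJ hw)
    · exact hsubK (hyW σ (ht0.trans_le hσ.1) hσ.2)
    · rcases hXs hw with hw | hw | hw
      · exact interior_subset (hWK hw)
      · exact hJK (hQJ hw)
      · exact hJK (hFJ hw)
  · rintro w ⟨hw | ⟨σ, hσ, rfl⟩, hw' | ⟨σ', hσ', h3⟩⟩
    · rcases hRs hw' with hw' | hw'
      · exact (hJW w (hQJ hw) hw').elim
      · exact (disjoint_left.1 hQF hw hw').elim
    · exact (hJW w (hQJ hw) (h3 ▸ hyW σ' (ht0.trans_le hσ'.1) hσ'.2)).elim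
    · exact (htR σ hσ.1 hσ.2 hw').elim
    · have h4 : σ' = σ := by exact_mod_cast hinj σ' σ h3
      have h5 : σ = t := le_antisymm hσ.2 (h4 ▸ hσ'.1)
      rw [h5]; rfl
  · rintro ζ h3 (h4 | ⟨σ, hσ, h4⟩)
    · exact ((hloc ζ h3).2 (Or.inl (Or.inl h4))).elim
    · rw [hζ ζ σ h4]
      exact ⟨by rw [Complex.ofReal_re]; linarith [hσ.2], Complex.ofReal_im _⟩
  · rintro ζ h3 (h4 | ⟨σ, hσ, h4⟩)
    · exact ((hloc ζ h3).2 (Or.inl (Or.inr h4))).elim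
    · rw [hζ ζ σ h4]
      exact ⟨by rw [Complex.ofReal_re]; linarith [hσ.1], Complex.ofReal_im _⟩
  · intro τ h0 h1
    refine Or.inr ⟨t - τ, ⟨by linarith, by linarith⟩, ?_⟩
    simp only [hy, hs]
    push_cast
    ring
  · intro τ h0 h1
    refine Or.inr ⟨t + τ, ⟨by linarith, by linarith⟩, ?_⟩
    simp only [hy, hs]
    push_cast
    ring
  · rw [union_sdiff_distrib, sdiff_singleton_eq_self hsQ, himg, Icc_sdiff_right]
    refine hQc.union z hzQ ⟨0, ⟨le_rfl, ht0⟩, by simp [hy]⟩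
      (isPreconnected_Ico.image _ hyc.continuousOn)
  · rw [union_sdiff_distrib, sdiff_singleton_eq_self hsR, himg, Icc_sdiff_left]
    refine hRc.union q hqR ⟨1, ⟨ht1, le_rfl⟩, by simp [hy, hd]⟩
      (isPreconnected_Ioc.image _ hyc.continuousOn)

end CremerJulia

namespace CremerJulia
open Set Filter Topology Metric

variable {v : ℂ}

/-- `z` is the end of a segment otherwise contained in the Fatou component of `x`. -/
def IsAccessible (v x z : ℂ) : Prop :=
  z ∈ julia v ∧ ∃ q ∈ fatou v x, ∀ y ∈ segment ℝ q z, y ≠ z → y ∈ fatou v x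

theorem exists_isAccessible {x z : ℂ} (hz : z ∈ frontier (fatou v x)) {η : ℝ} (hη : 0 < η) :
    ∃ y, dist y z < η ∧ IsAccessible v x y := by
  obtain ⟨w, hw, hwz⟩ := Metric.mem_closure_iff.1 (frontier_subset_closure hz) (η / 2) (half_pos hη)
  have hzW : z ∈ (fatou v x)ᶜ := fun h => by
    rw [(isOpen_fatou v x).frontier_eq] at hz
    exact hz.2 h
  obtain ⟨y, hy, hwy, hseg⟩ := exists_nearest (isOpen_fatou v x).isClosed_compl hzW w
  have hseg' : ∀ u ∈ segment ℝ w y, u ≠ y → u ∈ fatou v x := fun u hu hne => by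
    by_contra h
    exact hne (hseg u hu h)
  refine ⟨y, ?_, frontier_fatou_subset v x ?_, w, hw, hseg'⟩
  · calc dist y z ≤ dist w y + dist w z := by
          rw [dist_comm w y]; exact dist_triangle _ _ _
      _ < η := by
          rw [dist_comm z w] at hwz
          linarith
  · rw [(isOpen_fatou v x).frontier_eq]
    refine ⟨?_, hy⟩
    have hne : w ≠ y := fun h => hy (h ▸ hw)
    have hlim : Tendsto (fun t : ℝ => AffineMap.lineMap w y t) (𝓝[<] 1) (𝓝 y) := by
      have : Continuous fun t : ℝ => (AffineMap.lineMap w y t : ℂ) := by fun_prop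
      simpa using (this.tendsto 1).mono_left nhdsWithin_le_nhds
    refine mem_closure_of_tendsto hlim ?_
    filter_upwards [self_mem_nhdsWithin,
      mem_nhdsWithin_of_mem_nhds (lt_mem_nhds (zero_lt_one' ℝ))] with t ht1 ht0
    refine hseg' _ ?_ fun h => ?_
    · rw [segment_eq_image_lineMap]
      exact ⟨t, ⟨ht0.le, (mem_Iio.1 ht1).le⟩, rfl⟩
    · rw [AffineMap.lineMap_eq_right_iff] at h
      exact h.elim hne (mem_Iio.1 ht1).ne

theorem IsAccessible.exists_continuum {x z q : ℂ} (h : IsAccessible v x z) (hq : q ∈ fatou v x) :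
    ∃ C, IsCompact C ∧ IsPreconnected C ∧ q ∈ C ∧ z ∈ C ∧ C ⊆ fatou v x ∪ {z} := by
  obtain ⟨-, q', hq', hseg⟩ := h
  have hpc : IsPathConnected (fatou v x) :=
    (isOpen_fatou v x).isConnected_iff_isPathConnected.1 ⟨⟨q, hq⟩, isPreconnected_fatou v x⟩
  obtain ⟨γ, hγ⟩ := hpc.joinedIn q hq q' hq'
  refine ⟨range γ ∪ segment ℝ q' z, (isCompact_range γ.continuous).union ?_, ?_,
    Or.inl ⟨0, γ.source⟩, Or.inr (right_mem_segment ℝ q' z), ?_⟩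
  · rw [segment_eq_image_lineMap]
    exact isCompact_Icc.image (by fun_prop)
  · exact (isPreconnected_range γ.continuous).union q' ⟨1, γ.target⟩ (left_mem_segment ℝ q' z)
      (convex_segment q' z).isPreconnected
  · rintro w (⟨t, rfl⟩ | hw)
    · exact Or.inl (hγ t)
    · by_cases hwz : w = z
      · exact Or.inr hwz
      · exact Or.inl (hseg w hw hwz)

/-- Two Fatou components each having accessible points on two disjoint subcontinua of the Julia
set coincide. -/
theorem fatou_eq_of_isAccessible {Q F : Set ℂ} (hQ : IsCompact Q) (hF : IsCompact F)
    (hQc : IsPreconnected Q) (hFc : IsPreconnected F) (hQJ : Q ⊆ julia v) (hFJ : F ⊆ julia v)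
    (hQF : Disjoint Q F) {x x' z₁ z₂ y₁ y₂ : ℂ} (h1 : IsAccessible v x z₁) (hz1 : z₁ ∈ Q)
    (h2 : IsAccessible v x z₂) (hz2 : z₂ ∈ F) (k1 : IsAccessible v x' y₁) (hy1 : y₁ ∈ Q)
    (k2 : IsAccessible v x' y₂) (hy2 : y₂ ∈ F) : fatou v x = fatou v x' := by
  by_contra hne
  have hdisj : Disjoint (fatou v x) (fatou v x') := by
    rw [disjoint_left]
    intro w hw hw'
    exact hne ((connectedComponentIn_eq hw).trans (connectedComponentIn_eq hw').symm)
  obtain ⟨-, q, hq, hseg⟩ := h1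
  obtain ⟨-, q', hq', hseg'⟩ := k1
  obtain ⟨C, hC, hCc, hqC, hzC, hCs⟩ := h2.exists_continuum hq
  obtain ⟨D, hD, hDc, hqD, hyD, hDs⟩ := k2.exists_continuum hq'
  refine false_of_fatou_access (R := C ∪ F) (X := segment ℝ q' y₁ ∪ D) (W' := fatou v x') hQ hQc
    hQJ hFJ hQF (hC.union hF) (hCc.union z₂ hzC hz2 hFc) ?_ subset_union_right (Or.inl hqC) hz1
    hseg ?_ ?_ ?_ (isOpen_fatou v x') (fatou_subset v x') hdisj
    ⟨y₁, Or.inl (right_mem_segment ℝ q' y₁), hy1⟩ ⟨y₂, Or.inr hyD, Or.inr hy2⟩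
  · refine union_subset (hCs.trans ?_) subset_union_right
    exact union_subset_union_right _ (singleton_subset_iff.2 hz2)
  · refine IsCompact.union ?_ hD
    rw [segment_eq_image_lineMap]
    exact isCompact_Icc.image (by fun_prop)
  · exact (convex_segment q' y₁).isPreconnected.union q' (left_mem_segment ℝ q' y₁) hqD hDc
  · refine union_subset (fun w hw => ?_) (hDs.trans ?_)
    · by_cases hwy : w = y₁
      · exact Or.inr (Or.inl (hwy ▸ hy1))
      · exact Or.inl (hseg' w hw hwy)
    · exact union_subset_union_right _ (singleton_subset_iff.2 (Or.inr hy2))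

theorem IsBottcher.gr_iterate {ψ : ℂ → ℂ} (h : IsBottcher v ψ) {z u : ℂ} (hz : (z, u) ∈ gr ψ)
    (n : ℕ) : ((quad v)^[n] z, u ^ 2 ^ n) ∈ gr ψ := by
  induction n with
  | zero => simpa using hz
  | succ n ih =>
    rw [Function.iterate_succ_apply', pow_succ, pow_mul]
    exact h.gr_quad ih

theorem mem_nb_singleton {u w : ℂ} {a : ℝ} : w ∈ nb {u} a ↔ w ∈ arc u a := by
  constructor
  · rintro ⟨e, rfl, hw⟩
    exact hw
  · exact fun hw => ⟨u, rfl, hw⟩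

variable {p : ℂ} {ψ : ℂ → ℂ} {E : Set ℂ}

namespace IsTrap

theorem exists_disjoint_imp_arc (hT : IsTrap v ψ p E) {u : ℂ} (hu : ‖u‖ = 1) (huE : u ∉ E) :
    ∃ a > 0, Disjoint (imp v ψ (nb E a)) (imp v ψ (arc u a)) := by
  by_contra! hcon
  have hcon' : ∀ n : ℕ, ∃ y, y ∈ imp v ψ (nb E (1 / (n + 1))) ∧ y ∈ imp v ψ (arc u (1 / (n + 1))) :=
    fun n => not_disjoint_iff.1 (hcon _ (by positivity))
  choose y hy hy' using hcon'
  choose w hw hyw using fun n => (hy' n).2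
  obtain ⟨x, hx, k, hk, hlim⟩ := (isCompact_julia v).tendsto_subseq fun n => (hy n).1
  have h0 := tendsto_one_div_succ.comp hk.tendsto_atTop
  have hxE : x ∈ ang ψ E := hT.mem_ang_of_tendsto h0 (fun n => (hy (k n)).2) hlim
  have hwu : Tendsto (fun n => w (k n)) atTop (𝓝 u) := by
    rw [tendsto_iff_dist_tendsto_zero]
    refine squeeze_zero (fun _ => dist_nonneg) (fun n => ?_) h0
    obtain ⟨e, rfl, he⟩ := exists_dist_le_of_mem_nb (E := {u}) (fun e he => by
      rw [mem_singleton_iff.1 he, hu]) (mem_nb_singleton.2 (hw (k n)))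
    exact he
  exact huE (hT.sat x u ⟨hx, hxE⟩ (isClosed_closure.mem_of_tendsto (hlim.prodMk_nhds hwu)
    (Eventually.of_forall fun n => hyw (k n))))

/-- The Fatou components along the critical orbit reach angles away from the trap. -/
theorem exists_angle_notMem_nb (hT : IsTrap v ψ p E) (h : IsBottcher v ψ)
    (hfix : quad v p = p) (hlam : ‖2 * p‖ = 1) {ε : ℝ} (hε : 0 < ε)
    (hneg : ∀ u ∈ nb E ε, -u ∉ nb E ε) (N : ℕ) :
    ∃ k ≥ N, ∃ x u, x ∈ frontier (fatou v ((quad v)^[k] v)) ∧ (x, u) ∈ gr ψ ∧ u ∉ nb E ε := by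
  obtain ⟨y, hy, hyE⟩ := not_subset.1 (hT.not_frontier_subset_imp h hfix hlam N)
  have hyJ := frontier_fatou_subset v _ hy
  obtain ⟨u, hu⟩ := h.exists_angle (mem_julia_iff.1 hyJ).2
  have huE : u ∉ E := fun huE => hyE ⟨hyJ, u, huE, hu⟩
  obtain ⟨n, hn⟩ : ∃ n : ℕ, u ^ 2 ^ n ∉ nb E ε := by
    by_contra! hcon
    exact huE (hT.mem_of_forall_pow hε hneg hcon)
  refine ⟨n + N, Nat.le_add_left _ _, (quad v)^[n] y, u ^ 2 ^ n, ?_, h.gr_iterate hu n, hn⟩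
  rw [Function.iterate_add_apply]
  exact iterate_mem_frontier_fatou hy n

/-- The critical value lies in a preperiodic Fatou component. -/
theorem exists_fatou_eq (hT : IsTrap v ψ p E) (h : IsBottcher v ψ)
    (hfix : quad v p = p) (hlam : ‖2 * p‖ = 1) :
    ∃ k l, k < l ∧ fatou v ((quad v)^[k] v) = fatou v ((quad v)^[l] v) := by
  obtain ⟨ε, hε, hneg⟩ := hT.exists_nb_neg
  choose k hkN x u hx hxu huE using hT.exists_angle_notMem_nb h hfix hlam hε hneg
  choose z hzx hz using fun n : ℕ =>
    exists_isAccessible (hx n) (η := 1 / ((n : ℝ) + 1)) (by positivity)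
  choose w hzw using fun n => h.exists_angle (mem_julia_iff.1 (hz n).1).2
  obtain ⟨⟨x', u', w'⟩, hmem, s, hs, hlim⟩ :=
    ((isCompact_julia v).prod ((isCompact_sphere (0 : ℂ) 1).prod
      (isCompact_sphere (0 : ℂ) 1))).tendsto_subseq (x := fun n => (x n, u n, w n)) fun n =>
      ⟨frontier_fatou_subset v _ (hx n), by simpa using norm_eq_one_of_mem_gr (hxu n),
        by simpa using norm_eq_one_of_mem_gr (hzw n)⟩
  have hx' : Tendsto (fun n => x (s n)) atTop (𝓝 x') := (continuous_fst.tendsto _).comp hlim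
  have hu' : Tendsto (fun n => u (s n)) atTop (𝓝 u') :=
    ((continuous_fst.comp continuous_snd).tendsto _).comp hlim
  have hw' : Tendsto (fun n => w (s n)) atTop (𝓝 w') :=
    ((continuous_snd.comp continuous_snd).tendsto _).comp hlim
  have hu'1 : ‖u'‖ = 1 := by simpa using hmem.2.1
  have hw'1 : ‖w'‖ = 1 := by simpa using hmem.2.2
  have hz' : Tendsto (fun n => z (s n)) atTop (𝓝 x') := by
    have h0 := tendsto_one_div_succ.comp hs.tendsto_atTop
    refine (tendsto_iff_of_dist ?_).2 hx'
    exact squeeze_zero (fun _ => dist_nonneg) (fun n => (hzx (s n)).le) h0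
  have hgu : (x', u') ∈ gr ψ := isClosed_closure.mem_of_tendsto (hx'.prodMk_nhds hu')
    (Eventually.of_forall fun n => hxu (s n))
  have hgw : (x', w') ∈ gr ψ := isClosed_closure.mem_of_tendsto (hz'.prodMk_nhds hw')
    (Eventually.of_forall fun n => hzw (s n))
  have hu'E : u' ∉ E := fun hmemE => by
    obtain ⟨n, hn⟩ := (hu'.eventually (eventually_mem_nb hε hmemE hu'1)).exists
    exact huE (s n) (hn (norm_eq_one_of_mem_gr (hxu (s n))))
  have hw'E : w' ∉ E := fun hmemE => hu'E (hT.sat x' u' ⟨hmem.1, w', hmemE, hgw⟩ hgu)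
  obtain ⟨a, ha, hdisj⟩ := hT.exists_disjoint_imp_arc hw'1 hw'E
  have hev : ∀ᶠ n in atTop, w (s n) ∈ arc w' a := by
    filter_upwards [hw'.eventually (eventually_mem_nb ha (mem_singleton w') hw'1)] with n hn
    exact mem_nb_singleton.1 (hn (norm_eq_one_of_mem_gr (hzw (s n))))
  obtain ⟨n, hn⟩ := hev.exists
  obtain ⟨m, hm, hkm⟩ := (hev.and ((hs.tendsto_atTop.eventually_gt_atTop (k (s n))))).exists
  have hacc : ∀ j : ℕ, ∃ y ∈ imp v ψ (nb E a), IsAccessible v ((quad v)^[j] v) y := by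
    intro j
    obtain ⟨y, hy, hyE⟩ := hT.frontier_inter_imp_nonempty h hfix hlam j
    obtain ⟨r, hr, hsub⟩ := hT.exists_ball_inter_subset h ha hyE
    obtain ⟨y', hy', hacc⟩ := exists_isAccessible hy hr
    exact ⟨y', ⟨hacc.1, hsub ⟨hy', (mem_julia_iff.1 hacc.1).2⟩⟩, hacc⟩
  obtain ⟨y₁, hy₁, hacc₁⟩ := hacc (k (s n))
  obtain ⟨y₂, hy₂, hacc₂⟩ := hacc (k (s m))
  refine ⟨k (s n), k (s m), hkm.trans_le (hkN (s m)), ?_⟩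
  exact fatou_eq_of_isAccessible (isCompact_imp (hT.isClosed_nb a))
    (isCompact_imp (isCompact_arc w' a).isClosed) (hT.isPreconnected_imp_nb h ha.le)
    (h.isConnected_imp_arc hw'1 ha.le).isPreconnected inter_subset_left inter_subset_left hdisj
    hacc₁ hy₁ (hz (s n)) ⟨(hz (s n)).1, w (s n), hn, hzw (s n)⟩
    hacc₂ hy₂ (hz (s m)) ⟨(hz (s m)).1, w (s m), hm, hzw (s m)⟩

end IsTrap

end CremerJulia

namespace CremerJulia
open Set Filter Topology Metric

theorem hasLog_of_isCompact_subset {W : Set ℂ} (hW : IsOpen W) (hWc : IsPreconnected W)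
    {f : ℂ → ℂ} (hf : ∀ X ⊆ W, IsCompact X → HasLog f X) : HasLog f W := by
  rcases W.eq_empty_or_nonempty with rfl | ⟨z₀, hz₀⟩
  · exact hf ∅ subset_rfl isCompact_empty
  have hpc : IsPathConnected W := hW.isConnected_iff_isPathConnected.1 ⟨⟨z₀, hz₀⟩, hWc⟩
  have huniq : ∀ {X Y : Set ℂ} {l m : ℂ → ℂ}, X ⊆ W → IsCompact X → IsPreconnected X → Y ⊆ W →
      IsCompact Y → IsPreconnected Y → ContinuousOn l X → (∀ z ∈ X, Complex.exp (l z) = f z) →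
      ContinuousOn m Y → (∀ z ∈ Y, Complex.exp (m z) = f z) → ∀ {z}, z₀ ∈ X → z₀ ∈ Y → z ∈ X →
      z ∈ Y → l z - l z₀ = m z - m z₀ := by
    intro X Y l m hXW hX hXc hYW hY hYc hl hle hm hme z h0X h0Y hzX hzY
    obtain ⟨M, hM, hMe⟩ := hf (X ∪ Y) (union_subset hXW hYW) (hX.union hY)
    have key : ∀ {Z : Set ℂ} {k : ℂ → ℂ}, Z ⊆ X ∪ Y → IsPreconnected Z → ContinuousOn k Z →
        (∀ z ∈ Z, Complex.exp (k z) = f z) → z₀ ∈ Z → z ∈ Z → k z - k z₀ = M z - M z₀ := by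
      intro Z k hZ hZc hk hke h0 hz
      have h1 := eq_of_exp_const hZc (f := fun x => M x - k x) ((hM.mono hZ).sub hk)
        (fun x hx y hy => by
          have h2 : ∀ w ∈ Z, Complex.exp (M w - k w) = 1 := fun w hw => by
            rw [Complex.exp_sub, hMe w (hZ hw), hke w hw, div_self]
            rw [← hke w hw]
            exact Complex.exp_ne_zero _
          rw [h2 x hx, h2 y hy]) hz h0
      linear_combination -h1
    rw [key subset_union_left hXc hl hle h0X hzX, key subset_union_right hYc hm hme h0Y hzY]
  have hex : ∀ z, ∃ (X : Set ℂ) (l : ℂ → ℂ), z ∈ W → X ⊆ W ∧ IsCompact X ∧ IsPreconnected X ∧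
      z₀ ∈ X ∧ z ∈ X ∧ ContinuousOn l X ∧ ∀ z ∈ X, Complex.exp (l z) = f z := by
    intro z
    by_cases hz : z ∈ W
    · obtain ⟨γ, hγ⟩ := hpc.joinedIn z₀ hz₀ z hz
      have hγW : range γ ⊆ W := range_subset_iff.2 hγ
      obtain ⟨l, hl, hle⟩ := hf _ hγW (isCompact_range γ.continuous)
      exact ⟨range γ, l, fun _ => ⟨hγW, isCompact_range γ.continuous,
        isPreconnected_range γ.continuous, ⟨0, γ.source⟩, ⟨1, γ.target⟩, hl, hle⟩⟩
    · exact ⟨∅, 0, fun h => (hz h).elim⟩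
  choose X l hXl using hex
  obtain ⟨c, hc⟩ : ∃ c, Complex.exp c = f z₀ := by
    obtain ⟨-, -, -, h0, -, -, h1⟩ := hXl z₀ hz₀
    exact ⟨_, h1 z₀ h0⟩
  refine ⟨fun z => l z z - l z z₀ + c, fun z hz => ContinuousAt.continuousWithinAt ?_,
    fun z hz => ?_⟩
  · obtain ⟨r, hr, hrW⟩ := nhds_basis_closedBall.mem_iff.1 (hW.mem_nhds hz)
    obtain ⟨hXW, hX, hXc, h0, hzX, -, -⟩ := hXl z hz
    have hYc : IsPreconnected (X z ∪ closedBall z r) :=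
      hXc.union z hzX (mem_closedBall_self hr.le) (convex_closedBall z r).isPreconnected
    obtain ⟨m, hm, hme⟩ := hf (X z ∪ closedBall z r) (union_subset hXW hrW)
      (hX.union (isCompact_closedBall z r))
    have hball : closedBall z r ∈ 𝓝 z := closedBall_mem_nhds z hr
    have hmc : ContinuousAt (fun y => m y - m z₀ + c) z :=
      ((hm.continuousAt (mem_of_superset hball subset_union_right)).sub continuousAt_const).add
        continuousAt_const
    refine hmc.congr ?_
    filter_upwards [hball] with y hy
    obtain ⟨hXW', hX', hXc', h0', hyX', hl', hle'⟩ := hXl y (hrW hy)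
    rw [huniq hXW' hX' hXc' (union_subset hXW hrW) (hX.union (isCompact_closedBall z r)) hYc hl'
      hle' hm hme h0' (Or.inl h0) hyX' (Or.inr hy)]
  · obtain ⟨-, -, -, h0, hzX, -, h1⟩ := hXl z hz
    rw [Complex.exp_add, Complex.exp_sub, h1 z hzX, h1 z₀ h0, hc, div_mul_cancel₀]
    rw [← hc]
    exact Complex.exp_ne_zero _

/-- A weak form of Bloch's theorem. -/
theorem norm_deriv_mul_le_of_exp_injOn {f : ℂ → ℂ} {W : Set ℂ} (hW : IsOpen W)
    (hf : DifferentiableOn ℂ f W)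
    (hinj : ∀ x ∈ W, ∀ y ∈ W, Complex.exp (f x) = Complex.exp (f y) → f x = f y) {a : ℂ} {R : ℝ}
    (hR : 0 < R) (haR : closedBall a R ⊆ W) : ‖deriv f a‖ * R ≤ 96 * Real.pi := by
  have hd : ContinuousOn (deriv f) W := (hf.deriv hW).continuousOn
  set M : ℂ → ℝ := fun w => (R - dist w a) * ‖deriv f w‖ with hM
  have hMc : ContinuousOn M (closedBall a R) :=
    ContinuousOn.mul (by fun_prop) (hd.mono haR).norm
  obtain ⟨w, hw, hmax⟩ := (isCompact_closedBall a R).exists_isMaxOn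
    ⟨a, mem_closedBall_self hR.le⟩ hMc
  have hMa : ‖deriv f a‖ * R ≤ M w := by
    have := hmax (mem_closedBall_self hR.le)
    have h2 : M a ≤ M w := this
    simp only [hM, dist_self, sub_zero] at h2 ⊢
    linarith
  rcases le_or_gt (M w) 0 with h0 | h0
  · exact hMa.trans (h0.trans (by positivity))
  have hdw : 0 < ‖deriv f w‖ := by
    rcases (norm_nonneg (deriv f w)).eq_or_lt with h1 | h1
    · simp [hM, ← h1] at h0
    · exact h1
  have hwR : 0 < R - dist w a := pos_of_mul_pos_left h0 hdw.le
  set σ := (R - dist w a) / 2 with hσ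
  have hσ0 : 0 < σ := half_pos hwR
  have hsub : ball w σ ⊆ closedBall a R := fun z hz => by
    have := dist_triangle z w a
    rw [mem_ball] at hz
    rw [mem_closedBall]
    linarith
  have hball := ball_subset_image_of_deriv_le (L := 2) hσ0 zero_le_two
    (hf.mono (hsub.trans haR)) (norm_pos_iff.1 hdw) fun z hz => by
      have h2 : M z ≤ M w := hmax (hsub hz)
      have h3 := dist_triangle z w a
      rw [mem_ball] at hz
      have h4 : σ ≤ R - dist z a := by linarith
      have h5 : σ * ‖deriv f z‖ ≤ σ * (2 * ‖deriv f w‖) := by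
        calc σ * ‖deriv f z‖ ≤ M z :=
              mul_le_mul_of_nonneg_right h4 (norm_nonneg _)
          _ ≤ M w := h2
          _ = σ * (2 * ‖deriv f w‖) := by rw [hM, hσ]; ring
      exact le_of_mul_le_mul_left h5 hσ0
  by_contra! hcon
  have hrad : 2 * Real.pi < σ * ‖deriv f w‖ / (8 * (2 + 1)) := by
    have : M w = 2 * σ * ‖deriv f w‖ := by rw [hM, hσ]; ring
    linarith
  obtain ⟨x, hx, hxw⟩ := hball (show f w + 2 * Real.pi * Complex.I ∈ _ by
    rw [mem_ball, dist_eq_norm, add_sub_cancel_left]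
    simpa [abs_of_pos Real.pi_pos] using hrad)
  have h6 := hinj x (haR (hsub hx)) w (haR hw) (by rw [hxw, Complex.exp_periodic])
  rw [hxw, add_eq_left] at h6
  exact Complex.two_pi_I_ne_zero h6

theorem exists_norm_sub_le_of_deriv_bound {W : Set ℂ} (hW : IsOpen W) (hWc : IsPreconnected W)
    {F : ℕ → ℂ → ℂ} (hF : ∀ n, DifferentiableOn ℂ (F n) W)
    (hd : ∀ z ∈ W, ∃ r > 0, ∃ L : ℝ, ∀ n, ∀ x ∈ ball z r ∩ W, ‖deriv (F n) x‖ ≤ L) {x y : ℂ}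
    (hx : x ∈ W) (hy : y ∈ W) : ∃ C : ℝ, ∀ n, ‖F n x - F n y‖ ≤ C := by
  refine hWc.induction₂ (fun a b => ∃ C : ℝ, ∀ n, ‖F n a - F n b‖ ≤ C) (fun a ha => ?_)
    (fun a b c _ _ _ h1 h2 => ?_) (fun a b _ _ h1 => ?_) hx hy
  · obtain ⟨r, hr, L, hL⟩ := hd a ha
    obtain ⟨s, hs, hsW⟩ := Metric.isOpen_iff.1 hW a ha
    have hball : ball a (min r s) ∈ 𝓝 a := ball_mem_nhds a (lt_min hr hs)
    filter_upwards [mem_nhdsWithin_of_mem_nhds hball] with b hb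
    refine ⟨L * ‖a - b‖, fun n => ?_⟩
    have hsub : ball a (min r s) ⊆ ball a r ∩ W :=
      subset_inter (ball_subset_ball (min_le_left _ _))
        ((ball_subset_ball (min_le_right _ _)).trans hsW)
    exact (convex_ball a (min r s)).norm_image_sub_le_of_norm_deriv_le
      (fun z hz => (hF n).differentiableAt (hW.mem_nhds (hsub hz).2))
      (fun z hz => hL n z (hsub hz)) hb (mem_ball_self (lt_min hr hs))
  · obtain ⟨C, hC⟩ := h1
    obtain ⟨D, hD⟩ := h2
    exact ⟨C + D, fun n => (norm_sub_le_norm_sub_add_norm_sub _ _ _).trans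
      (add_le_add (hC n) (hD n))⟩
  · obtain ⟨C, hC⟩ := h1
    exact ⟨C, fun n => by rw [norm_sub_rev]; exact hC n⟩

/-- A map without a holomorphic fixed point in a domain `W` cannot have an orbit in `W` tending to
an irrationally indifferent fixed point `p ∉ W`, when `z - p` has a logarithm on `W`. -/
theorem false_of_tendsto_iterate {W : Set ℂ} (hW : IsOpen W) (hWc : IsPreconnected W) {T : ℂ → ℂ}
    (hT : Differentiable ℂ T) (hTW : MapsTo T W W) {p : ℂ} (hTp : T p = p) {θ : ℝ}
    (hθ : Irrational θ) (hder : HasDerivAt T (Complex.exp (2 * Real.pi * Complex.I * θ)) p)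
    (hlog : HasLog (fun z => z - p) W) {z₀ : ℂ} (hz₀ : z₀ ∈ W) {t : ℕ → ℕ}
    (ht : Tendsto (fun n => T^[t n] z₀) atTop (𝓝 p)) : False := by
  obtain ⟨l, hl, hle⟩ : ∃ l, ContinuousOn l W ∧ ∀ z ∈ W, Complex.exp (l z) = z - p := hlog
  have hld : DifferentiableOn ℂ l W :=
    differentiableOn_of_exp_eq hW hl (differentiable_id.sub_const p).differentiableOn hle
  have hTn : ∀ n, MapsTo T^[n] W W := fun n => hTW.iterate n
  have hTnd : ∀ n, Differentiable ℂ T^[n] := fun n => hT.iterate n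
  set F : ℕ → ℂ → ℂ := fun n z => l (T^[t n] z) - l (T^[t n] z₀) with hF
  have hFd : ∀ n, DifferentiableOn ℂ (F n) W := fun n =>
    (hld.comp (hTnd (t n)).differentiableOn (hTn (t n))).sub_const _
  have hinj : ∀ n, ∀ x ∈ W, ∀ y ∈ W, Complex.exp (F n x) = Complex.exp (F n y) →
      F n x = F n y := by
    intro n x hx y hy hxy
    simp only [hF, Complex.exp_sub, hle _ (hTn (t n) hx), hle _ (hTn (t n) hy)] at hxy
    rw [div_left_inj' (Complex.exp_ne_zero _),
      sub_left_inj] at hxy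
    simp only [hF, hxy]
  have hFb : ∀ z ∈ W, ∃ r > 0, ∃ L : ℝ, ∀ n, ∀ x ∈ ball z r ∩ W, ‖deriv (F n) x‖ ≤ L := by
    intro z hz
    obtain ⟨r, hr, hrW⟩ := Metric.isOpen_iff.1 hW z hz
    refine ⟨r / 2, half_pos hr, 96 * Real.pi / (r / 3), fun n x hx => ?_⟩
    rw [le_div_iff₀ (by positivity)]
    refine norm_deriv_mul_le_of_exp_injOn hW (hFd n) (hinj n) (by positivity) fun y hy => hrW ?_
    have h1 := mem_ball.1 hx.1
    have h2 := mem_closedBall.1 hy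
    have h3 := dist_triangle y x z
    rw [mem_ball]
    linarith
  have hF0 : ∀ n, F n z₀ = 0 := fun n => sub_self _
  have hFbd : ∀ z ∈ W, ∃ C : ℝ, ∀ n, ‖F n z‖ ≤ C := by
    intro z hz
    obtain ⟨C, hC⟩ := exists_norm_sub_le_of_deriv_bound hW hWc hFd hFb hz hz₀
    exact ⟨C, fun n => by simpa [hF0] using hC n⟩
  obtain ⟨g, hgd, hg⟩ := exists_limit_of_deriv_bound hW hFd hFb hFbd (hyperfilter ℕ)
  have hgz : ∀ z ∈ W, Tendsto (fun n => F n z) (hyperfilter ℕ) (𝓝 (g z)) :=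
    fun z hz => hg.tendsto_at hz
  have htp : ∀ z ∈ W, Tendsto (fun n => T^[t n] z) (hyperfilter ℕ) (𝓝 p) := by
    intro z hz
    have h1 : Tendsto (fun n => Complex.exp (F n z) * (T^[t n] z₀ - p)) (hyperfilter ℕ)
        (𝓝 (Complex.exp (g z) * (p - p))) :=
      ((Complex.continuous_exp.tendsto _).comp (hgz z hz)).mul
        ((ht.mono_left Nat.hyperfilter_le_atTop).sub_const p)
    rw [sub_self, mul_zero] at h1
    have h2 := h1.add_const p
    rw [zero_add] at h2
    refine h2.congr fun n => ?_
    rw [← hle _ (hTn (t n) hz₀), ← Complex.exp_add, hF, sub_add_cancel, hle _ (hTn (t n) hz),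
      sub_add_cancel]
  have hpW : p ∉ W := fun h => Complex.exp_ne_zero _ ((hle p h).trans (sub_self p))
  have hexp : ∀ z ∈ W, Complex.exp (g (T z) - g z) =
      Complex.exp (2 * Real.pi * Complex.I * θ) := by
    intro z hz
    have h1 : Tendsto (fun n => Complex.exp (F n (T z) - F n z)) (hyperfilter ℕ)
        (𝓝 (Complex.exp (g (T z) - g z))) :=
      (Complex.continuous_exp.tendsto _).comp ((hgz _ (hTW hz)).sub (hgz z hz))
    have h2 : Tendsto (fun n => T^[t n] z) (hyperfilter ℕ) (𝓝[≠] p) :=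
      tendsto_nhdsWithin_iff.2 ⟨htp z hz, Eventually.of_forall fun n h =>
        hpW (mem_singleton_iff.1 h ▸ hTn (t n) hz)⟩
    have h3 := (hasDerivAt_iff_tendsto_slope.1 hder).comp h2
    refine tendsto_nhds_unique h1 (h3.congr fun n => ?_)
    rw [Function.comp_apply, slope_def_field, hTp, hF]
    simp only
    rw [sub_sub_sub_cancel_right, Complex.exp_sub, hle _ (hTn _ (hTW hz)), hle _ (hTn _ hz),
      ← Function.iterate_succ_apply, Function.iterate_succ_apply']
  set c := g (T z₀) - g z₀ with hc
  have hgT : ∀ z ∈ W, g (T z) - g z = c := fun z hz =>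
    eq_of_exp_const hWc (f := fun z => g (T z) - g z)
      ((hgd.continuousOn.comp hT.continuous.continuousOn hTW).sub hgd.continuousOn)
      (fun x hx y hy => by rw [hexp x hx, hexp y hy]) hz hz₀
  have hgTn : ∀ k : ℕ, ∀ z ∈ W, g (T^[k] z) = g z + k * c := by
    intro k z hz
    induction k with
    | zero => simp
    | succ k ih =>
      rw [Function.iterate_succ_apply', ← sub_add_cancel (g (T _)) (g (T^[k] z)),
        hgT _ (hTn k hz), ih]
      push_cast
      ring
  obtain ⟨m, hm⟩ := Complex.exp_eq_exp_iff_exists_int.1 (hexp z₀ hz₀)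
  rw [← hc] at hm
  set α : ℝ := θ + m with hα
  have hαirr : Irrational α := hθ.add_intCast m
  have hcα : c = 2 * Real.pi * Complex.I * α := by
    rw [hm, hα]
    push_cast
    ring
  have hα0 : α ≠ 0 := hαirr.ne_zero
  obtain ⟨a, ha, hga⟩ : ∃ a ∈ W, deriv g a ≠ 0 := by
    by_contra! hcon
    have h1 := hW.is_const_of_deriv_eq_zero hWc hgd (fun x hx => hcon x hx) (hTW hz₀) hz₀
    have h2 : (2 * Real.pi * Complex.I * α : ℂ) = 0 := by rw [← hcα, hc, h1, sub_self]
    exact mul_ne_zero Complex.two_pi_I_ne_zero (Complex.ofReal_ne_zero.2 hα0) h2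
  have hga0 : 0 < ‖deriv g a‖ := norm_pos_iff.2 hga
  obtain ⟨r, hr, L, hL⟩ := hFb a ha
  obtain ⟨r', hr', hrW⟩ := Metric.isOpen_iff.1 hW a ha
  set ρ := min r r' with hρ
  have hρ0 : 0 < ρ := lt_min hr hr'
  have hρW : ball a ρ ⊆ W := (ball_subset_ball (min_le_right _ _)).trans hrW
  have hρL : ∀ n, ∀ x ∈ ball a ρ, ‖deriv (F n) x‖ ≤ L := fun n x hx =>
    hL n x ⟨ball_subset_ball (min_le_left _ _) hx, hρW hx⟩
  have hL0 : 0 ≤ L := (norm_nonneg _).trans (hρL 0 a (mem_ball_self hρ0))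
  set b := ‖deriv g a‖ / 2 with hb
  have hb0 : 0 < b := half_pos hga0
  set s := ρ * b / (8 * (L / b + 1)) with hs
  have hs0 : 0 < s := by positivity
  have hdF : Tendsto (fun n => ‖deriv (F n) a‖) (hyperfilter ℕ) (𝓝 ‖deriv g a‖) :=
    ((hg.deriv (Eventually.of_forall hFd) hW).tendsto_at ha).norm
  have hball : ∀ᶠ n in hyperfilter ℕ, ball (F n a) s ⊆ F n '' ball a ρ := by
    filter_upwards [hdF.eventually (lt_mem_nhds (half_lt_self hga0))] with n hn
    have hn0 : 0 < ‖deriv (F n) a‖ := hb0.trans hn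
    refine (ball_subset_ball ?_).trans (ball_subset_image_of_deriv_le (L := L / b) hρ0
      (by positivity) ((hFd n).mono hρW) (norm_pos_iff.1 hn0) fun z hz => (hρL n z hz).trans ?_)
    · rw [hs]; gcongr
    · rw [div_mul_eq_mul_div, le_div_iff₀ hb0]
      gcongr
  set δ := min (s / (2 * Real.pi)) |α| with hδ
  have hδ0 : 0 < δ := lt_min (by positivity) (abs_pos.2 hα0)
  obtain ⟨n₀, hn₀⟩ := exists_nat_one_div_lt hδ0
  obtain ⟨k, hk0, -, hk⟩ := Real.exists_nat_abs_mul_sub_round_le α n₀.succ_pos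
  set N : ℤ := round (k * α) with hN
  have hkδ : |k * α - N| < δ := by
    refine hk.trans_lt (lt_of_le_of_lt ?_ hn₀)
    push_cast
    gcongr
    linarith
  have hN0 : N ≠ 0 := by
    intro h0
    rw [h0, Int.cast_zero, sub_zero, abs_mul, Nat.abs_cast] at hkδ
    have h1 : (1 : ℝ) ≤ k := by exact_mod_cast hk0
    have h2 : |α| ≤ k * |α| := le_mul_of_one_le_left (abs_nonneg _) h1
    linarith [min_le_right (s / (2 * Real.pi)) |α|]
  have hlim : Tendsto (fun n => F n (T^[k] a) - N * (2 * Real.pi * Complex.I) - F n a)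
      (hyperfilter ℕ) (𝓝 (g (T^[k] a) - N * (2 * Real.pi * Complex.I) - g a)) :=
    ((hgz _ (hTn k ha)).sub_const _).sub (hgz a ha)
  have hsmall : ‖g (T^[k] a) - N * (2 * Real.pi * Complex.I) - g a‖ < s := by
    have h1 : g (T^[k] a) - N * (2 * Real.pi * Complex.I) - g a =
        2 * Real.pi * Complex.I * ((k * α - N : ℝ) : ℂ) := by
      rw [hgTn k a ha, hcα]
      push_cast
      ring
    rw [h1, norm_mul, Complex.norm_real, Real.norm_eq_abs]
    have h2 : ‖(2 * Real.pi * Complex.I : ℂ)‖ = 2 * Real.pi := by simp [abs_of_pos Real.pi_pos]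
    rw [h2, mul_comm, ← lt_div_iff₀ (by positivity)]
    exact hkδ.trans_le (min_le_left _ _)
  obtain ⟨n, hn, hns⟩ := (hball.and (hlim.norm.eventually (gt_mem_nhds hsmall))).exists
  obtain ⟨x, hx, hxe⟩ := hn (show F n (T^[k] a) - N * (2 * Real.pi * Complex.I) ∈ _ by
    rwa [mem_ball, dist_eq_norm])
  have h7 := hinj n x (hρW hx) (T^[k] a) (hTn k ha) (by
    rw [hxe, Complex.exp_sub, Complex.exp_int_mul_two_pi_mul_I, div_one])
  rw [hxe, sub_eq_self] at h7
  exact mul_ne_zero (Int.cast_ne_zero.2 hN0) Complex.two_pi_I_ne_zero h7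

end CremerJulia

namespace CremerJulia
open Set Filter Topology Metric

variable {v p : ℂ} {ψ : ℂ → ℂ} {E : Set ℂ}

theorem iterate_mem_fatou {x z : ℂ} (hx : x ∈ fatou v z) (n : ℕ) :
    (quad v)^[n] x ∈ fatou v ((quad v)^[n] z) := by
  induction n with
  | zero => exact hx
  | succ n ih =>
    rw [Function.iterate_succ_apply', Function.iterate_succ_apply']
    exact quad_mem_fatou ih

/-- If the critical value accumulates at `p` then so does its orbit sampled along an arithmetic
progression. -/
theorem IsTrap.exists_dist_iterate_mul_lt (hT : IsTrap v ψ p E) (h : IsBottcher v ψ)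
    (hfix : quad v p = p) (hlam : ‖2 * p‖ = 1) (k : ℕ) {N : ℕ} (hN : 0 < N) {η : ℝ}
    (hη : 0 < η) : ∃ t, dist ((quad v)^[N * t] ((quad v)^[k] v)) p < η := by
  have hpint := (mem_julia_iff.1 hT.mem.1).2
  have h1 : ∀ᶠ y in 𝓝 p, ∀ i ∈ Finset.range (N + 1), dist ((quad v)^[i] y) p < η := by
    refine (Filter.eventually_all_finset _).2 fun i _ => ?_
    have hc := ((differentiable_iterate_quad v i).continuous.tendsto p)
    rw [iterate_fixed hfix] at hc
    exact hc.eventually (ball_mem_nhds p hη)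
  have h2 : ∀ᶠ y in 𝓝 p, ∀ m ∈ Finset.range k, y ≠ (quad v)^[m] v := by
    refine (Filter.eventually_all_finset _).2 fun m _ => ?_
    refine isOpen_ne.mem_nhds fun he => hpint ?_
    rw [he]
    exact hT.iterate_value_mem_interior h hfix hlam m
  obtain ⟨δ, hδ, hδp⟩ := Metric.eventually_nhds_iff.1 (h1.and h2)
  obtain ⟨n, hn⟩ := hT.exists_dist_iterate_value_lt h hfix hlam hδ
  obtain ⟨ha, hb⟩ := hδp hn
  have hkn : k ≤ n := by
    by_contra! hlt
    exact hb n (Finset.mem_range.2 hlt) rfl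
  refine ⟨(n - k) / N + 1, ?_⟩
  have hr := Nat.mod_lt (n - k) hN
  have hd := Nat.div_add_mod (n - k) N
  have hi := ha (N - (n - k) % N) (Finset.mem_range.2 (by omega))
  rw [← Function.iterate_add_apply] at hi ⊢
  have he : N * ((n - k) / N + 1) + k = N - (n - k) % N + n := by
    rw [mul_add]
    omega
  rwa [he]

/-- A neutral fixed point with irrational rotation number carries no trap. -/
theorem IsTrap.false (hT : IsTrap v ψ p E) (h : IsBottcher v ψ) (hfix : quad v p = p) {ρ : ℝ}
    (hρ : Irrational ρ) (hmult : 2 * p = Complex.exp (2 * Real.pi * Complex.I * ρ)) : False := by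
  have hlam : ‖2 * p‖ = 1 := by
    rw [hmult, Complex.norm_exp]
    simp
  obtain ⟨k, l, hkl, hW⟩ := hT.exists_fatou_eq h hfix hlam
  obtain ⟨N, rfl⟩ := Nat.exists_eq_add_of_lt hkl
  have hpint := (mem_julia_iff.1 hT.mem.1).2
  set z₀ := (quad v)^[k] v with hz₀
  have hev : ∀ j : ℕ, ∃ t, dist ((quad v)^[(N + 1) * t] z₀) p < 1 / ((j : ℝ) + 1) := fun j =>
    hT.exists_dist_iterate_mul_lt h hfix hlam k N.succ_pos (by positivity)
  choose t ht using hev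
  have hlim : Tendsto (fun n => ((quad v)^[N + 1])^[t n] z₀) atTop (𝓝 p) := by
    simp only [← Function.iterate_mul]
    rw [tendsto_iff_dist_tendsto_zero]
    exact squeeze_zero (fun _ => dist_nonneg) (fun n => (ht n).le)
      tendsto_one_div_add_atTop_nhds_zero_nat
  refine false_of_tendsto_iterate (W := fatou v z₀) (p := p)
    (θ := ((N + 1 : ℕ) : ℝ) * ρ) (isOpen_fatou v z₀) (isPreconnected_fatou v z₀)
    (differentiable_iterate_quad v (N + 1)) ?_ (iterate_fixed hfix _)
    (hρ.natCast_mul N.succ_ne_zero) ?_ ?_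
    (mem_fatou (hT.iterate_value_mem_interior h hfix hlam k)) hlim
  · intro x hx
    have h1 := iterate_mem_fatou hx (N + 1)
    rw [hz₀, ← Function.iterate_add_apply, show N + 1 + k = k + N + 1 by ring, ← hW] at h1
    exact h1
  · have h1 := hasDerivAt_iterate_quad hfix (N + 1)
    rw [hmult, ← Complex.exp_nat_mul] at h1
    convert h1 using 2
    push_cast
    ring
  · refine hasLog_of_isCompact_subset (isOpen_fatou v z₀) (isPreconnected_fatou v z₀)
      fun X hXW hX => ?_
    refine hasLog_sub_of_unbounded hX (isConnected_compl_interior v).isPreconnected ?_ ?_ hpint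
    · exact disjoint_compl_left.mono_right (hXW.trans (fatou_subset v z₀))
    · exact fun hb => not_isBounded_compl_filled v
        (hb.subset (compl_subset_compl.2 interior_subset))

/-- The equivalence relation of a monotone map onto a locally connected space. -/
theorem IsBottcher.isLamination_of_isCoinducing (h : IsBottcher v ψ) {A : Type*} [MetricSpace A]
    [LocallyConnectedSpace A] {φ : julia v → A} (hφ : Topology.IsCoinducing φ)
    (hc : Continuous φ) (hfib : ∀ a, IsConnected (φ ⁻¹' {a})) :
    IsLamination v ψ {q | ∃ x y : julia v, (x : ℂ) = q.1 ∧ (y : ℂ) = q.2 ∧ φ x = φ y} where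
  closed := by
    have : CompactSpace (julia v) := isCompact_iff_compactSpace.1 (isCompact_julia v)
    have h1 : IsClosed {q : julia v × julia v | φ q.1 = φ q.2} :=
      isClosed_eq (hc.comp continuous_fst) (hc.comp continuous_snd)
    have h2 := (h1.isCompact.image (f := Prod.map ((↑) : julia v → ℂ) ((↑) : julia v → ℂ))
      (by fun_prop)).isClosed
    convert h2 using 1
    ext ⟨a, b⟩
    constructor
    · rintro ⟨x, y, rfl, rfl, hxy⟩
      exact ⟨(x, y), hxy, rfl⟩
    · rintro ⟨⟨x, y⟩, hxy, he⟩
      obtain ⟨rfl, rfl⟩ := Prod.mk.inj he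
      exact ⟨x, y, rfl, rfl, hxy⟩
  sub := by
    rintro _ _ ⟨x, y, rfl, rfl, -⟩
    exact ⟨x.2, y.2⟩
  refl x hx := ⟨⟨x, hx⟩, ⟨x, hx⟩, rfl, rfl, rfl⟩
  symm := by
    rintro _ _ ⟨x, y, rfl, rfl, hxy⟩
    exact ⟨y, x, rfl, rfl, hxy.symm⟩
  trans := by
    rintro _ _ _ ⟨x, y, rfl, rfl, hxy⟩ ⟨y', z, hy, rfl, hyz⟩
    obtain rfl := Subtype.ext hy
    exact ⟨x, z, rfl, rfl, hxy.trans hyz⟩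
  imp u x y hx hy hxu hyu := ⟨⟨x, hx⟩, ⟨y, hy⟩, rfl, rfl,
    h.map_eq_of_mem_imp hφ hfib (norm_eq_one_of_mem_gr hxu) _ _ ⟨hx, u, rfl, hxu⟩ ⟨hy, u, rfl, hyu⟩⟩

end CremerJulia

/-- If `P(z) = z² + v` is a quadratic polynomial with a fixed Cremer point
(a non-linearizable fixed point with multiplier `e^{2πiρ}`, `ρ` irrational) and `J` is
its Julia set (the frontier of the filled Julia set), then every monotone map from `J`
onto a nonempty compact connected locally connected metric space `A` has degenerate
image: `A` is a single point. -/
theorem cremer_julia_monotone_image_degenerate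
    (v p : ℂ) (ρ : ℝ) (hρ : Irrational ρ)
    (P : ℂ → ℂ) (hP : P = fun z : ℂ => z ^ 2 + v)
    (hfix : P p = p)
    (hmult : deriv P p = Complex.exp (2 * Real.pi * Complex.I * (ρ : ℂ)))
    (hnonlin : ¬ ∃ (U : Set ℂ) (h : ℂ → ℂ), IsOpen U ∧ p ∈ U ∧
      DifferentiableOn ℂ h U ∧ Set.InjOn h U ∧ h p = 0 ∧
      ∀ z ∈ U, P z ∈ U → h (P z) = deriv P p * h z)
    (J : Set ℂ)
    (hJ : J = frontier {z : ℂ | Bornology.IsBounded (Set.range fun n : ℕ => P^[n] z)})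
    (A : Type*) [MetricSpace A] [CompactSpace A] [ConnectedSpace A]
    [LocallyConnectedSpace A] [Nonempty A]
    (φ : J → A) (hφcont : Continuous φ) (hφsurj : Function.Surjective φ)
    (hφmono : ∀ a : A, IsConnected (φ ⁻¹' {a})) :
    Subsingleton A := by
  have hPq : P = CremerJulia.quad v := hP
  subst hPq
  have hder : deriv (CremerJulia.quad v) p = 2 * p := (CremerJulia.hasDerivAt_quad p).deriv
  rw [hder] at hmult hnonlin
  have hJv : J = CremerJulia.julia v := hJ
  subst hJv
  have : CompactSpace (CremerJulia.julia v) :=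
    isCompact_iff_compactSpace.1 (CremerJulia.isCompact_julia v)
  have hφ : Topology.IsCoinducing φ :=
    (hφcont.isClosedMap.isQuotientMap hφcont hφsurj).isCoinducing
  have hconn : IsConnected (CremerJulia.julia v) := by
    rw [isConnected_iff_connectedSpace, connectedSpace_iff_univ]
    exact hφ.isConnected_preimage_of_isClosed hφmono isClosed_univ isConnected_univ
  obtain ⟨ψ, hψ⟩ := CremerJulia.exists_isBottcher (CremerJulia.zero_mem_filled hconn)
  have hlam : ‖2 * p‖ = 1 := by
    rw [hmult, Complex.norm_exp]
    simp
  have hpJ : p ∈ CremerJulia.julia v := CremerJulia.mem_julia_iff.2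
    ⟨CremerJulia.mem_filled_of_fixed hfix,
      fun hp => hnonlin (CremerJulia.exists_linearization hfix hlam hp)⟩
  refine ⟨fun a b => by_contra fun hab => ?_⟩
  obtain ⟨x, rfl⟩ := hφsurj a
  obtain ⟨y, rfl⟩ := hφsurj b
  obtain ⟨E, hE⟩ := hψ.exists_isTrap (hψ.isLamination_of_isCoinducing hφ hφcont hφmono)
    x.2 y.2 (fun ⟨x', y', hx, hy, he⟩ => hab (by
      rwa [Subtype.ext hx, Subtype.ext hy] at he)) hfix hpJ
  exact hE.false hψ hfix hρ hmult
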